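/- arXiv:math/0608204 — 5 statements merged into one kernel-verified Lean document; each statement's English description precedes it below -/
import Mathlib

section
/- For any continuous function f : S² → ℝ and any real number r with 0 < r < 2, there exist points x, y ∈ S² such that the Euclidean distance between x and y equals r and f(x) = f(-x) = f(y) = f(-y). -/
open Complex in
theorem Complex.exists_continuous_exp_eq {X : Type*} [TopologicalSpace X]
    [LocallyPathConnectedSpace X] [SimplyConnectedSpace X] {φ : X → ℂ} (hφ : Continuous φ)
    (h0 : ∀ x, φ x ≠ 0) : ∃ L : X → ℂ, Continuous L ∧ ∀ x, exp (L x) = φ x := by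
  obtain ⟨x₀⟩ : Nonempty X := inferInstance
  obtain ⟨L, ⟨-, hL⟩, -⟩ := isCoveringMapOn_exp.existsUnique_continuousMap_lifts
    ⟨φ, hφ⟩ (exp_log (h0 x₀)) h0
  exact ⟨L, L.continuous, fun x ↦ congrFun hL x⟩

open Complex in
theorem Complex.eq_of_exp_comp_eq {X : Type*} [TopologicalSpace X] [PreconnectedSpace X]
    {L M : X → ℂ} (hL : Continuous L) (hM : Continuous M) (h : ∀ x, exp (L x) = exp (M x))
    (a : X) (ha : L a = M a) (x : X) : L x = M x :=
  congrFun (isCoveringMap_exp.eq_of_comp_eq hL hM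
    (funext fun x ↦ Subtype.ext (h x)) a ha) x

open Complex in
/-- The **Borsuk–Ulam theorem** in dimension two. -/
theorem borsuk_ulam_sphere_two
    {φ : Metric.sphere (0 : EuclideanSpace ℝ (Fin 3)) 1 → ℂ} (hφ : Continuous φ)
    (hodd : ∀ x, φ (-x) = -φ x) : ∃ x, φ x = 0 := by
  by_contra! h0
  let P : ℝ × ℝ → Metric.sphere (0 : EuclideanSpace ℝ (Fin 3)) 1 := fun q ↦
    ⟨!₂[Real.sin q.1 * Real.cos q.2, Real.sin q.1 * Real.sin q.2, Real.cos q.1], by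
      simp only [mem_sphere_zero_iff_norm, EuclideanSpace.norm_eq, Fin.sum_univ_three,
        Real.norm_eq_abs, sq_abs, Real.sqrt_eq_one]
      simp only [Matrix.cons_val]
      linear_combination Real.sin q.1 ^ 2 * Real.sin_sq_add_cos_sq q.2 +
        Real.sin_sq_add_cos_sq q.1⟩
  have hP : Continuous P := by
    refine Continuous.subtype_mk ((PiLp.continuous_toLp 2 _).comp ?_) _
    refine continuous_pi fun i ↦ ?_
    fin_cases i <;> simp <;> fun_prop
  have hPneg (p θ : ℝ) : P (Real.pi - p, θ + Real.pi) = -P (p, θ) := by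
    ext i
    fin_cases i <;> simp [P]
  have hP0 (θ : ℝ) : P (0, θ) = P (0, 0) := by
    ext i
    fin_cases i <;> simp [P]
  obtain ⟨L, hL, hexp⟩ := exists_continuous_exp_eq (hφ.comp hP) fun q ↦ h0 (P q)
  simp only [Function.comp_apply] at hexp
  set c : ℂ := L (Real.pi, Real.pi) - L (0, 0) with hc
  have hstep (p θ : ℝ) : L (Real.pi - p, θ + Real.pi) = L (p, θ) + c := by
    refine eq_of_exp_comp_eq (X := ℝ × ℝ)
      (L := fun q ↦ L (Real.pi - q.1, q.2 + Real.pi)) (M := fun q ↦ L q + c)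
      (by fun_prop) (by fun_prop) (fun q ↦ ?_) (0, 0) (by simp [hc]) (p, θ)
    have h1 := hPneg 0 0
    simp only [sub_zero, zero_add] at h1
    rw [exp_add, hc, exp_sub, hexp, hexp, hexp, hexp, hPneg, hodd, h1, hodd,
      neg_div, div_self (h0 _)]
    simp
  have hconst (θ : ℝ) : L (0, θ) = L (0, 0) := by
    refine eq_of_exp_comp_eq (L := fun θ : ℝ ↦ L (0, θ)) (M := fun _ ↦ L (0, 0))
      (by fun_prop) continuous_const (fun θ ↦ ?_) 0 rfl θ
    rw [hexp, hexp, hP0]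
  have h1 := hstep 0 0
  have h2 := hstep Real.pi Real.pi
  simp only [sub_zero, zero_add, sub_self] at h1 h2
  have hc0 : c = 0 := by
    rw [hconst, h1] at h2
    linear_combination (-1 / 2 : ℂ) * h2
  have h3 := hPneg 0 0
  simp only [sub_zero, zero_add] at h3
  have h4 : φ (-P (0, 0)) = φ (P (0, 0)) := by
    rw [← h3, ← hexp, ← hexp, h1, hc0, add_zero]
  rw [hodd, neg_eq_self] at h4
  exact h0 _ h4

open Complex in
theorem Complex.log_I_mul {z : ℂ} (hre : 0 ≤ z.re) (hz : z ≠ 0) :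
    log (I * z) = log z + Real.pi / 2 * I := by
  have h := abs_le.1 (abs_arg_le_pi_div_two_iff.2 hre)
  have := Real.pi_pos
  rw [log_mul I_ne_zero hz ⟨by rw [arg_I]; linarith, by rw [arg_I]; linarith⟩, log_I, add_comm]

open Complex in
theorem Complex.sub_eq_log_sub_log {X : Type*} [TopologicalSpace X] [PreconnectedSpace X]
    {L : X → ℂ} (hL : Continuous L) {c : ℂ} (hc : c ≠ 0)
    (h : ∀ x, c * exp (L x) ∈ slitPlane) (x y : X) :
    L x - L y = log (c * exp (L x)) - log (c * exp (L y)) := by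
  have := eq_of_exp_comp_eq (L := fun t ↦ log (c * exp (L t)))
    (M := fun t ↦ L t + (log (c * exp (L y)) - L y))
    (Continuous.clog (by fun_prop) h) (by fun_prop) (fun t ↦ by
      rw [exp_log (slitPlane_ne_zero (h t)), exp_add, exp_sub,
        exp_log (slitPlane_ne_zero (h y))]
      field_simp [exp_ne_zero]) y (by ring) x
  linear_combination -this

open Complex in
/-- The **Poincaré–Miranda theorem** on the unit square. -/
theorem poincare_miranda_unit_square {u v : ℝ × ℝ → ℝ} (hu : Continuous u) (hv : Continuous v)
    (hleft : ∀ t ∈ Set.Icc (0 : ℝ) 1, 0 ≤ u (0, t))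
    (hright : ∀ t ∈ Set.Icc (0 : ℝ) 1, u (1, t) ≤ 0)
    (hbot : ∀ s ∈ Set.Icc (0 : ℝ) 1, v (s, 0) < 0)
    (htop : ∀ s ∈ Set.Icc (0 : ℝ) 1, 0 < v (s, 1)) :
    ∃ s ∈ Set.Icc (0 : ℝ) 1, ∃ t ∈ Set.Icc (0 : ℝ) 1, u (s, t) = 0 ∧ v (s, t) = 0 := by
  by_contra! h
  let p : ℝ → ℝ := fun t ↦ max 0 (min 1 t)
  have hp : Continuous p := by fun_prop
  have hpmem (t : ℝ) : p t ∈ Set.Icc (0 : ℝ) 1 := by simp [p]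
  have hp0 : p 0 = 0 := by simp [p]
  have hp1 : p 1 = 1 := by simp [p]
  let φ : ℝ × ℝ → ℂ := fun q ↦ u (p q.1, p q.2) + v (p q.1, p q.2) * I
  have hre (q) : (φ q).re = u (p q.1, p q.2) := by simp [φ]
  have him (q) : (φ q).im = v (p q.1, p q.2) := by simp [φ]
  have hφ : Continuous φ := by fun_prop
  have hφ0 (q) : φ q ≠ 0 := fun hq ↦
    h _ (hpmem q.1) _ (hpmem q.2) (by rw [← hre, hq, zero_re]) (by rw [← him, hq, zero_im])
  obtain ⟨L, hL, hexp⟩ := exists_continuous_exp_eq hφ hφ0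
  have hslit {z : ℂ} (h0 : z ≠ 0) (hz : 0 ≤ z.re) : z ∈ slitPlane := by
    rw [mem_slitPlane_iff_not_le_zero, nonpos_iff]
    exact fun hz' ↦ h0 (Complex.ext (le_antisymm hz'.1 hz) hz'.2)
  have hl (t : ℝ) : 0 ≤ (φ (0, t)).re := by rw [hre]; simpa [hp0] using hleft _ (hpmem t)
  have hr (t : ℝ) : (φ (1, t)).re ≤ 0 := by rw [hre]; simpa [hp1] using hright _ (hpmem t)
  have hb (s : ℝ) : (φ (s, 0)).im < 0 := by rw [him]; simpa [hp0] using hbot _ (hpmem s)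
  have ht (s : ℝ) : 0 < (φ (s, 1)).im := by rw [him]; simpa [hp1] using htop _ (hpmem s)
  have e1 := sub_eq_log_sub_log (L := fun t : ℝ ↦ L (0, t)) (by fun_prop) (one_ne_zero)
    (fun t ↦ hslit (by simp) (by simpa [hexp] using hl t)) 1 0
  have e2 := sub_eq_log_sub_log (L := fun s : ℝ ↦ L (s, 1)) (by fun_prop) (neg_ne_zero.2 I_ne_zero)
    (fun t ↦ hslit (by simp) (by simpa [hexp] using (ht t).le)) 1 0
  have e3 := sub_eq_log_sub_log (L := fun t : ℝ ↦ L (1, t)) (by fun_prop)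
    (neg_ne_zero.2 one_ne_zero) (fun t ↦ hslit (by simp) (by simpa [hexp] using hr t)) 0 1
  have e4 := sub_eq_log_sub_log (L := fun s : ℝ ↦ L (s, 0)) (by fun_prop) I_ne_zero
    (fun t ↦ hslit (by simp) (by simpa [hexp] using (hb t).le)) 0 1
  simp only [hexp, one_mul, neg_one_mul] at e1 e2 e3 e4
  have f1 := log_I_mul (z := -I * φ (0, 1)) (by simpa using (ht 0).le) (by simp [hφ0])
  have f2 := log_I_mul (z := φ (0, 0)) (hl 0) (hφ0 _)
  have f3 := log_I_mul (z := -φ (1, 1)) (by simpa using hr 1) (by simp [hφ0])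
  have f4 := log_I_mul (z := I * φ (1, 0)) (by simpa using (hb 1).le) (by simp [hφ0])
  rw [← mul_assoc, mul_neg, I_mul_I, neg_neg, one_mul] at f1
  rw [mul_neg, ← neg_mul] at f3
  rw [← mul_assoc, I_mul_I, neg_one_mul] at f4
  have : 2 * Real.pi * I = 0 := by linear_combination -(e1 + e2 + e3 + e4 + f1 + f2 + f3 + f4)
  exact two_pi_I_ne_zero this

open Complex in
/-- Near the zero set of an odd function on the sphere, some point can be joined to its antipode. -/
theorem exists_joinedIn_neg_of_odd {g : Metric.sphere (0 : EuclideanSpace ℝ (Fin 3)) 1 → ℝ}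
    (hg : Continuous g) (hodd : ∀ x, g (-x) = -g x) {ε : ℝ} (hε : 0 < ε) :
    ∃ x, JoinedIn {y | |g y| < ε} x (-x) := by
  classical
  have : LocallyPathConnectedSpace (Metric.sphere (0 : EuclideanSpace ℝ (Fin 3)) 1) := by
    have : Fact (Module.finrank ℝ (EuclideanSpace ℝ (Fin 3)) = 2 + 1) := ⟨by simp⟩
    exact ChartedSpace.locallyPathConnectedSpace (EuclideanSpace ℝ (Fin 2)) _
  by_contra! h
  set U := {y | |g y| < ε} with hU
  have hUo : IsOpen U := isOpen_lt (by fun_prop) continuous_const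
  have hUneg {x} (hx : x ∈ U) : -x ∈ U := by simpa [hU, hodd] using hx
  let C := pathComponentIn U
  have hC {x y} (hxy : y ∈ C x) : C y = C x := pathComponentIn_congr hxy
  have hCneg {x y} (hxy : y ∈ C x) : C (-y) = C (-x) := by
    obtain ⟨γ, hγ⟩ := hxy
    exact hC ⟨γ.map continuous_neg, fun t ↦ hUneg (hγ t)⟩
  have hCne {x} (hx : x ∈ U) : C x ≠ C (-x) := fun hEq ↦
    h x (hEq ▸ mem_pathComponentIn_self (hUneg hx) : -x ∈ C x)
  let σ : Metric.sphere (0 : EuclideanSpace ℝ (Fin 3)) 1 → ℝ := fun x ↦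
    if WellOrderingRel (C x) (C (-x)) then 1 else -1
  have hσ (x) : σ x = 1 ∨ σ x = -1 := by simp only [σ]; split_ifs <;> simp
  have hσneg {x} (hx : x ∈ U) : σ (-x) = -σ x := by
    have := hCne hx
    simp only [σ, neg_neg]
    rcases trichotomous_of WellOrderingRel (C x) (C (-x)) with h1 | h1 | h1
    · simp [h1, asymm h1]
    · exact absurd h1 this
    · simp [h1, asymm h1]
  let m : Metric.sphere (0 : EuclideanSpace ℝ (Fin 3)) 1 → ℝ := fun x ↦ max 0 (ε - |g x|)
  have hm : Continuous m := by fun_prop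
  have hm0 {x} (hx : x ∉ U) : m x = 0 := by simpa [m, hU] using hx
  have hσm : Continuous fun x ↦ σ x * m x := by
    refine continuous_iff_continuousAt.2 fun x ↦ ?_
    by_cases hx : x ∈ U
    · have : (fun y ↦ σ x * m y) =ᶠ[nhds x] fun y ↦ σ y * m y := by
        filter_upwards [(hUo.pathComponentIn x).mem_nhds (mem_pathComponentIn_self hx)] with y hy
        simp only [σ, hC hy, hCneg hy]
      exact (by fun_prop : ContinuousAt (fun y ↦ σ x * m y) x).congr this
    · rw [ContinuousAt, hm0 hx, mul_zero]
      refine squeeze_zero_norm (a := m) (fun y ↦ ?_) (hm0 hx ▸ hm.tendsto x)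
      have : 0 ≤ m y := le_max_left _ _
      rcases hσ y with h | h <;> simp [h, abs_of_nonneg this]
  obtain ⟨x, hx⟩ := borsuk_ulam_sphere_two (φ := fun x ↦ (g x : ℂ) + (σ x * m x : ℝ) * I)
    (by fun_prop) (fun x ↦ by
      have : σ (-x) * m (-x) = -(σ x * m x) := by
        have hmneg : m (-x) = m x := by simp [m, hodd]
        by_cases hx : x ∈ U
        · rw [hσneg hx, hmneg, neg_mul]
        · simp [hmneg, hm0 hx]
      rw [this, hodd]
      push_cast
      ring)
  have h1 : g x = 0 := by simpa using congrArg re hx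
  have h2 : σ x * m x = 0 := by simpa using congrArg im hx
  have h3 : m x = ε := by simp [m, h1, hε.le]
  rcases hσ x with h | h <;> simp [h, h3, hε.ne'] at h2

/-- An even function takes equal values at two points at prescribed distance on any path
joining a point of the sphere to its antipode, up to replacing points by antipodes. -/
theorem exists_dist_eq_of_joinedIn_neg
    {U : Set (Metric.sphere (0 : EuclideanSpace ℝ (Fin 3)) 1)} (hU : ∀ x ∈ U, -x ∈ U)
    {e : Metric.sphere (0 : EuclideanSpace ℝ (Fin 3)) 1 → ℝ} (he : Continuous e)
    (heven : ∀ x, e (-x) = e x) {x₀ : Metric.sphere (0 : EuclideanSpace ℝ (Fin 3)) 1}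
    (hx₀ : JoinedIn U x₀ (-x₀)) {r : ℝ} (hr0 : 0 < r) (hr2 : r < 2) :
    ∃ x ∈ U, ∃ y ∈ U, dist x y = r ∧ e x = e y := by
  obtain ⟨γ, hγ⟩ := hx₀
  let Γ : ℝ → Metric.sphere (0 : EuclideanSpace ℝ (Fin 3)) 1 := fun t ↦
    if t ≤ 1 then γ.extend t else -γ.extend (t - 1)
  have hΓ : Continuous Γ := by
    refine Continuous.if_le (by fun_prop) (by fun_prop) (by fun_prop) (by fun_prop) ?_
    rintro t rfl
    simp
  have hγU (t : ℝ) : γ.extend t ∈ U := hγ (Set.projIcc 0 1 zero_le_one t)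
  have hΓU (t : ℝ) : Γ t ∈ U := by
    simp only [Γ]
    split_ifs
    exacts [hγU _, hU _ (hγU _)]
  have hΓ_of_le {t : ℝ} (ht : t ≤ 1) : Γ t = γ.extend t := if_pos ht
  have hΓneg {t : ℝ} (ht : t ∈ Set.Icc (0 : ℝ) 1) : Γ (t + 1) = -Γ t := by
    rcases ht.1.eq_or_lt with rfl | h
    · simp [Γ]
    · simp [Γ, ht.2, h]
  have heΓ (t : ℝ) : ∃ i : unitInterval, e (Γ t) = e (γ i) := by
    simp only [Γ]
    split_ifs
    exacts [⟨_, rfl⟩, ⟨_, heven _⟩]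
  have hγe : Continuous fun i ↦ e (γ i) := by fun_prop
  obtain ⟨a, -, ha⟩ := isCompact_univ.exists_isMinOn Set.univ_nonempty hγe.continuousOn
  obtain ⟨b, -, hb⟩ := isCompact_univ.exists_isMaxOn Set.univ_nonempty hγe.continuousOn
  have hmin (t : ℝ) : e (Γ a) ≤ e (Γ t) := by
    obtain ⟨i, hi⟩ := heΓ t
    rw [hi, hΓ_of_le a.2.2, γ.extend_apply a.2]
    exact ha (Set.mem_univ i)
  have hmax (t : ℝ) : e (Γ t) ≤ e (Γ b) := by
    obtain ⟨i, hi⟩ := heΓ t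
    rw [hi, hΓ_of_le b.2.2, γ.extend_apply b.2]
    exact hb (Set.mem_univ i)
  let w : ℝ → ℝ := fun s ↦ (1 - s) * a + s * b
  have hw : Continuous w := by fun_prop
  have hw0 : w 0 = a := by simp [w]
  have hw1 : w 1 = b := by simp [w]
  have hwmem {s : ℝ} (hs : s ∈ Set.Icc (0 : ℝ) 1) : w s ∈ Set.Icc (0 : ℝ) 1 :=
    convex_Icc (0 : ℝ) 1 a.2 b.2 (sub_nonneg.2 hs.2) hs.1 (by ring)
  obtain ⟨s, -, t, -, h1, h2⟩ := poincare_miranda_unit_square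
    (u := fun q ↦ e (Γ (w q.1 + q.2)) - e (Γ (w q.1)))
    (v := fun q ↦ dist (Γ (w q.1)) (Γ (w q.1 + q.2)) - r)
    (by fun_prop) (by fun_prop) (fun t _ ↦ by simpa [hw0] using hmin _)
    (fun t _ ↦ by simpa [hw1] using hmax _) (fun s _ ↦ by simpa using hr0)
    (fun s hs ↦ by
      have : dist (Γ (w s)) (-Γ (w s)) = 2 := by
        rw [Subtype.dist_eq, coe_neg_sphere, dist_eq_norm, sub_neg_eq_add, ← two_smul ℝ,
          norm_smul, norm_eq_of_mem_sphere]
        norm_num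
      rw [hΓneg (hwmem hs), this]
      linarith)
  exact ⟨_, hΓU _, _, hΓU _, sub_eq_zero.1 h2, (sub_eq_zero.1 h1).symm⟩


/-- Livesay–Zarankiewicz: for continuous `f : S² → ℝ` and any `0 < r < 2` there are points
`x, y` on the sphere at Euclidean distance `r` with `f x = f (-x) = f y = f (-y)`. -/
theorem livesay_zarankiewicz (f : Metric.sphere (0 : EuclideanSpace ℝ (Fin 3)) 1 → ℝ)
    (hf : Continuous f) (r : ℝ) (hr0 : 0 < r) (hr2 : r < 2) :
    ∃ x y : Metric.sphere (0 : EuclideanSpace ℝ (Fin 3)) 1,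
      dist (x : EuclideanSpace ℝ (Fin 3)) (y : EuclideanSpace ℝ (Fin 3)) = r ∧
      f x = f (-x) ∧ f x = f y ∧ f y = f (-y) := by

  let g : Metric.sphere (0 : EuclideanSpace ℝ (Fin 3)) 1 → ℝ := fun x ↦ f x - f (-x)
  let e : Metric.sphere (0 : EuclideanSpace ℝ (Fin 3)) 1 → ℝ := fun x ↦ f x + f (-x)
  have hg : Continuous g := by fun_prop
  have he : Continuous e := by fun_prop
  have hodd (x) : g (-x) = -g x := by simp [g]
  have heven (x) : e (-x) = e x := by simp [e, add_comm]
  have happrox {ε : ℝ} (hε : 0 < ε) :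
      ∃ x y, dist x y = r ∧ e x = e y ∧ |g x| < ε ∧ |g y| < ε := by
    obtain ⟨x₀, hx₀⟩ := exists_joinedIn_neg_of_odd hg hodd hε
    obtain ⟨x, hx, y, hy, h⟩ := exists_dist_eq_of_joinedIn_neg
      (fun x hx ↦ by simpa [hodd] using hx) he heven hx₀ hr0 hr2
    exact ⟨x, y, h.1, h.2, hx, hy⟩
  have hK : IsCompact {q : Metric.sphere (0 : EuclideanSpace ℝ (Fin 3)) 1 ×
      Metric.sphere (0 : EuclideanSpace ℝ (Fin 3)) 1 | dist q.1 q.2 = r ∧ e q.1 = e q.2} :=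
    ((isClosed_eq (by fun_prop) (by fun_prop)).inter
      (isClosed_eq (by fun_prop) (by fun_prop))).isCompact
  obtain ⟨⟨x, y⟩, ⟨hd, hxy⟩, hmin⟩ := hK.exists_isMinOn
    (let ⟨x, y, h1, h2, _⟩ := happrox one_pos; ⟨(x, y), h1, h2⟩)
    (f := fun q ↦ max |g q.1| |g q.2|) (by fun_prop)
  have hle : max |g x| |g y| ≤ 0 := by
    by_contra! hpos
    obtain ⟨x', y', h1, h2, h3, h4⟩ := happrox hpos
    exact (hmin (show (x', y') ∈ _ from ⟨h1, h2⟩)).not_gt (max_lt h3 h4)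
  have hx : g x = 0 := abs_nonpos_iff.1 ((le_max_left _ _).trans hle)
  have hy : g y = 0 := abs_nonpos_iff.1 ((le_max_right _ _).trans hle)
  simp only [g, e] at hx hy hxy
  exact ⟨x, y, hd, by linarith, by linarith, by linarith⟩
end

section
/- Let P be a simple closed curve (a subset of S² homeomorphic to the circle). Then S² \ P has exactly two connected components, each of which is open and has P as its boundary. -/
namespace JordanCurve

open Set Topology Complex

/-- A nonvanishing function homotopic to the constant `1` through nonvanishing functions
has a continuous logarithm. -/
theorem exists_log_of_homotopy {X : Type*} [TopologicalSpace X] (H : C(unitInterval × X, ℂ))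
    (hH : ∀ y, H y ≠ 0) (h0 : ∀ x, H (0, x) = 1) :
    ∃ g : C(X, ℂ), ∀ x, exp (g x) = H (1, x) := by
  let H' : C(unitInterval × X, {z : ℂ // z ≠ 0}) := ⟨fun y ↦ ⟨H y, hH y⟩, by fun_prop⟩
  have hH0 : ∀ x, H' (0, x) = ⟨exp ((0 : C(X, ℂ)) x), exp_ne_zero _⟩ := fun x ↦
    Subtype.ext (by simpa [H'] using h0 x)
  let L := isCoveringMap_exp.liftHomotopy H' 0 hH0
  refine ⟨⟨fun x ↦ L (1, x), by fun_prop⟩, fun x ↦ ?_⟩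
  have := congrFun (isCoveringMap_exp.liftHomotopy_lifts H' 0 hH0) (1, x)
  exact congrArg Subtype.val this

/-- Nonvanishing functions on a real topological vector space have continuous logarithms. -/
theorem exists_log_of_vectorSpace {E : Type*} [AddCommGroup E] [Module ℝ E] [TopologicalSpace E]
    [ContinuousSMul ℝ E] (f : C(E, ℂ)) (hf : ∀ x, f x ≠ 0) :
    ∃ g : C(E, ℂ), ∀ x, exp (g x) = f x := by
  obtain ⟨g, hg⟩ := exists_log_of_homotopy
    (⟨fun y ↦ f ((y.1 : ℝ) • y.2) / f 0, by fun_prop⟩ : C(unitInterval × E, ℂ))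
    (fun y ↦ div_ne_zero (hf _) (hf _)) (fun x ↦ by simp [hf])
  refine ⟨⟨fun x ↦ g x + log (f 0), by fun_prop⟩, fun x ↦ ?_⟩
  simp [Complex.exp_add, hg, exp_log (hf 0), hf]

/-- Nonvanishing functions along a path have continuous logarithms. -/
theorem exists_log_of_path (f : C(unitInterval, ℂ)) (hf : ∀ t, f t ≠ 0) :
    ∃ g : C(unitInterval, ℂ), ∀ t, exp (g t) = f t := by
  obtain ⟨g, hg⟩ := exists_log_of_vectorSpace
    (f.comp ⟨projIcc (0 : ℝ) 1 zero_le_one, continuous_projIcc⟩) (fun x ↦ hf _)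
  exact ⟨⟨fun t ↦ g t, by fun_prop⟩, fun t ↦ by simp [hg]⟩

/-- Two continuous logarithms on a preconnected set differ by a constant. -/
theorem exists_int_of_exp_eq {X : Type*} [TopologicalSpace X] {s : Set X} (hs : IsPreconnected s)
    {g h : X → ℂ} (hg : ContinuousOn g s) (hh : ContinuousOn h s)
    (hgh : ∀ x ∈ s, exp (g x) = exp (h x)) :
    ∃ n : ℤ, ∀ x ∈ s, g x = h x + n * (2 * Real.pi * I) := by
  rcases s.eq_empty_or_nonempty with rfl | ⟨x₀, hx₀⟩
  · simp
  obtain ⟨n, hn⟩ := exp_eq_exp_iff_exists_int.1 (hgh x₀ hx₀)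
  refine ⟨n, fun x hx ↦ ?_⟩
  have hT : IsDiscrete (AddSubgroup.zmultiples (2 * Real.pi * I : ℂ) : Set ℂ) :=
    ⟨NormedSpace.discreteTopology_zmultiples _⟩
  have := hs.constant_of_mapsTo hT (hg.sub hh) (fun y hy ↦ by
    obtain ⟨m, hm⟩ := exp_eq_exp_iff_exists_int.1 (hgh y hy)
    exact ⟨m, by simp [hm]⟩) hx hx₀
  simp only [Pi.sub_apply, hn, add_sub_cancel_left] at this
  rw [← this]; ring

/-- The power `(z - c) ^ m` has no continuous logarithm on a circle around `c` unless `m = 0`. -/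
theorem eq_zero_of_log_on_sphere {c : ℂ} {R : ℝ} (hR : 0 < R) {m : ℤ} {g : ℂ → ℂ}
    (hg : ContinuousOn g (Metric.sphere c R))
    (h : ∀ z ∈ Metric.sphere c R, exp (g z) = (z - c) ^ m) : m = 0 := by
  have hmem : ∀ t : ℝ, c + R * exp (t * I) ∈ Metric.sphere c R := fun t ↦ by
    simp [norm_exp_ofReal_mul_I, abs_of_pos hR]
  have hR' : (R : ℂ) ≠ 0 := by exact_mod_cast hR.ne'
  obtain ⟨n, hn⟩ := exists_int_of_exp_eq (s := (univ : Set ℝ)) isPreconnected_univ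
    (g := fun t ↦ g (c + R * exp (t * I))) (h := fun t ↦ m * (log R + t * I))
    (hg.comp_continuous (by fun_prop) hmem).continuousOn (by fun_prop) (fun t _ ↦ by
      rw [h _ (hmem t), exp_int_mul, Complex.exp_add, exp_log hR', add_sub_cancel_left])
  have h0 := hn 0 trivial
  have h1 := hn (2 * Real.pi) trivial
  have : exp (((2 * Real.pi : ℝ) : ℂ) * I) = exp (((0 : ℝ) : ℂ) * I) := by
    simp [exp_two_pi_mul_I]
  simp only [this, h0] at h1
  have h2 : (m : ℂ) * (2 * Real.pi * I) = 0 := by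
    push_cast at h1; linear_combination -h1
  simpa [Real.pi_ne_zero] using h2

/-- If `U` is a bounded plane region whose boundary lies in `K`, then `z - p` with `p ∈ U` is of
infinite order, modulo functions with a logarithm on `K`, relative to `z - q` with `q` outside.
No condition on `q` is needed when `n = 0`. -/
theorem eq_zero_of_log_on_boundary {K U : Set ℂ} (hK : IsClosed K) (hU : IsOpen U)
    (hKU : IsCompact (K ∪ U)) {p q : ℂ} (hp : p ∈ U) {m n : ℤ} (hq : q ∈ K ∪ U → n = 0) {g : ℂ → ℂ}
    (hg : ContinuousOn g K) (h : ∀ z ∈ K, exp (g z) * (z - q) ^ n = (z - p) ^ m) : m = 0 := by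
  classical
  obtain ⟨G, hG⟩ := ContinuousMap.exists_restrict_eq hK ⟨K.domRestrict g, hg.domRestrict⟩
  replace hG : ∀ z ∈ K, G z = g z := fun z hz ↦ congrArg (fun f ↦ f ⟨z, hz⟩) hG
  have hq' : ∀ z ∈ K ∪ U, z - q ≠ 0 ∨ n = 0 := fun z hz ↦
    or_iff_not_imp_left.2 fun h ↦ hq (sub_eq_zero.1 (not_not.1 h) ▸ hz)
  have hp' : ∀ z ∈ Uᶜ, z - p ≠ 0 := fun z hz h ↦ hz (sub_eq_zero.1 h ▸ hp)
  let F : ℂ → ℂ := fun z ↦ if z ∈ K ∪ U then exp (G z) * (z - q) ^ n else (z - p) ^ m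
  have hF1 : ∀ z ∈ K ∪ U, F z = exp (G z) * (z - q) ^ n := fun z hz ↦ if_pos hz
  have hF2 : ∀ z ∈ Uᶜ, F z = (z - p) ^ m := fun z hz ↦ by
    by_cases hz' : z ∈ K
    · rw [hF1 z (.inl hz'), hG z hz', h z hz']
    · exact if_neg (by simp_all)
  have hFc : Continuous F := by
    rw [← continuousOn_univ, show (univ : Set ℂ) = (K ∪ U) ∪ Uᶜ by
      ext z; by_cases z ∈ U <;> simp_all]
    refine ContinuousOn.union_of_isClosed ?_ ?_ hKU.isClosed hU.isClosed_compl
    · refine ContinuousOn.congr (fun z hz ↦ ?_) hF1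
      have : ContinuousAt (fun z ↦ (z - q) ^ n) z :=
        ContinuousAt.zpow₀ (by fun_prop) _ ((hq' z hz).imp_right ge_of_eq)
      exact ContinuousAt.continuousWithinAt (by fun_prop)
    · refine ContinuousOn.congr (fun z hz ↦ ?_) hF2
      have : ContinuousAt (fun z ↦ (z - p) ^ m) z :=
        ContinuousAt.zpow₀ (by fun_prop) _ (.inl (hp' z hz))
      exact this.continuousWithinAt
  have hF0 : ∀ z, F z ≠ 0 := fun z ↦ by
    by_cases hz : z ∈ K ∪ U
    · rw [hF1 z hz]
      refine mul_ne_zero (exp_ne_zero _) ?_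
      rcases hq' z hz with h | rfl
      · exact zpow_ne_zero _ h
      · simp
    · have : z ∈ Uᶜ := fun h ↦ hz (.inr h)
      rw [hF2 z this]; exact zpow_ne_zero _ (hp' z this)
  obtain ⟨L, hL⟩ := exists_log_of_vectorSpace ⟨F, hFc⟩ hF0
  obtain ⟨R, hR, hKR⟩ := hKU.isBounded.subset_ball_lt 0 p
  refine eq_zero_of_log_on_sphere (c := p) hR (g := L) (by fun_prop) fun z hz ↦ ?_
  rw [hL, ContinuousMap.coe_mk, hF2]
  intro hzU
  exact (Metric.mem_ball.1 (hKR (.inr hzU))).ne hz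

/-- `(z - a) / (z - b)` has a logarithm off any path from `a` to `b`. -/
theorem exists_log_div_compl_path (γ : C(unitInterval, ℂ)) :
    ∃ g : ℂ → ℂ, ContinuousOn g (range γ)ᶜ ∧
      ∀ z ∈ (range γ)ᶜ, exp (g z) = (z - γ 0) / (z - γ 1) := by
  have hne : ∀ (z : ((range γ)ᶜ : Set ℂ)) t, (z : ℂ) - γ t ≠ 0 := fun z t h ↦
    z.2 ⟨t, (sub_eq_zero.1 h).symm⟩
  obtain ⟨g, hg⟩ := exists_log_of_homotopy (X := ((range γ)ᶜ : Set ℂ))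
    ⟨fun y ↦ ((y.2 : ℂ) - γ 0) / (y.2 - γ y.1), by
      exact Continuous.div (by fun_prop) (by fun_prop) fun y ↦ hne _ _⟩
    (fun y ↦ div_ne_zero (hne _ _) (hne _ _)) (fun x ↦ div_self (hne _ _))
  classical
  refine ⟨fun z ↦ if hz : z ∈ (range γ)ᶜ then g ⟨z, hz⟩ else 0, ?_, fun z hz ↦ ?_⟩
  · rw [continuousOn_iff_continuous_domRestrict]
    convert g.continuous using 1
    ext z
    simp only [domRestrict_apply, dif_pos z.2]
  · simp only [dif_pos hz]
    exact hg ⟨z, hz⟩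

/-- `(z - a) / (z - b)` has no logarithm on the plane without `a` and `b`. -/
theorem not_exists_log_div {a b : ℂ} (hab : a ≠ b) {g : ℂ → ℂ} (hg : ContinuousOn g {a, b}ᶜ)
    (h : ∀ z ∈ ({a, b}ᶜ : Set ℂ), exp (g z) = (z - a) / (z - b)) : False := by
  have hba : a - b ≠ 0 := sub_ne_zero.2 hab
  have hr : 0 < ‖a - b‖ / 2 := by positivity
  have hs : ∀ z ∈ Metric.sphere a (‖a - b‖ / 2), z ∈ ({a, b}ᶜ : Set ℂ) ∧
      (z - b) / (a - b) ∈ slitPlane := fun z hz ↦ by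
    have hz' : ‖z - a‖ = ‖a - b‖ / 2 := by simpa [dist_eq_norm] using hz
    constructor
    · simp only [mem_compl_iff, mem_insert_iff, mem_singleton_iff, not_or]
      constructor
      · rintro rfl; rw [sub_self, norm_zero] at hz'; linarith
      · rintro rfl; rw [norm_sub_rev] at hz'; linarith
    · have : (z - b) / (a - b) = 1 + (z - a) / (a - b) := by field_simp; ring
      rw [this]
      apply mem_slitPlane_of_norm_lt_one
      rw [norm_div, hz', div_lt_one (by positivity)]
      linarith
  have := eq_zero_of_log_on_sphere (c := a) (m := 1) hr
    (g := fun z ↦ g z + log ((z - b) / (a - b)) + log (a - b)) ?_ ?_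
  · simp at this
  · refine ((hg.mono fun z hz ↦ (hs z hz).1).add ?_).add continuousOn_const
    exact ContinuousOn.clog (by fun_prop) fun z hz ↦ (hs z hz).2
  · intro z hz
    have hz1 := (hs z hz).1
    have hzb : z - b ≠ 0 := sub_ne_zero.2 fun e ↦ hz1 (by simp [e])
    rw [Complex.exp_add, Complex.exp_add, h z hz1, exp_log hba, exp_log (div_ne_zero hzb hba)]
    field_simp

/-- Two paths from `a` to `b` in the plane meeting only at `a` and `b` separate the plane. -/
theorem not_isPreconnected_compl_of_paths {γ δ : C(unitInterval, ℂ)} (h0 : γ 0 = δ 0) (h1 : γ 1 = δ 1)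
    (hne : γ 0 ≠ γ 1) (hγδ : range γ ∩ range δ ⊆ {γ 0, γ 1}) :
    ¬ IsPreconnected (range γ ∪ range δ)ᶜ := by
  classical
  intro hc
  obtain ⟨g, hg, hge⟩ := exists_log_div_compl_path γ
  obtain ⟨d, hd, hde⟩ := exists_log_div_compl_path δ
  rw [← h0, ← h1] at hde
  rw [compl_union] at hc
  obtain ⟨n, hn⟩ := exists_int_of_exp_eq hc (hg.mono inter_subset_left)
    (hd.mono inter_subset_right) fun z hz ↦ by rw [hge z hz.1, hde z hz.2]
  have hper : ∀ w : ℂ, exp (w + n * (2 * Real.pi * I)) = exp w := fun w ↦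
    exp_eq_exp_iff_exists_int.2 ⟨n, rfl⟩
  let L : ℂ → ℂ := fun z ↦ if z ∈ range γ then d z + n * (2 * Real.pi * I) else g z
  have hL1 : ∀ z ∈ (range γ)ᶜ, L z = g z := fun z hz ↦ if_neg hz
  have hL2 : ∀ z ∈ (range δ)ᶜ, L z = d z + n * (2 * Real.pi * I) := fun z hz ↦ by
    by_cases hz' : z ∈ range γ
    · exact if_pos hz'
    · rw [hL1 z hz', hn z ⟨hz', hz⟩]
  have hcov : ({γ 0, γ 1}ᶜ : Set ℂ) ⊆ (range γ)ᶜ ∪ (range δ)ᶜ := by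
    rw [← compl_inter]; exact compl_subset_compl.2 hγδ
  have hog : IsOpen (range γ)ᶜ := (isCompact_range γ.continuous).isClosed.isOpen_compl
  have hod : IsOpen (range δ)ᶜ := (isCompact_range δ.continuous).isClosed.isOpen_compl
  refine not_exists_log_div hne (g := L) ?_ fun z hz ↦ ?_
  · exact ((hg.congr hL1).union_of_isOpen ((hd.add continuousOn_const).congr hL2) hog hod).mono hcov
  · rcases hcov hz with hz | hz
    · rw [hL1 z hz, hge z hz]
    · rw [hL2 z hz, hper, hde z hz]

variable {S : Type*} [TopologicalSpace S]

/-- The pair `φ`, `ψ` identifies the complement of `q` with the complex plane. -/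
structure IsPuncturedChart (q : S) (φ : S → ℂ) (ψ : ℂ → S) : Prop where
  isOpenEmbedding : IsOpenEmbedding ψ
  range_eq : range ψ = {q}ᶜ
  continuousOn : ContinuousOn φ {q}ᶜ
  leftInverse : Function.LeftInverse φ ψ

theorem IsPuncturedChart.rightInvOn {q : S} {φ : S → ℂ} {ψ : ℂ → S} (h : IsPuncturedChart q φ ψ)
    {x : S} (hx : x ≠ q) : ψ (φ x) = x := by
  obtain ⟨z, rfl⟩ : x ∈ range ψ := h.range_eq ▸ hx
  rw [h.leftInverse]

theorem IsPuncturedChart.apply_ne {q : S} {φ : S → ℂ} {ψ : ℂ → S} (h : IsPuncturedChart q φ ψ)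
    (z : ℂ) : ψ z ≠ q := by
  have : ψ z ∈ ({q}ᶜ : Set S) := h.range_eq ▸ mem_range_self z
  exact this

theorem IsPuncturedChart.isCompact_preimage [CompactSpace S] {q : S} {φ : S → ℂ} {ψ : ℂ → S}
    (h : IsPuncturedChart q φ ψ) {A : Set S} (hA : IsClosed A) (hq : q ∉ A) :
    IsCompact (ψ ⁻¹' A) := by
  have hA' : A ⊆ {q}ᶜ := subset_compl_singleton_iff.2 hq
  convert hA.isCompact.image_of_continuousOn (h.continuousOn.mono hA') using 1
  ext z
  refine ⟨fun hz ↦ ⟨ψ z, hz, h.leftInverse z⟩, ?_⟩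
  rintro ⟨x, hx, rfl⟩
  rwa [mem_preimage, h.rightInvOn (hA' hx)]

/-- A space all of whose punctures are homeomorphic to the complex plane. -/
def IsSphereLike (S : Type*) [TopologicalSpace S] : Prop :=
  ∀ q : S, ∃ φ ψ, IsPuncturedChart q φ ψ

theorem IsPuncturedChart.eq_zero_of_log [CompactSpace S] {q : S} {φ : S → ℂ}
    {ψ : ℂ → S} (h : IsPuncturedChart q φ ψ) {A U : Set S} (hA : IsClosed A) (hU : IsOpen U)
    (hAU : IsClosed (A ∪ U)) (hq : q ∉ A ∪ U) {x : S} (hx : x ∈ U) {w : ℂ} {m n : ℤ}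
    (hw : ψ w ∈ A ∪ U → n = 0) {g : S → ℂ} (hg : ContinuousOn g A)
    (hgA : ∀ y ∈ A, exp (g y) * (φ y - w) ^ n = (φ y - φ x) ^ m) : m = 0 := by
  have hxq : x ≠ q := fun e ↦ hq (.inr (e ▸ hx))
  have hψ := h.isOpenEmbedding.continuous
  refine eq_zero_of_log_on_boundary (hA.preimage hψ) (hU.preimage hψ)
    (by simpa using h.isCompact_preimage hAU hq) (p := φ x) (q := w) (n := n) (g := g ∘ ψ)
    (by simpa [h.rightInvOn hxq] using hx) (by simpa using hw)
    (hg.comp hψ.continuousOn (mapsTo_preimage _ _)) fun z hz ↦ ?_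
  simpa [h.leftInverse z] using hgA _ hz

/-- Every nonvanishing continuous function on `A` has a continuous logarithm. -/
def HasLogs (A : Set S) : Prop :=
  ∀ f : S → ℂ, ContinuousOn f A → (∀ x ∈ A, f x ≠ 0) →
    ∃ g, ContinuousOn g A ∧ ∀ x ∈ A, exp (g x) = f x

theorem isPreconnected_compl_of_hasLogs [CompactSpace S] (hS : IsSphereLike S) {A : Set S}
    (hA : IsClosed A) (hlog : HasLogs A) : IsPreconnected Aᶜ := by
  rw [isPreconnected_iff_subset_of_disjoint]
  intro u v hu hv huv hd
  by_contra! hcon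
  obtain ⟨⟨q, hqA, hqu⟩, ⟨x, hxA, hxv⟩⟩ := And.imp not_subset.1 not_subset.1 hcon
  have hxu : x ∈ u := (huv hxA).resolve_right hxv
  obtain ⟨φ, ψ, h⟩ := hS q
  have hAq : A ⊆ {q}ᶜ := subset_compl_singleton_iff.2 hqA
  have hAu : A ∪ (u ∩ Aᶜ) = (v ∩ Aᶜ)ᶜ := by
    ext y
    have h1 := @huv y
    have h2 : y ∉ Aᶜ ∩ (u ∩ v) := by simp [hd]
    simp only [mem_union, mem_inter_iff, mem_compl_iff] at *
    tauto
  obtain ⟨g, hg, hgA⟩ := hlog (fun y ↦ φ y - φ x)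
    ((h.continuousOn.mono hAq).sub continuousOn_const) fun y hy e ↦ hxA (by
      have hxq : x ≠ q := fun e ↦ hqu (e ▸ hxu)
      rw [← h.rightInvOn hxq, ← sub_eq_zero.1 e, h.rightInvOn (hAq hy)]
      exact hy)
  have := h.eq_zero_of_log hA (hu.inter hA.isOpen_compl)
    (by rw [hAu]; exact (hv.inter hA.isOpen_compl).isClosed_compl)
    (fun hq ↦ hq.elim hqA fun hq ↦ hqu hq.1) ⟨hxu, hxA⟩ (w := 0) (m := 1) (n := 0) (by simp) hg (by simpa using hgA)
  exact one_ne_zero this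

theorem HasLogs.of_finite [T1Space S] {A : Set S} (hA : A.Finite) : HasLogs A := fun f _ hf ↦
  ⟨fun x ↦ log (f x), hA.continuousOn _, fun x hx ↦ exp_log (hf x hx)⟩

/-- A function on a compact space descends to the image of any map whose fibres it respects. -/
theorem exists_continuousOn_range [T2Space S] {X Y : Type*} [TopologicalSpace X] [CompactSpace X]
    [TopologicalSpace Y] [Nonempty Y] (c : C(X, S)) (h : C(X, Y))
    (hc : ∀ s t, c s = c t → h s = h t) :
    ∃ g : S → Y, ContinuousOn g (range c) ∧ ∀ t, g (c t) = h t := by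
  classical
  have hf : Function.FactorsThrough h c := fun s t hst ↦ hc s t hst
  have hgc : ∀ t, Function.extend c h (fun _ ↦ Classical.arbitrary Y) (c t) = h t := fun t ↦
    hf.extend_apply _ t
  refine ⟨_, ?_, hgc⟩
  rw [continuousOn_iff_continuous_domRestrict]
  have hq : IsQuotientMap (rangeFactorization c) :=
    IsClosedMap.isQuotientMap (c.continuous.rangeFactorization.isClosedMap)
      c.continuous.rangeFactorization rangeFactorization_surjective
  rw [hq.continuous_iff]
  convert h.continuous using 1
  ext t
  exact hgc t

theorem HasLogs.of_path [T2Space S] (c : C(unitInterval, S)) (hc : Function.Injective c) :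
    HasLogs (range c) := fun f hf hf0 ↦ by
  obtain ⟨h, hh⟩ := exists_log_of_path
    ⟨fun t ↦ f (c t), hf.comp_continuous c.continuous mem_range_self⟩
    fun t ↦ hf0 _ (mem_range_self t)
  obtain ⟨g, hg, hgc⟩ := exists_continuousOn_range c h fun s t e ↦ by rw [hc e]
  refine ⟨g, hg, ?_⟩
  rintro _ ⟨t, rfl⟩
  rw [hgc]
  exact hh t

/-- A closed path that is injective apart from its endpoints. -/
structure IsSimpleClosed (c : C(unitInterval, S)) : Prop where
  closed : c 0 = c 1
  eq_of_apply_eq : ∀ s t, c s = c t → s = t ∨ (s = 0 ∧ t = 1) ∨ (s = 1 ∧ t = 0)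

/-- On a simple closed curve, nonvanishing functions have rank at most one modulo functions with
logarithms. -/
theorem IsSimpleClosed.exists_log_relation [T2Space S] {c : C(unitInterval, S)}
    (hc : IsSimpleClosed c) {f₁ f₂ : S → ℂ}
    (hf₁ : ContinuousOn f₁ (range c)) (hf₂ : ContinuousOn f₂ (range c))
    (h₁ : ∀ x ∈ range c, f₁ x ≠ 0) (h₂ : ∀ x ∈ range c, f₂ x ≠ 0) :
    ∃ d₁ d₂ : ℤ, (∃ g, ContinuousOn g (range c) ∧
        ∀ x ∈ range c, exp (g x) * f₁ x ^ d₂ = f₂ x ^ d₁) ∧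
      (d₁ = 0 → ∃ g, ContinuousOn g (range c) ∧ ∀ x ∈ range c, exp (g x) = f₁ x) := by
  have key : ∀ f : S → ℂ, ContinuousOn f (range c) → (∀ x ∈ range c, f x ≠ 0) →
      ∃ (G : C(unitInterval, ℂ)) (d : ℤ), (∀ t, exp (G t) = f (c t)) ∧
        G 1 = G 0 + d * (2 * Real.pi * I) := fun f hf h ↦ by
    obtain ⟨G, hG⟩ := exists_log_of_path
      ⟨fun t ↦ f (c t), hf.comp_continuous c.continuous mem_range_self⟩
      fun t ↦ h _ (mem_range_self t)
    obtain ⟨d, hd⟩ := exp_eq_exp_iff_exists_int.1 (show exp (G 1) = exp (G 0) by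
      rw [hG, hG]; simp [hc.closed])
    exact ⟨G, d, hG, hd⟩
  have desc : ∀ h : C(unitInterval, ℂ), h 0 = h 1 →
      ∃ g : S → ℂ, ContinuousOn g (range c) ∧ ∀ t, g (c t) = h t := fun h h01 ↦
    exists_continuousOn_range c h fun s t e ↦ by
      rcases hc.eq_of_apply_eq s t e with rfl | ⟨rfl, rfl⟩ | ⟨rfl, rfl⟩
      exacts [rfl, h01, h01.symm]
  obtain ⟨G₁, d₁, hG₁, hd₁⟩ := key f₁ hf₁ h₁
  obtain ⟨G₂, d₂, hG₂, hd₂⟩ := key f₂ hf₂ h₂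
  refine ⟨d₁, d₂, ?_, fun h ↦ ?_⟩
  · obtain ⟨g, hg, hgc⟩ := desc (⟨fun t ↦ d₁ * G₂ t - d₂ * G₁ t, by fun_prop⟩)
      (by simp only [ContinuousMap.coe_mk, hd₁, hd₂]; ring)
    refine ⟨g, hg, ?_⟩
    rintro _ ⟨t, rfl⟩
    rw [hgc, ← hG₁, ← hG₂, ← exp_int_mul, ← exp_int_mul, ← Complex.exp_add]
    simp
  · obtain ⟨g, hg, hgc⟩ := desc G₁ (by simp [hd₁, h])
    refine ⟨g, hg, ?_⟩
    rintro _ ⟨t, rfl⟩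
    rw [hgc, hG₁]

/-- The complement of a simple closed curve has at most two components. -/
theorem IsSimpleClosed.not_three_regions [CompactSpace S] [T2Space S] (hS : IsSphereLike S)
    {c : C(unitInterval, S)} (hc : IsSimpleClosed c) {U V W : Set S}
    (hU : IsOpen U) (hV : IsOpen V) (hW : IsOpen W) (hUn : U.Nonempty) (hVn : V.Nonempty)
    (hWn : W.Nonempty) (hUV : Disjoint U V) (hUW : Disjoint U W) (hVW : Disjoint V W)
    (h : U ∪ V ∪ W = (range c)ᶜ) : False := by
  obtain ⟨x, hx⟩ := hUn
  obtain ⟨y, hy⟩ := hVn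
  obtain ⟨q, hq⟩ := hWn
  obtain ⟨φ, ψ, hφ⟩ := hS q
  have hP : IsClosed (range c) := (isCompact_range c.continuous).isClosed
  have hmem : ∀ z, z ∈ range c ↔ z ∉ U ∧ z ∉ V ∧ z ∉ W := fun z ↦ by
    rw [← not_iff_not, ← mem_compl_iff, ← h]
    simp only [mem_union]; tauto
  have hxV : x ∉ V := fun hx' ↦ disjoint_left.1 hUV hx hx'
  have hxW : x ∉ W := fun hx' ↦ disjoint_left.1 hUW hx hx'
  have hyU : y ∉ U := fun hx' ↦ disjoint_left.1 hUV hx' hy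
  have hyW : y ∉ W := fun hx' ↦ disjoint_left.1 hVW hy hx'
  have hqU : q ∉ U := fun hx' ↦ disjoint_left.1 hUW hx' hq
  have hqV : q ∉ V := fun hx' ↦ disjoint_left.1 hVW hx' hq
  have hxP : x ∉ range c := by simp only [hmem]; tauto
  have hyP : y ∉ range c := by simp only [hmem]; tauto
  have hqP : q ∉ range c := by simp only [hmem]; tauto
  have hxq : x ≠ q := fun e ↦ hxW (e ▸ hq)
  have hyq : y ≠ q := fun e ↦ hyW (e ▸ hq)
  have hPq : range c ⊆ {q}ᶜ := subset_compl_singleton_iff.2 hqP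
  have hPU : IsClosed (range c ∪ U) := by
    convert (hV.union hW).isClosed_compl using 1
    ext z
    have : z ∈ U → z ∉ V := fun h' ↦ disjoint_left.1 hUV h'
    have : z ∈ U → z ∉ W := fun h' ↦ disjoint_left.1 hUW h'
    simp only [mem_union, hmem, mem_compl_iff]; tauto
  have hPV : IsClosed (range c ∪ V) := by
    convert (hU.union hW).isClosed_compl using 1
    ext z
    have : z ∈ U → z ∉ V := fun h' ↦ disjoint_left.1 hUV h'
    have : z ∈ V → z ∉ W := fun h' ↦ disjoint_left.1 hVW h'
    simp only [mem_union, hmem, mem_compl_iff]; tauto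
  have hcont : ∀ z, ContinuousOn (fun s ↦ φ s - φ z) (range c) := fun z ↦
    (hφ.continuousOn.mono hPq).sub continuousOn_const
  have hne : ∀ z ≠ q, z ∉ range c → ∀ s ∈ range c, φ s - φ z ≠ 0 := fun z hzq hz s hs e ↦ hz (by
    rwa [← hφ.rightInvOn hzq, ← sub_eq_zero.1 e, hφ.rightInvOn (hPq hs)])
  obtain ⟨d₁, d₂, ⟨g, hg, hgP⟩, h0⟩ := hc.exists_log_relation (hcont x) (hcont y)
    (hne x hxq hxP) (hne y hyq hyP)
  have hd₁ : d₁ = 0 := hφ.eq_zero_of_log hP hV hPV (by simp_all) hy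
    (fun h' ↦ by rw [hφ.rightInvOn hxq] at h'; simp_all) hg hgP
  obtain ⟨g, hg, hgP⟩ := h0 hd₁
  exact one_ne_zero (hφ.eq_zero_of_log hP hU hPU (by simp_all) hx (w := 0) (m := 1) (n := 0)
    (by simp) hg (by simpa using hgP))

/-- Puncturing the complement of a closed set does not disconnect it. -/
theorem IsPuncturedChart.isPreconnected_compl_preimage [CompactSpace S] [T2Space S] {q : S}
    {φ : S → ℂ} {ψ : ℂ → S} (h : IsPuncturedChart q φ ψ) {A : Set S} (hA : IsClosed A)
    (hq : q ∉ A) (hc : IsPreconnected Aᶜ) : IsPreconnected (ψ ⁻¹' A)ᶜ := by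
  have hψ := h.isOpenEmbedding.continuous
  obtain ⟨R, hR, hKR⟩ := (h.isCompact_preimage hA hq).isBounded.subset_ball_lt 0 0
  let E : Set ℂ := exp '' {z | Real.log R < z.re}
  have hE : IsPreconnected E :=
    (convex_halfSpace_re_gt _).isPreconnected.image _ continuous_exp.continuousOn
  have hEmem : ∀ z : ℂ, R < ‖z‖ → z ∈ E := fun z hz ↦
    ⟨log z, by rw [mem_ofPred, log_re]; exact Real.log_lt_log hR hz,
      exp_log (norm_pos_iff.1 (hR.trans hz))⟩
  have hEK : E ⊆ (ψ ⁻¹' A)ᶜ := by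
    rintro _ ⟨z, hz, rfl⟩ hzA
    have := hKR hzA
    rw [mem_ball_zero_iff, norm_exp] at this
    exact absurd ((Real.lt_log_iff_exp_lt hR).2 this) (not_lt.2 (le_of_lt hz))
  have key : ∀ u v : Set ℂ, IsOpen u → IsOpen v → Disjoint u v → u ∪ v = (ψ ⁻¹' A)ᶜ → E ⊆ u →
      (ψ ⁻¹' A)ᶜ ⊆ u := fun u v hu hv huv hcov hEu ↦ by
    have hKv : IsCompact (ψ ⁻¹' A ∪ v) := by
      refine Metric.isCompact_of_isClosed_isBounded ?_ ?_
      · convert hu.isClosed_compl using 1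
        ext z
        have h1 : z ∈ u → z ∉ v := fun hz ↦ disjoint_left.1 huv hz
        have h2 := Set.ext_iff.1 hcov z
        simp only [mem_union, mem_compl_iff] at h2 ⊢
        tauto
      · refine (Metric.isBounded_closedBall (x := (0 : ℂ)) (r := R)).subset ?_
        rintro z (hz | hz)
        · exact Metric.ball_subset_closedBall (hKR hz)
        · rw [mem_closedBall_zero_iff]
          by_contra! hz'
          exact disjoint_left.1 huv (hEu (hEmem z hz')) hz
    have hsub := hc.subset_or_subset (hKv.image hψ).isClosed.isOpen_compl
      (h.isOpenEmbedding.isOpenMap v hv)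
      (disjoint_compl_left.mono_right (image_mono subset_union_right)) (fun s hs ↦ by
        by_cases hs' : s ∈ ψ '' v
        · exact .inr hs'
        · refine .inl ?_
          rintro ⟨z, hz | hz, rfl⟩
          exacts [hs hz, hs' ⟨z, hz, rfl⟩])
    rcases hsub with hsub | hsub
    · intro z hz
      refine (hcov.symm ▸ hz : z ∈ u ∪ v).resolve_right fun hzv ↦ ?_
      exact hsub hz ⟨z, .inr hzv, rfl⟩
    · obtain ⟨z, -, hz⟩ := hsub hq
      exact absurd hz (h.apply_ne z)
  have hKo : IsOpen (ψ ⁻¹' A)ᶜ := (hA.preimage hψ).isOpen_compl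
  rw [isPreconnected_iff_subset_of_disjoint]
  intro u v hu hv huv hd
  have hd' : Disjoint (u ∩ (ψ ⁻¹' A)ᶜ) (v ∩ (ψ ⁻¹' A)ᶜ) := by
    rw [disjoint_left]
    rintro z ⟨h1, h2⟩ ⟨h3, -⟩
    exact (hd ▸ (⟨h2, h1, h3⟩ : z ∈ (ψ ⁻¹' A)ᶜ ∩ (u ∩ v)) : z ∈ (∅ : Set ℂ))
  have hcov : u ∩ (ψ ⁻¹' A)ᶜ ∪ v ∩ (ψ ⁻¹' A)ᶜ = (ψ ⁻¹' A)ᶜ := by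
    rw [← union_inter_distrib_right, inter_eq_right.2 huv]
  have hu' := hu.inter hKo
  have hv' := hv.inter hKo
  rcases hE.subset_or_subset hu' hv' hd' (hEK.trans hcov.ge) with hE' | hE'
  · exact .inl ((key _ _ hu' hv' hd' hcov hE').trans inter_subset_left)
  · exact .inr ((key _ _ hv' hu' hd'.symm (by rwa [union_comm]) hE').trans inter_subset_left)

/-- A simple closed curve separates the sphere. -/
theorem IsSimpleClosed.not_isPreconnected_compl [CompactSpace S] [T2Space S] (hS : IsSphereLike S)
    {c : C(unitInterval, S)} (hc : IsSimpleClosed c) (hne : (range c)ᶜ.Nonempty) :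
    ¬ IsPreconnected (range c)ᶜ := by
  intro hpre
  obtain ⟨q, hq⟩ := hne
  obtain ⟨φ, ψ, h⟩ := hS q
  have hPq : range c ⊆ {q}ᶜ := subset_compl_singleton_iff.2 hq
  have hP : IsClosed (range c) := (isCompact_range c.continuous).isClosed
  have hφc : Continuous fun t ↦ φ (c t) :=
    (h.continuousOn.mono hPq).comp_continuous c.continuous mem_range_self
  have hφi : ∀ s t, φ (c s) = φ (c t) → c s = c t := fun s t e ↦ by
    rw [← h.rightInvOn (hPq (mem_range_self s)), e, h.rightInvOn (hPq (mem_range_self t))]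
  let a : C(unitInterval, unitInterval) :=
    ⟨fun t ↦ ⟨t / 2, by linarith [t.2.1], by linarith [t.2.2]⟩, by fun_prop⟩
  let b : C(unitInterval, unitInterval) :=
    ⟨fun t ↦ ⟨1 - t / 2, by linarith [t.2.2], by linarith [t.2.1]⟩, by fun_prop⟩
  have ha : ∀ t, (a t : ℝ) = t / 2 := fun t ↦ rfl
  have hb : ∀ t, (b t : ℝ) = 1 - t / 2 := fun t ↦ rfl
  have ha0 : a 0 = 0 := Subtype.ext (by simp [ha])
  have hb0 : b 0 = 1 := Subtype.ext (by simp [hb])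
  have hab : a 1 = b 1 := Subtype.ext (by simp [ha, hb]; norm_num)
  let F : C(unitInterval, ℂ) := ⟨fun t ↦ φ (c t), hφc⟩
  refine not_isPreconnected_compl_of_paths (γ := F.comp a) (δ := F.comp b) ?_ ?_ ?_ ?_ ?_
  · simp [F, ha0, hb0, hc.closed]
  · simp [F, hab]
  · intro e
    rcases hc.eq_of_apply_eq _ _ (hφi _ _ e) with e | ⟨-, e⟩ | ⟨e, -⟩ <;>
    · have := congrArg Subtype.val e
      norm_num [ha] at this
  · rintro _ ⟨⟨s, rfl⟩, ⟨t, e⟩⟩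
    have hs := s.2.2
    have ht := t.2.2
    rcases hc.eq_of_apply_eq _ _ (hφi _ _ e) with e | ⟨-, e⟩ | ⟨-, e⟩
    · have e' := congrArg Subtype.val e
      rw [ha, hb] at e'
      have : s = 1 := Subtype.ext (show (s : ℝ) = 1 by linarith)
      simp [this]
    · have e' := congrArg Subtype.val e
      rw [ha] at e'
      simp at e'
      linarith
    · have e' := congrArg Subtype.val e
      rw [ha] at e'
      have : s = 0 := Subtype.ext (by simpa using e')
      simp [this]
  · convert h.isPreconnected_compl_preimage hP hq hpre using 2
    ext z
    have hz : ∀ t, F t = z ↔ c t = ψ z := fun t ↦ by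
      rw [show F t = φ (c t) from rfl]
      refine ⟨?_, fun e ↦ by rw [e, h.leftInverse]⟩
      rintro rfl
      rw [h.rightInvOn (hPq (mem_range_self t))]
    simp only [mem_union, mem_range, mem_preimage, ContinuousMap.comp_apply, hz]
    constructor
    · rintro (⟨t, ht⟩ | ⟨t, ht⟩)
      exacts [⟨_, ht⟩, ⟨_, ht⟩]
    · rintro ⟨t, ht⟩
      rcases le_total (t : ℝ) (1 / 2) with h' | h'
      · refine .inl ⟨⟨2 * t, by linarith [t.2.1], by linarith⟩, ?_⟩
        rw [← ht]; congr 1; ext; simp [ha]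
      · refine .inr ⟨⟨2 - 2 * t, by linarith [t.2.2], by linarith⟩, ?_⟩
        rw [← ht]; congr 1; ext; simp [hb]; ring

theorem IsSimpleClosed.isPreconnected_of_compl_eq_union [CompactSpace S] [T2Space S]
    (hS : IsSphereLike S) {c : C(unitInterval, S)} (hc : IsSimpleClosed c) {U V : Set S}
    (hU : IsOpen U) (hV : IsOpen V) (hVn : V.Nonempty) (hUV : Disjoint U V)
    (h : U ∪ V = (range c)ᶜ) : IsPreconnected U := by
  rw [isPreconnected_iff_subset_of_disjoint]
  intro u v hu hv huv hd
  by_contra! hcon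
  obtain ⟨⟨x, hx, hxu⟩, ⟨y, hy, hyv⟩⟩ := And.imp not_subset.1 not_subset.1 hcon
  refine hc.not_three_regions hS (hU.inter hu) (hU.inter hv) hV
    ⟨y, hy, (huv hy).resolve_right hyv⟩ ⟨x, hx, (huv hx).resolve_left hxu⟩ hVn ?_
    (hUV.mono_left inter_subset_left) (hUV.mono_left inter_subset_left) ?_
  · rw [disjoint_iff_inter_eq_empty, ← inter_inter_distrib_left, hd]
  · rw [← inter_union_distrib_left, inter_eq_left.2 huv, h]

/-- If every point of a set `P` lies outside some set `A ⊆ P` whose complement is connected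
and which contains all points of `P` away from a neighbourhood of the point, then `P` is the
boundary of each region it bounds. -/
theorem frontier_eq_of_compl_eq_union {P U V : Set S}
    (hP : ∀ x ∈ P, ∀ N ∈ 𝓝 x, ∃ A ⊆ P, P \ N ⊆ A ∧ x ∉ A ∧ IsPreconnected Aᶜ)
    (hU : IsOpen U) (hV : IsOpen V) (hUn : U.Nonempty) (hUV : Disjoint U V)
    (h : U ∪ V = Pᶜ) : frontier U = P := by
  have hUP : Disjoint U P := disjoint_left.2 fun z hz ↦ (h.le (.inl hz) : z ∈ Pᶜ)
  rw [hU.frontier_eq]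
  refine Subset.antisymm (fun z hz ↦ ?_) fun x hx ↦ ⟨?_, fun hxU ↦ disjoint_left.1 hUP hxU hx⟩
  · by_contra hzP
    have hzV : z ∈ V := (h.ge hzP : z ∈ U ∪ V).resolve_left hz.2
    exact disjoint_left.1 (hUV.closure_left hV) hz.1 hzV
  · by_contra hxU
    obtain ⟨A, hAP, hNA, hxA, hA⟩ := hP x hx _ (isClosed_closure.isOpen_compl.mem_nhds hxU)
    have hUA : U ⊆ Aᶜ := fun z hz hzA ↦ disjoint_left.1 hUP hz (hAP hzA)
    have hcov : Aᶜ ⊆ U ∪ (closure U)ᶜ := fun z hz ↦ by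
      by_cases hzU : z ∈ closure U
      · refine .inl ?_
        by_contra hzU'
        have hzV : z ∉ V := disjoint_left.1 (hUV.closure_left hV) hzU
        have hzP : z ∈ P := by
          by_contra hzP
          exact (h.ge hzP : z ∈ U ∪ V).elim hzU' hzV
        exact hz (hNA ⟨hzP, not_not.2 hzU⟩)
      · exact .inr hzU
    rcases hA.subset_or_subset hU isClosed_closure.isOpen_compl
      (disjoint_compl_right.mono_left subset_closure) hcov with hsub | hsub
    · exact hxU (subset_closure (hsub hxA))
    · obtain ⟨z, hz⟩ := hUn
      exact hsub (hUA hz) (subset_closure hz)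

/-- Any point of a simple closed curve lies outside a subarc containing all points of the curve
away from a neighbourhood of the point. -/
theorem IsSimpleClosed.exists_arc [T2Space S] {c : C(unitInterval, S)}
    (hc : IsSimpleClosed c) {N : Set S} (hN : N ∈ 𝓝 (c 0)) :
    ∃ A ⊆ range c, IsClosed A ∧ range c \ N ⊆ A ∧ c 0 ∉ A ∧ HasLogs A := by
  have h0 : ∀ᶠ t in 𝓝 (0 : unitInterval), c t ∈ N := c.continuous.continuousAt hN
  have h1 : ∀ᶠ t in 𝓝 (1 : unitInterval), c t ∈ N :=
    c.continuous.continuousAt (by rwa [← hc.closed])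
  obtain ⟨r, hr, hr0⟩ := Metric.eventually_nhds_iff.1 h0
  obtain ⟨s, hs, hs1⟩ := Metric.eventually_nhds_iff.1 h1
  obtain ⟨ε, hε, hε'⟩ : ∃ ε : ℝ, 0 < ε ∧ ε < min (min r s) (1 / 2) := exists_between (by positivity)
  simp only [lt_min_iff] at hε'
  obtain ⟨⟨hεr, hεs⟩, hε2⟩ := hε'
  have hw : 0 < 1 - 2 * ε := by linarith
  let a : C(unitInterval, unitInterval) :=
    ⟨fun t ↦ ⟨ε + (1 - 2 * ε) * t, by nlinarith [t.2.1], by nlinarith [t.2.2]⟩, by fun_prop⟩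
  have ha : ∀ t, (a t : ℝ) = ε + (1 - 2 * ε) * t := fun t ↦ rfl
  have ha0 : ∀ t, a t ≠ 0 := fun t e ↦ by
    have := congrArg Subtype.val e
    rw [ha] at this
    simp only [Icc.coe_zero] at this
    nlinarith [t.2.1]
  have ha1 : ∀ t, a t ≠ 1 := fun t e ↦ by
    have := congrArg Subtype.val e
    rw [ha] at this
    simp only [Icc.coe_one] at this
    nlinarith [t.2.2]
  refine ⟨range (c.comp a), by rintro _ ⟨t, rfl⟩; exact mem_range_self _,
    (isCompact_range (c.comp a).continuous).isClosed, ?_, ?_, .of_path _ fun t u e ↦ ?_⟩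
  · rintro _ ⟨⟨t, rfl⟩, ht⟩
    have htr : ε ≤ t := by
      by_contra! h
      exact ht (hr0 (by rw [Subtype.dist_eq, Real.dist_eq, Icc.coe_zero, sub_zero,
        abs_of_nonneg t.2.1]; linarith))
    have hts : (t : ℝ) ≤ 1 - ε := by
      by_contra! h
      exact ht (hs1 (by rw [Subtype.dist_eq, dist_comm, Real.dist_eq, Icc.coe_one,
        abs_of_nonneg (by linarith [t.2.2])]; linarith))
    refine ⟨⟨(t - ε) / (1 - 2 * ε), div_nonneg (by linarith) hw.le,
      (div_le_one hw).2 (by linarith)⟩, ?_⟩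
    rw [ContinuousMap.comp_apply]
    congr 1
    ext
    rw [ha, mul_div_cancel₀ _ hw.ne']
    ring
  · rintro ⟨t, ht⟩
    rcases hc.eq_of_apply_eq _ _ ht with e | ⟨e, -⟩ | ⟨e, -⟩
    exacts [ha0 t e, ha0 t e, ha1 t e]
  · rcases hc.eq_of_apply_eq _ _ e with e | ⟨e, -⟩ | ⟨e, -⟩
    · have := congrArg Subtype.val e
      rw [ha, ha] at this
      exact Subtype.ext (mul_left_cancel₀ hw.ne' (by linarith))
    exacts [(ha0 t e).elim, (ha1 t e).elim]

/-- An embedded circle, traversed from any of its points, is a simple closed path. -/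
theorem exists_isSimpleClosed_of_circle {f : Circle → S} (hf : Continuous f)
    (hi : Function.Injective f) (x : Circle) :
    ∃ c : C(unitInterval, S), IsSimpleClosed c ∧ c 0 = f x ∧ range c = range f := by
  have hpi := Real.two_pi_pos
  let c : C(unitInterval, S) := ⟨fun t ↦ f (x * Circle.exp (2 * Real.pi * t)), by fun_prop⟩
  have hc0 : c 0 = f x := by simp [c]
  have hc1 : c 1 = f x := by simp [c]
  refine ⟨c, ⟨hc0.trans hc1.symm, fun s t e ↦ ?_⟩, hc0, Subset.antisymm ?_ ?_⟩
  · obtain ⟨m, hm⟩ := Circle.exp_eq_exp.1 (mul_left_cancel (hi e))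
    have hm' : (s : ℝ) = t + m := by
      have : 2 * Real.pi * ((s : ℝ) - (t + m)) = 0 := by linear_combination hm
      linarith [(mul_eq_zero.1 this).resolve_left hpi.ne']
    have hs := s.2
    have ht := t.2
    have h1 : (-1 : ℤ) ≤ m := by
      have : (-1 : ℝ) ≤ m := by linarith [hs.1, ht.2]
      exact_mod_cast this
    have h2 : m ≤ 1 := by
      have : (m : ℝ) ≤ 1 := by linarith [hs.2, ht.1]
      exact_mod_cast this
    interval_cases m <;> push_cast at hm'
    · exact .inr (.inl ⟨Subtype.ext (show (s : ℝ) = 0 by linarith [hs.1, ht.2]),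
        Subtype.ext (show (t : ℝ) = 1 by linarith [hs.1, ht.2])⟩)
    · exact .inl (Subtype.ext (by linarith))
    · exact .inr (.inr ⟨Subtype.ext (show (s : ℝ) = 1 by linarith [hs.2, ht.1]),
        Subtype.ext (show (t : ℝ) = 0 by linarith [hs.2, ht.1])⟩)
  · rintro _ ⟨t, rfl⟩
    exact mem_range_self _
  · rintro _ ⟨y, rfl⟩
    obtain ⟨r, hr⟩ := Circle.exp_surjective (x⁻¹ * y)
    refine ⟨⟨Int.fract (r / (2 * Real.pi)), Int.fract_nonneg _, (Int.fract_lt_one _).le⟩, ?_⟩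
    have : Circle.exp (2 * Real.pi * Int.fract (r / (2 * Real.pi))) = x⁻¹ * y := by
      rw [← hr, Circle.exp_eq_exp]
      refine ⟨-⌊r / (2 * Real.pi)⌋, ?_⟩
      rw [Int.fract]
      push_cast
      field_simp
      ring
    simp [c, this]

/-- A sphere is not a circle. -/
theorem nonempty_compl_range_circle [CompactSpace S] [T2Space S] (hS : IsSphereLike S)
    {f : Circle → S} (hf : Continuous f) (hi : Function.Injective f) : (range f)ᶜ.Nonempty := by
  rw [nonempty_compl]
  intro hr
  have hA : ({f 1, f (-1)} : Set S).Finite := toFinite _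
  have hpre := isPreconnected_compl_of_hasLogs hS hA.isClosed (.of_finite hA)
  let e := (Equiv.ofBijective f ⟨hi, range_eq_univ.1 hr⟩)
  have he : Continuous e.symm := (Continuous.homeoOfEquivCompactToT2 (f := e) hf).symm.continuous
  have hef : ∀ z, e.symm (f z) = z := e.symm_apply_apply
  have him := hpre.image (fun s ↦ (e.symm s : ℂ).im) (by fun_prop : Continuous _).continuousOn
  have hmem : ∀ z : Circle, (z : ℂ) ≠ 1 → (z : ℂ) ≠ -1 →
      (z : ℂ).im ∈ (fun s ↦ (e.symm s : ℂ).im) '' {f 1, f (-1)}ᶜ := fun z h1 h2 ↦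
    ⟨f z, by
      simp only [mem_compl_iff, mem_insert_iff, mem_singleton_iff, hi.eq_iff, not_or]
      exact ⟨fun h ↦ h1 (by simp [h]), fun h ↦ h2 (by simp [h])⟩, by simp only [hef]⟩
  have hI := hmem ⟨I, by simp [Submonoid.unitSphere]⟩
    (fun h ↦ by simpa using congrArg im h) (fun h ↦ by simpa using congrArg im h)
  have hJ := hmem ⟨-I, by simp [Submonoid.unitSphere]⟩
    (fun h ↦ by simpa using congrArg im h) (fun h ↦ by simpa using congrArg im h)
  obtain ⟨s, hs, hs0⟩ := him.Icc_subset hJ hI (show (0 : ℝ) ∈ Icc _ _ by simp)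
  obtain ⟨z, rfl⟩ : s ∈ range f := hr ▸ mem_univ s
  simp only [hef] at hs0
  have hz : (z : ℂ).re * (z : ℂ).re = 1 := by
    have := Circle.normSq_coe z
    rwa [normSq_apply, hs0, mul_zero, add_zero] at this
  refine hs ?_
  simp only [mem_insert_iff, mem_singleton_iff, hi.eq_iff]
  rcases mul_self_eq_one_iff.1 hz with h | h
  · exact .inl (Circle.ext (Complex.ext (by simpa using h) (by simpa using hs0)))
  · exact .inr (Circle.ext (Complex.ext (by simpa using h) (by simpa using hs0)))

/-- The Jordan curve theorem for spaces whose punctures are planes. -/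
theorem IsSphereLike.jordan_curve [CompactSpace S] [T2Space S] (hS : IsSphereLike S)
    {f : Circle → S} (hf : Continuous f) (hi : Function.Injective f) :
    ∃ U V : Set S, IsOpen U ∧ IsOpen V ∧ IsConnected U ∧ IsConnected V ∧ Disjoint U V ∧
      U ∪ V = (range f)ᶜ ∧ frontier U = range f ∧ frontier V = range f := by
  obtain ⟨c, hc, -, hcf⟩ := exists_isSimpleClosed_of_circle hf hi 1
  have hP : IsOpen (range f)ᶜ := (isCompact_range hf).isClosed.isOpen_compl
  have hsep := hc.not_isPreconnected_compl hS (hcf ▸ nonempty_compl_range_circle hS hf hi)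
  rw [hcf, isPreconnected_iff_subset_of_disjoint] at hsep
  push Not at hsep
  obtain ⟨u, v, hu, hv, huv, hd, hnu, hnv⟩ := hsep
  obtain ⟨x, hx, hxu⟩ := not_subset.1 hnu
  obtain ⟨y, hy, hyv⟩ := not_subset.1 hnv
  have hU := hP.inter hu
  have hV := hP.inter hv
  have hUn : ((range f)ᶜ ∩ u).Nonempty := ⟨y, hy, (huv hy).resolve_right hyv⟩
  have hVn : ((range f)ᶜ ∩ v).Nonempty := ⟨x, hx, (huv hx).resolve_left hxu⟩
  have hUV : Disjoint ((range f)ᶜ ∩ u) ((range f)ᶜ ∩ v) := by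
    rw [disjoint_iff_inter_eq_empty, ← inter_inter_distrib_left, hd]
  have hcov : (range f)ᶜ ∩ u ∪ (range f)ᶜ ∩ v = (range f)ᶜ := by
    rw [← inter_union_distrib_left, inter_eq_left.2 huv]
  have hcov' := (union_comm _ _).trans hcov
  have harc : ∀ x ∈ range f, ∀ N ∈ 𝓝 x,
      ∃ A ⊆ range f, range f \ N ⊆ A ∧ x ∉ A ∧ IsPreconnected Aᶜ := by
    rintro _ ⟨x, rfl⟩ N hN
    obtain ⟨c, hc, hc0, hcf⟩ := exists_isSimpleClosed_of_circle hf hi x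
    rw [← hc0] at hN ⊢
    rw [← hcf]
    obtain ⟨A, hA, hAc, hNA, hxA, hlog⟩ := hc.exists_arc hN
    exact ⟨A, hA, hNA, hxA, isPreconnected_compl_of_hasLogs hS hAc hlog⟩
  exact ⟨_, _, hU, hV,
    ⟨hUn, hc.isPreconnected_of_compl_eq_union hS hU hV hVn hUV (hcf ▸ hcov)⟩,
    ⟨hVn, hc.isPreconnected_of_compl_eq_union hS hV hU hUn hUV.symm (hcf ▸ hcov')⟩, hUV, hcov,
    frontier_eq_of_compl_eq_union harc hU hV hUn hUV hcov,
    frontier_eq_of_compl_eq_union harc hV hU hVn hUV.symm hcov'⟩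

theorem isSphereLike_sphere :
    IsSphereLike (Metric.sphere (0 : EuclideanSpace ℝ (Fin 3)) 1) := fun q ↦ by
  have hq : ‖(q : EuclideanSpace ℝ (Fin 3))‖ = 1 := by simp
  have : Fact (Module.finrank ℝ (EuclideanSpace ℝ (Fin 3)) = 2 + 1) := ⟨by simp⟩
  have hdim : Module.finrank ℝ ℂ = Module.finrank ℝ (ℝ ∙ (q : EuclideanSpace ℝ (Fin 3)))ᗮ := by
    rw [Complex.finrank_real_complex,
      Submodule.finrank_orthogonal_span_singleton (n := 2) (norm_ne_zero_iff.1 (by simp [hq]))]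
  let e := ContinuousLinearEquiv.ofFinrankEq hdim
  refine ⟨fun x ↦ e.symm (stereographic hq x), fun z ↦ (stereographic hq).symm (e z), ?_, ?_, ?_, ?_⟩
  · exact (isOpenEmbedding_stereographic_symm hq).comp e.toHomeomorph.isOpenEmbedding
  · exact (e.surjective.range_comp (stereographic hq).symm).trans (range_stereographic_symm hq)
  · have := (stereographic hq).continuousOn
    rw [stereographic_source] at this
    exact e.symm.continuous.comp_continuousOn this
  · intro z
    exact (congrArg e.symm ((stereographic hq).right_inv (by simp))).trans (e.symm_apply_apply z)

end JordanCurve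

/-- Jordan curve theorem on the sphere: a simple closed curve `P ⊆ S²` separates the sphere
into exactly two connected components, each open with boundary `P`. -/
theorem jordan_curve_sphere
    (P : Set (Metric.sphere (0 : EuclideanSpace ℝ (Fin 3)) 1))
    (hP : ∃ f : Circle → Metric.sphere (0 : EuclideanSpace ℝ (Fin 3)) 1,
      Continuous f ∧ Function.Injective f ∧ Set.range f = P) :
    ∃ C₁ C₂ : Set (Metric.sphere (0 : EuclideanSpace ℝ (Fin 3)) 1),
      IsOpen C₁ ∧ IsOpen C₂ ∧ IsConnected C₁ ∧ IsConnected C₂ ∧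
      Disjoint C₁ C₂ ∧ C₁ ∪ C₂ = Pᶜ ∧ frontier C₁ = P ∧ frontier C₂ = P := by
  obtain ⟨f, hf, hi, rfl⟩ := hP
  exact JordanCurve.isSphereLike_sphere.jordan_curve hf hi
end

section
/- Let P be a simple closed curve in S² such that P and its antipodal image -P are disjoint. Then S² \ (P ∪ -P) has exactly three connected components: one component C₀ invariant under the antipodal map, and two components C₁, C₂ with -C₁ = C₂. -/
open Set Filter Topology

/-- `f` has a continuous logarithm on the set `s`. -/
def HasLogOn {X : Type*} [TopologicalSpace X] (f : X → ℂ) (s : Set X) : Prop :=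
  ∃ g : X → ℂ, ContinuousOn g s ∧ ∀ x ∈ s, f x = Complex.exp (g x)

namespace HasLogOn

variable {X Y : Type*} [TopologicalSpace X] [TopologicalSpace Y] {f f' : X → ℂ} {s t : Set X}

theorem mono (h : HasLogOn f t) (hst : s ⊆ t) : HasLogOn f s := by
  obtain ⟨g, hg, hfg⟩ := h
  exact ⟨g, hg.mono hst, fun x hx ↦ hfg x (hst hx)⟩

theorem congr (h : HasLogOn f s) (hff' : ∀ x ∈ s, f' x = f x) : HasLogOn f' s := by
  obtain ⟨g, hg, hfg⟩ := h
  exact ⟨g, hg, fun x hx ↦ (hff' x hx).trans (hfg x hx)⟩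

theorem comp (h : HasLogOn f s) {u : Y → X} {r : Set Y} (hu : ContinuousOn u r)
    (hur : MapsTo u r s) : HasLogOn (fun y ↦ f (u y)) r := by
  obtain ⟨g, hg, hfg⟩ := h
  exact ⟨g ∘ u, hg.comp hu hur, fun y hy ↦ hfg _ (hur hy)⟩

theorem of_const {c : ℂ} (hc : c ≠ 0) (hf : ∀ x ∈ s, f x = c) : HasLogOn f s :=
  ⟨fun _ ↦ Complex.log c, continuousOn_const, fun x hx ↦ by rw [hf x hx, Complex.exp_log hc]⟩

/-- Homotopy invariance of the existence of a continuous logarithm. -/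
theorem of_homotopy {H : unitInterval → X → ℂ}
    (hH : ContinuousOn (fun q : unitInterval × X ↦ H q.1 q.2) (univ ×ˢ s))
    (hne : ∀ t, ∀ x ∈ s, H t x ≠ 0) (h0 : HasLogOn (H 0) s) : HasLogOn (H 1) s := by
  classical
  obtain ⟨g, hg, hfg⟩ := h0
  let K : C(unitInterval × s, {z : ℂ // z ≠ 0}) :=
    ⟨fun q ↦ ⟨H q.1 q.2, hne _ _ q.2.2⟩, by
      refine Continuous.subtype_mk ?_ _
      exact hH.comp_continuous (f := fun q : unitInterval × s ↦ (q.1, (q.2 : X)))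
        (by fun_prop) (fun q ↦ ⟨trivial, q.2.2⟩)⟩
  let G : C(s, ℂ) := ⟨fun x ↦ g x, continuousOn_iff_continuous_domRestrict.mp hg⟩
  have hK : ∀ x, K (0, x) = ⟨Complex.exp (G x), (G x).exp_ne_zero⟩ := fun x ↦
    Subtype.ext (hfg x x.2)
  let L := Complex.isCoveringMap_exp.liftHomotopy K G hK
  have hL : ∀ q, Complex.exp (L q) = H q.1 q.2 := fun q ↦
    congrArg Subtype.val (congrFun (Complex.isCoveringMap_exp.liftHomotopy_lifts K G hK) q)
  refine ⟨fun x ↦ if hx : x ∈ s then L (1, ⟨x, hx⟩) else 0, ?_, fun x hx ↦ ?_⟩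
  · rw [continuousOn_iff_continuous_domRestrict]
    have hext : s.domRestrict (fun x ↦ if hx : x ∈ s then L (1, ⟨x, hx⟩) else 0) =
        fun x ↦ L (1, x) := by
      ext x
      simp
    rw [hext]
    fun_prop
  · simp [hx, hL]

/-- A nonvanishing continuous function has a logarithm on the whole plane. -/
theorem of_complex {f : ℂ → ℂ} (hf : Continuous f) (hne : ∀ z, f z ≠ 0) :
    HasLogOn f univ := by
  have := of_homotopy (H := fun t z ↦ f ((t : ℂ) * z)) (s := univ)
    (Continuous.continuousOn (by fun_prop)) (fun _ _ _ ↦ hne _)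
    (of_const (c := f 0) (hne 0) (by simp))
  simpa using this

end HasLogOn

/-- Two continuous logarithms of a function on a preconnected set differ by a constant. -/
theorem IsPreconnected.exists_int_of_exp_eq {X : Type*} [TopologicalSpace X] {s : Set X}
    (hs : IsPreconnected s) {g h : X → ℂ} (hg : ContinuousOn g s) (hh : ContinuousOn h s)
    (hgh : ∀ x ∈ s, Complex.exp (g x) = Complex.exp (h x)) :
    ∃ n : ℤ, ∀ x ∈ s, g x = h x + n * (2 * Real.pi * Complex.I) := by
  rcases s.eq_empty_or_nonempty with rfl | ⟨x₀, hx₀⟩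
  · simp
  have hint : ∀ x ∈ s, ∃ n : ℤ, g x = h x + n * (2 * Real.pi * Complex.I) := fun x hx ↦
    Complex.exp_eq_exp_iff_exists_int.mp (hgh x hx)
  obtain ⟨n, hn⟩ := hint x₀ hx₀
  refine ⟨n, fun x hx ↦ ?_⟩
  have hpi : (2 * Real.pi * Complex.I : ℂ) ≠ 0 := Complex.two_pi_I_ne_zero
  have key := hs.constant_of_mapsTo (T := range ((↑) : ℤ → ℝ))
    (f := fun x ↦ ((g x - h x) / (2 * Real.pi * Complex.I)).re)
    ⟨Int.isClosedEmbedding_coe_real.isEmbedding.toHomeomorph.symm.isEmbedding.discreteTopology⟩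
    (by fun_prop)
    (fun y hy ↦ by
      obtain ⟨m, hm⟩ := hint y hy
      refine ⟨m, ?_⟩
      beta_reduce
      rw [hm, add_sub_cancel_left, mul_div_cancel_right₀ _ hpi, Complex.intCast_re]) hx hx₀
  obtain ⟨m, hm⟩ := hint x hx
  simp only [hm, hn, add_sub_cancel_left, mul_div_cancel_right₀ _ hpi, Complex.intCast_re] at key
  rw [hm, Int.cast_injective key]

/-- Logarithms on two open sets with preconnected intersection can be glued. -/
theorem HasLogOn.union {X : Type*} [TopologicalSpace X] {f : X → ℂ} {U V : Set X}
    (hU : IsOpen U) (hV : IsOpen V) (hUV : IsPreconnected (U ∩ V))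
    (hfU : HasLogOn f U) (hfV : HasLogOn f V) : HasLogOn f (U ∪ V) := by
  classical
  obtain ⟨g, hg, hfg⟩ := hfU
  obtain ⟨h, hh, hfh⟩ := hfV
  obtain ⟨n, hn⟩ := hUV.exists_int_of_exp_eq (hg.mono inter_subset_left)
    (hh.mono inter_subset_right) (fun x hx ↦ (hfg x hx.1).symm.trans (hfh x hx.2))
  let k : X → ℂ := fun x ↦ if x ∈ U then g x else h x + n * (2 * Real.pi * Complex.I)
  have hkU : ∀ x ∈ U, k x = g x := fun x hx ↦ if_pos hx
  have hkV : ∀ x ∈ V, k x = h x + n * (2 * Real.pi * Complex.I) := fun x hx ↦ by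
    by_cases hxU : x ∈ U
    · rw [hkU x hxU, hn x ⟨hxU, hx⟩]
    · exact if_neg hxU
  refine ⟨k, ?_, ?_⟩
  · exact ContinuousOn.union_of_isOpen (hg.congr hkU)
      ((hh.add continuousOn_const).congr hkV) hU hV
  · rintro x (hx | hx)
    · rw [hkU x hx, hfg x hx]
    · rw [hkV x hx, hfh x hx, Complex.exp_eq_exp_iff_exists_int]
      exact ⟨-n, by push_cast; ring⟩

/-- A nonzero power of `z - c` has no continuous logarithm on a circle around `c`. -/
theorem HasLogOn.eq_zero_of_zpow_sub {c : ℂ} {R : ℝ} (hR : 0 < R) {m : ℤ}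
    (h : HasLogOn (fun z ↦ (z - c) ^ m) (Metric.sphere c R)) : m = 0 := by
  obtain ⟨g, hg, hfg⟩ := h
  have hmem : ∀ θ : ℝ, circleMap c R θ ∈ Metric.sphere c R := circleMap_mem_sphere c hR.le
  obtain ⟨n, hn⟩ := isPreconnected_univ.exists_int_of_exp_eq (X := ℝ)
    (g := fun θ ↦ g (circleMap c R θ))
    (h := fun θ ↦ m * (Real.log R + θ * Complex.I))
    (hg.comp (continuous_circleMap c R).continuousOn (fun θ _ ↦ hmem θ))
    (Continuous.continuousOn (by fun_prop)) (fun θ _ ↦ by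
      rw [← hfg _ (hmem θ), Complex.exp_int_mul, Complex.exp_add, ← Complex.ofReal_exp,
        Real.exp_log hR]
      simp [circleMap])
  have h0 := hn 0 trivial
  have h1 := hn (2 * Real.pi) trivial
  rw [show circleMap c R (2 * Real.pi) = circleMap c R 0 by simp [circleMap]] at h1
  rw [h0] at h1
  push_cast at h1
  have : (m : ℂ) * (2 * Real.pi * Complex.I) = 0 := by linear_combination h1.symm
  rcases mul_eq_zero.mp this with h | h
  · exact_mod_cast h
  · exact absurd h Complex.two_pi_I_ne_zero

/-- A continuous nonvanishing function on the circle has a logarithm along the universal cover,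
whose increment over a period is an integral multiple of `2πi`. -/
theorem Circle.exists_lift_log {f : Circle → ℂ} (hf : Continuous f) (hne : ∀ z, f z ≠ 0) :
    ∃ (g : ℝ → ℂ) (d : ℤ), Continuous g ∧ (∀ t, f (Circle.exp t) = Complex.exp (g t)) ∧
      ∀ t, g (t + 2 * Real.pi) = g t + d * (2 * Real.pi * Complex.I) := by
  obtain ⟨g, hg, hfg⟩ := HasLogOn.of_complex (f := fun z ↦ f (Circle.exp z.re))
    (by fun_prop) (fun _ ↦ hne _)
  have hgc : Continuous g := continuousOn_univ.mp hg
  have hfg' : ∀ t : ℝ, f (Circle.exp t) = Complex.exp (g t) := fun t ↦ by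
    simpa using hfg t trivial
  obtain ⟨d, hd⟩ := isPreconnected_univ.exists_int_of_exp_eq (X := ℝ)
    (g := fun t ↦ g ((t + 2 * Real.pi : ℝ) : ℂ)) (h := fun t ↦ g t)
    (Continuous.continuousOn (by fun_prop)) (Continuous.continuousOn (by fun_prop))
    (fun t _ ↦ by rw [← hfg', ← hfg', Circle.periodic_exp])
  exact ⟨fun t ↦ g t, d, by fun_prop, hfg', fun t ↦ hd t trivial⟩

/-- A periodic logarithm on the universal cover of the circle descends to the circle. -/
theorem HasLogOn.of_periodic {f : Circle → ℂ} {g : ℝ → ℂ} (hg : Continuous g)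
    (hfg : ∀ t, f (Circle.exp t) = Complex.exp (g t))
    (hper : Function.Periodic g (2 * Real.pi)) : HasLogOn f univ := by
  have hc : Continuous hper.lift := continuous_coinduced_dom.mpr hg
  refine ⟨hper.lift ∘ AddCircle.homeomorphCircle'.symm,
    (hc.comp AddCircle.homeomorphCircle'.symm.continuous).continuousOn, fun z _ ↦ ?_⟩
  obtain ⟨t, rfl⟩ : ∃ t : ℝ, z = Circle.exp t := ⟨_, (Circle.exp_arg z).symm⟩
  rw [hfg, Function.comp_apply, ← AddCircle.homeomorphCircle'_apply_mk,
    Homeomorph.symm_apply_apply]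
  rfl

/-- Any two nonvanishing functions on the circle are multiplicatively dependent up to
exponentials. -/
theorem Circle.exists_hasLogOn_zpow_mul_zpow {f₁ f₂ : Circle → ℂ} (hf₁ : Continuous f₁)
    (hf₂ : Continuous f₂) (hne₁ : ∀ z, f₁ z ≠ 0) (hne₂ : ∀ z, f₂ z ≠ 0) :
    ∃ m n : ℤ, (m ≠ 0 ∨ n ≠ 0) ∧ HasLogOn (fun z ↦ f₁ z ^ m * f₂ z ^ n) univ := by
  obtain ⟨g₁, d₁, hg₁, hfg₁, hd₁⟩ := Circle.exists_lift_log hf₁ hne₁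
  obtain ⟨g₂, d₂, hg₂, hfg₂, hd₂⟩ := Circle.exists_lift_log hf₂ hne₂
  have key : ∀ m n : ℤ, m * d₁ + n * d₂ = 0 →
      HasLogOn (fun z ↦ f₁ z ^ m * f₂ z ^ n) univ := fun m n hmn ↦ by
    refine HasLogOn.of_periodic (g := fun t ↦ m * g₁ t + n * g₂ t) (by fun_prop)
      (fun t ↦ by rw [hfg₁, hfg₂, Complex.exp_add, Complex.exp_int_mul, Complex.exp_int_mul])
      (fun t ↦ ?_)
    have : (m : ℂ) * d₁ + n * d₂ = 0 := by exact_mod_cast hmn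
    simp only [hd₁, hd₂]
    linear_combination (2 * Real.pi * Complex.I) * this
  by_cases h : d₁ = 0
  · exact ⟨1, 0, by simp, key 1 0 (by simp [h])⟩
  · exact ⟨d₂, -d₁, by simp [h], key _ _ (by ring)⟩

/-- A function which is continuous on the traces of two closed sets covering `s` is continuous
on `s`. -/
theorem ContinuousOn.of_isClosed_cover {X Y : Type*} [TopologicalSpace X] [TopologicalSpace Y]
    {f : X → Y} {s A B : Set X} (hA : IsClosed A) (hB : IsClosed B) (hs : s ⊆ A ∪ B)
    (hfA : ContinuousOn f (s ∩ A)) (hfB : ContinuousOn f (s ∩ B)) : ContinuousOn f s := by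
  have aux : ∀ C, IsClosed C → ContinuousOn f (s ∩ C) → ∀ x ∈ s,
      ContinuousWithinAt f (s ∩ C) x := fun C hC hfC x hx ↦ by
    by_cases hxC : x ∈ C
    · exact hfC x ⟨hx, hxC⟩
    · exact continuousWithinAt_of_notMem_closure
        fun h ↦ hxC (hC.closure_subset_iff.mpr inter_subset_right h)
  intro x hx
  have := (aux A hA hfA x hx).union (aux B hB hfB x hx)
  rwa [← inter_union_distrib_left, inter_eq_left.mpr hs] at this

section Sphere

variable {X : Type*} [TopologicalSpace X] [T2Space X]

/-- If `e` identifies the complement of `q` with the plane and `O` is an open set with boundary in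
`K` that stays away from `q`, then the winding of `K` around a point of `O` is nontrivial. -/
theorem OpenPartialHomeomorph.eq_zero_of_hasLogOn [CompactSpace X] (e : OpenPartialHomeomorph X ℂ)
    {q : X} (hes : e.source = {q}ᶜ) (het : e.target = univ) {K O : Set X} (hK : IsClosed K)
    (hO : IsOpen O) (hOK : IsClosed (O ∪ K)) (hq : q ∉ O ∪ K) {p₁ p₂ : X} (hp₁ : p₁ ∈ O)
    (hp₂ : p₂ ∉ O ∪ K) (hp₂q : p₂ ≠ q) {m n : ℤ}
    (h : HasLogOn (fun x ↦ (e x - e p₁) ^ m * (e x - e p₂) ^ n) K) : m = 0 := by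
  classical
  obtain ⟨g, hg, hfg⟩ := h
  obtain ⟨G, hG⟩ := ContinuousMap.exists_restrict_eq hK
    ⟨K.domRestrict g, continuousOn_iff_continuous_domRestrict.mp hg⟩
  have hGK : ∀ x ∈ K, G x = g x := fun x hx ↦ congrArg (fun u ↦ u ⟨x, hx⟩) hG
  have hsymm : Continuous e.symm := by
    have := e.continuousOn_symm
    rwa [het, continuousOn_univ] at this
  have hes' : ∀ z, e (e.symm z) = z := fun z ↦ e.right_inv (by rw [het]; trivial)
  have hse : ∀ x, x ≠ q → e.symm (e x) = x := fun x hx ↦ e.left_inv (by rwa [hes])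
  have hp₁q : p₁ ≠ q := by
    rintro rfl
    exact hq (Or.inl hp₁)
  have hOK₂ : ∀ z, e.symm z ∈ O ∪ K → z - e p₂ ≠ 0 := fun z hz h0 ↦ hp₂ (by
    rwa [sub_eq_zero.mp h0, hse _ hp₂q] at hz)
  have hO₁ : ∀ z, e.symm z ∉ O → z - e p₁ ≠ 0 := fun z hz h0 ↦ hz (by
    rwa [sub_eq_zero.mp h0, hse _ hp₁q])
  let F : ℂ → ℂ := fun z ↦ if e.symm z ∈ O then Complex.exp (G (e.symm z)) * (z - e p₂) ^ (-n)
    else (z - e p₁) ^ m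
  have hFA : ∀ z ∈ e.symm ⁻¹' (O ∪ K), F z = Complex.exp (G (e.symm z)) * (z - e p₂) ^ (-n) := by
    intro z hz
    by_cases hzO : e.symm z ∈ O
    · exact if_pos hzO
    · have hzK : e.symm z ∈ K := hz.resolve_left hzO
      have h2 := hfg _ hzK
      simp only [hes'] at h2
      rw [show F z = (z - e p₁) ^ m from if_neg hzO, hGK _ hzK, ← h2, mul_assoc,
        ← zpow_add₀ (hOK₂ z hz)]
      simp
  have hFB : ∀ z ∈ e.symm ⁻¹' Oᶜ, F z = (z - e p₁) ^ m := fun z hz ↦ if_neg hz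
  have hFc : ContinuousOn F univ := by
    refine ContinuousOn.of_isClosed_cover (hOK.preimage hsymm)
      (hO.isClosed_compl.preimage hsymm) (fun z _ ↦ ?_) ?_ ?_
    · by_cases hz : e.symm z ∈ O
      · exact Or.inl (Or.inl hz)
      · exact Or.inr hz
    · rw [univ_inter]
      refine ContinuousOn.congr ?_ hFA
      exact (Continuous.continuousOn (by fun_prop)).mul
        (ContinuousOn.zpow₀ (by fun_prop) _ fun z hz ↦ Or.inl (hOK₂ z hz))
    · rw [univ_inter]
      refine ContinuousOn.congr ?_ hFB
      exact ContinuousOn.zpow₀ (by fun_prop) _ fun z hz ↦ Or.inl (hO₁ z hz)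
  have hFne : ∀ z, F z ≠ 0 := fun z ↦ by
    by_cases hz : e.symm z ∈ O
    · rw [hFA z (Or.inl hz)]
      exact mul_ne_zero (Complex.exp_ne_zero _) (zpow_ne_zero _ (hOK₂ z (Or.inl hz)))
    · rw [hFB z hz]
      exact zpow_ne_zero _ (hO₁ z hz)
  have hbdd : Bornology.IsBounded (e '' (O ∪ K)) :=
    (hOK.isCompact.image_of_continuousOn (e.continuousOn.mono fun x hx ↦ by
      rw [hes]
      rintro rfl
      exact hq hx)).isBounded
  obtain ⟨R, hR, hsub⟩ := hbdd.subset_ball_lt 0 (e p₁)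
  refine HasLogOn.eq_zero_of_zpow_sub hR (c := e p₁)
    (((HasLogOn.of_complex (continuousOn_univ.mp hFc) hFne).mono (subset_univ _)).congr ?_)
  intro z hz
  refine (hFB z fun hzO ↦ ?_).symm
  have := hsub ⟨_, Or.inl hzO, hes' z⟩
  rw [Metric.mem_sphere] at hz
  rw [Metric.mem_ball] at this
  exact this.ne hz

/-- The complement of a simple closed curve in a sphere does not split into three pieces. -/
theorem not_three_open_of_simple_closed_curve [CompactSpace X]
    (hX : ∀ q : X, ∃ e : OpenPartialHomeomorph X ℂ, e.source = {q}ᶜ ∧ e.target = univ)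
    {f : Circle → X} (hf : Continuous f) (hinj : Function.Injective f) {O₁ O₂ O₃ : Set X}
    (h₁ : IsOpen O₁) (h₂ : IsOpen O₂) (h₃ : IsOpen O₃)
    (n₁ : O₁.Nonempty) (n₂ : O₂.Nonempty) (n₃ : O₃.Nonempty)
    (h₁₂ : Disjoint O₁ O₂) (h₁₃ : Disjoint O₁ O₃) (h₂₃ : Disjoint O₂ O₃)
    (hU : O₁ ∪ O₂ ∪ O₃ = (range f)ᶜ) : False := by
  obtain ⟨p₁, hp₁⟩ := n₁
  obtain ⟨p₂, hp₂⟩ := n₂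
  obtain ⟨q, hq⟩ := n₃
  obtain ⟨e, hes, het⟩ := hX q
  have hcl : IsClosed (range f) := (isCompact_range hf).isClosed
  have mem : ∀ x, x ∈ range f ∨ x ∈ O₁ ∨ x ∈ O₂ ∨ x ∈ O₃ := fun x ↦ by
    have := Set.ext_iff.mp hU x
    simp only [mem_union, mem_compl_iff] at this
    tauto
  have nmem : ∀ x ∈ range f, x ∉ O₁ ∧ x ∉ O₂ ∧ x ∉ O₃ := fun x ↦ by
    have := Set.ext_iff.mp hU x
    simp only [mem_union, mem_compl_iff] at this
    tauto
  rw [Set.disjoint_left] at h₁₂ h₁₃ h₂₃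
  have c₁ : IsClosed (O₁ ∪ range f) := by
    have : O₁ ∪ range f = (O₂ ∪ O₃)ᶜ := by
      ext x
      have := mem x; have := nmem x; have := @h₁₂ x; have := @h₁₃ x
      simp only [mem_union, mem_compl_iff]
      tauto
    rw [this]
    exact (h₂.union h₃).isClosed_compl
  have c₂ : IsClosed (O₂ ∪ range f) := by
    have : O₂ ∪ range f = (O₁ ∪ O₃)ᶜ := by
      ext x
      have := mem x; have := nmem x; have := @h₁₂ x; have := @h₂₃ x
      simp only [mem_union, mem_compl_iff]
      tauto
    rw [this]
    exact (h₁.union h₃).isClosed_compl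
  have hne : ∀ x, x ∉ O₃ → x ≠ q := by
    rintro x hx rfl
    exact hx hq
  have hfq : ∀ z, f z ∈ e.source := fun z ↦ by
    rw [hes]
    exact hne _ (nmem _ (mem_range_self z)).2.2
  have hef : Continuous fun z ↦ e (f z) := e.continuousOn.comp_continuous hf hfq
  have hsub : ∀ p, p ∉ range f → p ≠ q → ∀ z, e (f z) - e p ≠ 0 := fun p hp hpq z h0 ↦ by
    have := e.injOn (hfq z) (by rwa [hes]) (sub_eq_zero.mp h0)
    exact hp ⟨z, this⟩
  have hp₁q : p₁ ≠ q := hne _ (h₁₃ hp₁)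
  have hp₂q : p₂ ≠ q := hne _ (h₂₃ hp₂)
  have hp₁f : p₁ ∉ range f := fun h ↦ (nmem _ h).1 hp₁
  have hp₂f : p₂ ∉ range f := fun h ↦ (nmem _ h).2.1 hp₂
  obtain ⟨m, n, hmn, hlog⟩ := Circle.exists_hasLogOn_zpow_mul_zpow
    (f₁ := fun z ↦ e (f z) - e p₁) (f₂ := fun z ↦ e (f z) - e p₂)
    (hef.sub continuous_const) (hef.sub continuous_const)
    (hsub p₁ hp₁f hp₁q) (hsub p₂ hp₂f hp₂q)
  have hinv : ∀ x ∈ range f, f (Function.invFun f x) = x := fun x hx ↦ Function.invFun_eq hx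
  have hlog' : HasLogOn (fun x ↦ (e x - e p₁) ^ m * (e x - e p₂) ^ n) (range f) := by
    refine (hlog.comp (u := Function.invFun f) (r := range f) ?_ (mapsTo_univ _ _)).congr
      fun x hx ↦ ?_
    · rw [(hf.isClosedEmbedding hinj).isEmbedding.isInducing.continuousOn_iff]
      exact continuousOn_id.congr hinv
    · simp only [hinv x hx]
  have hqn₁ : q ∉ O₁ ∪ range f := by
    rintro (h | h)
    exacts [h₁₃ h hq, (nmem _ h).2.2 hq]
  have hqn₂ : q ∉ O₂ ∪ range f := by
    rintro (h | h)
    exacts [h₂₃ h hq, (nmem _ h).2.2 hq]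
  rcases hmn with hm | hn
  · exact hm (e.eq_zero_of_hasLogOn hes het hcl h₁ c₁ hqn₁ hp₁
      (by rintro (h | h); exacts [h₁₂ h hp₂, hp₂f h]) hp₂q hlog')
  · exact hn (e.eq_zero_of_hasLogOn hes het hcl h₂ c₂ hqn₂ hp₂
      (by rintro (h | h); exacts [h₁₂ hp₁ h, hp₁f h]) hp₁q
      (hlog'.congr fun x _ ↦ mul_comm _ _))

/-- A chart on the complement of `q` tends to infinity at `q`. -/
theorem OpenPartialHomeomorph.tendsto_cobounded (e : OpenPartialHomeomorph X ℂ) {q : X}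
    (hes : e.source = {q}ᶜ) (het : e.target = univ) :
    Tendsto e (𝓝[≠] q) (Bornology.cobounded ℂ) := by
  rw [Metric.cobounded_eq_cocompact, hasBasis_cocompact.tendsto_right_iff]
  intro C hC
  have hcl : IsClosed (e.symm '' C) :=
    (hC.image_of_continuousOn (e.continuousOn_symm.mono (by simp [het]))).isClosed
  have hq : q ∈ (e.symm '' C)ᶜ := by
    rintro ⟨z, -, hz⟩
    have := e.map_target (x := z) (by simp [het])
    rw [hz, hes] at this
    exact this rfl
  filter_upwards [self_mem_nhdsWithin, mem_nhdsWithin_of_mem_nhds (hcl.isOpen_compl.mem_nhds hq)]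
    with x hx hxC hxe
  exact hxC ⟨e x, hxe, e.left_inv (by rwa [hes])⟩

/-- On the complement of a path from `q` to `γ 1`, the function `e x - e (γ 1)` has a logarithm,
where `e` is a chart sending `q` to infinity. -/
theorem OpenPartialHomeomorph.hasLogOn_compl_range_path (e : OpenPartialHomeomorph X ℂ) {q : X}
    (hes : e.source = {q}ᶜ) (het : e.target = univ) {γ : unitInterval → X}
    (hγ : Continuous γ) (h0 : γ 0 = q) (h1 : γ 1 ≠ q) :
    HasLogOn (fun x ↦ e x - e (γ 1)) (range γ)ᶜ := by
  classical
  rcases (range γ)ᶜ.eq_empty_or_nonempty with hemp | ⟨p, hp⟩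
  · rw [hemp]
    exact HasLogOn.of_const one_ne_zero (by simp)
  have hmem : ∀ {x}, x ∈ (range γ)ᶜ → x ∈ e.source := fun {x} hx ↦ by
    rw [hes]
    rintro rfl
    exact hx ⟨0, h0⟩
  have hpq := hmem hp
  have hsub : ∀ x ∈ (range γ)ᶜ, ∀ t, γ t ≠ q → e x - e (γ t) ≠ 0 := fun x hx t ht h ↦
    hx ⟨t, (e.injOn (hmem hx) (by rwa [hes]) (sub_eq_zero.mp h)).symm⟩
  let κ : X → ℂ := fun x ↦ if x = q then 0 else (e p - e x)⁻¹
  have hκ : ∀ x ≠ q, κ x = (e p - e x)⁻¹ := fun x hx ↦ if_neg hx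
  have hκq : κ q = 0 := if_pos rfl
  have hκc : ∀ x, x ≠ p → ContinuousAt κ x := by
    intro x hxp
    by_cases hxq : x = q
    · subst hxq
      rw [continuousAt_iff_punctured_nhds, hκq]
      refine Tendsto.congr' ?_ (tendsto_inv₀_cobounded.comp
        ((tendsto_const_sub_cobounded (e p)).comp (e.tendsto_cobounded hes het)))
      filter_upwards [self_mem_nhdsWithin] with y hy
      exact (hκ y hy).symm
    · have hx : x ∈ e.source := by rwa [hes]
      have hev : κ =ᶠ[𝓝 x] fun y ↦ (e p - e y)⁻¹ := by
        filter_upwards [isOpen_ne.mem_nhds hxq] with y hy using hκ y hy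
      refine ContinuousAt.congr ?_ hev.symm
      exact (continuousAt_const.sub (e.continuousAt hx)).inv₀
        fun h ↦ hxp (e.injOn hpq hx (sub_eq_zero.mp h)).symm
  have hκγ : Continuous (κ ∘ γ) := continuous_iff_continuousAt.mpr fun t ↦
    (hκc _ fun h ↦ hp ⟨t, h⟩).comp hγ.continuousAt
  have key := HasLogOn.of_homotopy (s := (range γ)ᶜ)
    (H := fun t x ↦ 1 + (e x - e p) * (κ ∘ γ) t) ?_ ?_ ?_
  · obtain ⟨g, hg, hfg⟩ := key
    have hne := hsub p hp 1 h1
    refine ⟨fun x ↦ g x + Complex.log (e p - e (γ 1)), by fun_prop, fun x hx ↦ ?_⟩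
    rw [Complex.exp_add, ← hfg x hx, Complex.exp_log hne, Function.comp_apply, hκ _ h1]
    field_simp
    ring
  · have he : ContinuousOn e (range γ)ᶜ := e.continuousOn.mono fun x hx ↦ hmem hx
    have he2 : ContinuousOn (fun q : unitInterval × X ↦ e q.2) (univ ×ˢ (range γ)ᶜ) :=
      he.comp continuousOn_snd fun q hq ↦ hq.2
    exact continuousOn_const.add ((he2.sub continuousOn_const).mul
      (hκγ.comp continuous_fst).continuousOn)
  · intro t x hx
    by_cases ht : γ t = q
    · simp [ht, hκq]
    · have h2 := hsub p hp t ht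
      have h3 := hsub x hx t ht
      rw [Function.comp_apply, hκ _ ht]
      have : 1 + (e x - e p) * (e p - e (γ t))⁻¹ = (e x - e (γ t)) * (e p - e (γ t))⁻¹ := by
        field_simp
        ring
      rw [this]
      exact mul_ne_zero h3 (inv_ne_zero h2)
  · exact HasLogOn.of_const one_ne_zero (by simp [h0, hκq])

/-- A simple closed curve separates the sphere. -/
theorem not_isPreconnected_compl_of_simple_closed_curve [CompactSpace X]
    (hX : ∀ q : X, ∃ e : OpenPartialHomeomorph X ℂ, e.source = {q}ᶜ ∧ e.target = univ)
    {f : Circle → X} (hf : Continuous f) (hinj : Function.Injective f) :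
    ¬ IsPreconnected (range f)ᶜ := by
  intro hconn
  obtain ⟨e, hes, het⟩ := hX (f 1)
  have hpi : Circle.exp Real.pi ≠ 1 := fun h ↦ by
    have := congrArg ((↑) : Circle → ℂ) h
    norm_num [Circle.coe_exp] at this
  have hpi' : Circle.exp (-Real.pi) = Circle.exp Real.pi := by
    have := Circle.periodic_exp (-Real.pi)
    rw [← this]
    congr 1
    ring
  let γ : unitInterval → X := fun t ↦ f (Circle.exp (Real.pi * t))
  let γ' : unitInterval → X := fun t ↦ f (Circle.exp (-(Real.pi * t)))
  have hγ : Continuous γ := by fun_prop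
  have hγ' : Continuous γ' := by fun_prop
  have h1 : γ 1 = f (Circle.exp Real.pi) := by simp [γ]
  have h1' : γ' 1 = f (Circle.exp Real.pi) := by simp only [γ', Set.Icc.coe_one, mul_one, hpi']
  have haq : f (Circle.exp Real.pi) ≠ f 1 := hinj.ne hpi
  have hlog := e.hasLogOn_compl_range_path hes het hγ (by simp [γ]) (by rwa [h1])
  have hlog' := e.hasLogOn_compl_range_path hes het hγ' (by simp [γ']) (by rwa [h1'])
  rw [h1] at hlog
  rw [h1'] at hlog'
  have hunion : range γ ∪ range γ' = range f := by
    apply Subset.antisymm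
    · rintro _ (⟨t, rfl⟩ | ⟨t, rfl⟩) <;> exact mem_range_self _
    · rintro _ ⟨z, rfl⟩
      have hle := Complex.abs_arg_le_pi (z : ℂ)
      have hmem : |Complex.arg z| / Real.pi ∈ unitInterval :=
        ⟨by positivity, div_le_one_of_le₀ hle Real.pi_pos.le⟩
      have hmul : Real.pi * (|Complex.arg z| / Real.pi) = |Complex.arg z| := by
        field_simp
      rcases le_total 0 (Complex.arg z) with h | h
      · left
        refine ⟨⟨_, hmem⟩, ?_⟩
        simp only [γ, hmul]
        rw [abs_of_nonneg h, Circle.exp_arg]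
      · right
        refine ⟨⟨_, hmem⟩, ?_⟩
        simp only [γ', hmul]
        rw [abs_of_nonpos h, neg_neg, Circle.exp_arg]
  have hinter : ∀ x ∈ range γ ∩ range γ', x = f 1 ∨ x = f (Circle.exp Real.pi) := by
    rintro _ ⟨⟨t, rfl⟩, ⟨s, hs⟩⟩
    have hexp : Circle.exp (Real.pi * t + Real.pi * s) = 1 := by
      rw [Circle.exp_add, ← hinj hs, ← Circle.exp_add]
      simp
    obtain ⟨n, hn⟩ := Circle.exp_eq_one.mp hexp
    have hts : (t : ℝ) + s = n * 2 := by
      have := Real.pi_pos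
      apply mul_left_cancel₀ this.ne'
      linear_combination hn
    have ht0 := t.2.1; have ht1 := t.2.2; have hs0 := s.2.1; have hs1 := s.2.2
    have hn0 : 0 ≤ n := by
      have : (0 : ℝ) ≤ n := by linarith
      exact_mod_cast this
    have hn1 : n ≤ 1 := by
      have : (n : ℝ) ≤ 1 := by linarith
      exact_mod_cast this
    obtain rfl | rfl : n = 0 ∨ n = 1 := by omega
    · left
      have : (t : ℝ) = 0 := by push_cast at hts; linarith
      simp [γ, this]
    · right
      have : (t : ℝ) = 1 := by push_cast at hts; linarith
      simp [γ, this]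
  have hfull := hlog.union (isCompact_range hγ).isClosed.isOpen_compl
    (isCompact_range hγ').isClosed.isOpen_compl
    (by rwa [← compl_union, hunion]) hlog'
  set a := f (Circle.exp Real.pi) with ha
  have hae : a ∈ e.source := by rwa [hes]
  refine one_ne_zero (HasLogOn.eq_zero_of_zpow_sub one_pos (c := e a) (m := 1)
    ((hfull.comp (u := e.symm) (r := Metric.sphere (e a) 1)
      (e.continuousOn_symm.mono (by simp [het])) fun z hz ↦ ?_).congr fun z hz ↦ ?_))
  · rw [← compl_inter]
    intro hmem
    have hz' : z ∈ e.target := by simp [het]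
    rcases hinter _ hmem with h | h
    · have := e.map_target hz'
      rw [h, hes] at this
      exact this rfl
    · have := e.right_inv hz'
      rw [h] at this
      simp [← this] at hz
  · rw [e.right_inv (by simp [het]), zpow_one]

/-- Every nonvanishing function on the sphere has a continuous logarithm. -/
theorem HasLogOn.of_sphere
    (hX : ∀ q : X, ∃ e : OpenPartialHomeomorph X ℂ, e.source = {q}ᶜ ∧ e.target = univ)
    {p q : X} (hpq : p ≠ q) {f : X → ℂ} (hf : Continuous f) (hne : ∀ x, f x ≠ 0) :
    HasLogOn f univ := by
  have aux : ∀ r, HasLogOn f {r}ᶜ := fun r ↦ by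
    obtain ⟨e, hes, het⟩ := hX r
    have hsymm : Continuous e.symm := by
      have := e.continuousOn_symm
      rwa [het, continuousOn_univ] at this
    refine ((HasLogOn.of_complex (hf.comp hsymm) fun _ ↦ hne _).comp (u := e) (r := {r}ᶜ)
      (hes ▸ e.continuousOn) (mapsTo_univ _ _)).congr fun x hx ↦ ?_
    rw [Function.comp_apply, e.left_inv (by rwa [hes])]
  have hconn : IsPreconnected ({p}ᶜ ∩ {q}ᶜ : Set X) := by
    obtain ⟨e, hes, het⟩ := hX p
    have hqe : q ∈ e.source := by
      rw [hes]
      exact hpq.symm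
    have himage : e.symm '' {e q}ᶜ = {p}ᶜ ∩ {q}ᶜ := by
      ext x
      constructor
      · rintro ⟨z, hz, rfl⟩
        have hz' : z ∈ e.target := by simp [het]
        refine ⟨hes ▸ e.map_target hz', fun h ↦ hz ?_⟩
        rw [mem_singleton_iff] at h
        rw [mem_singleton_iff, ← h, e.right_inv hz']
      · rintro ⟨hxp, hxq⟩
        have hxe : x ∈ e.source := by rwa [hes]
        exact ⟨e x, fun h ↦ hxq (e.injOn hxe hqe h), e.left_inv hxe⟩
    rw [← himage]
    exact (isConnected_compl_singleton_of_one_lt_rank (by simp) _).isPreconnected.image _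
      (e.continuousOn_symm.mono (by simp [het]))
  refine ((aux p).union isOpen_compl_singleton isOpen_compl_singleton hconn (aux q)).mono
    fun x _ ↦ ?_
  by_cases hx : x = p
  · exact Or.inr (by rwa [mem_compl_singleton_iff, hx])
  · exact Or.inl hx

/-- Two connected open sets covering the sphere have a connected intersection. -/
theorem IsPreconnected.inter_of_union_eq_univ [CompactSpace X]
    (hX : ∀ q : X, ∃ e : OpenPartialHomeomorph X ℂ, e.source = {q}ᶜ ∧ e.target = univ)
    {U V : Set X} (hU : IsOpen U) (hV : IsOpen V) (hUc : IsPreconnected U)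
    (hVc : IsPreconnected V) (hUV : U ∪ V = univ) : IsPreconnected (U ∩ V) := by
  classical
  intro A B hA hB hcover ⟨p, hp, hpA⟩ ⟨q, hq, hqB⟩
  by_contra hemp
  rw [not_nonempty_iff_eq_empty] at hemp
  set O₁ := U ∩ V ∩ A with hO₁
  set O₂ := U ∩ V ∩ B with hO₂
  have ho₁ : IsOpen O₁ := (hU.inter hV).inter hA
  have ho₂ : IsOpen O₂ := (hU.inter hV).inter hB
  have hdisj : ∀ x ∈ O₁, x ∉ O₂ := fun x h₁ h₂ ↦ by
    have : x ∈ U ∩ V ∩ (A ∩ B) := ⟨h₁.1, h₁.2, h₂.2⟩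
    rwa [hemp] at this
  have hsplit : ∀ x, x ∈ O₁ ∨ x ∈ O₂ ∨ x ∉ U ∨ x ∉ V := fun x ↦ by
    by_cases hx : x ∈ U ∩ V
    · rcases hcover hx with h | h
      exacts [Or.inl ⟨hx, h⟩, Or.inr (Or.inl ⟨hx, h⟩)]
    · rw [mem_inter_iff, not_and_or] at hx
      exact Or.inr (Or.inr hx)
  have hcov : ∀ x, x ∈ O₂ᶜ ∪ O₁ᶜ := fun x ↦ by
    by_cases hx : x ∈ O₁
    · exact Or.inl (hdisj x hx)
    · exact Or.inr hx
  obtain ⟨φ, hφU, hφV, -⟩ := exists_continuous_zero_one_of_isClosed hU.isClosed_compl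
    hV.isClosed_compl (by
      rw [Set.disjoint_compl_left_iff_subset]
      intro x hx
      exact ((hUV ▸ mem_univ x : x ∈ U ∪ V).resolve_right hx))
  have hc₁ := ho₁.isClosed_compl
  have hc₂ := ho₂.isClosed_compl
  -- Glue `φ` on `O₁` with the constant `c` elsewhere.
  let ψ : ℂ → X → ℂ := fun c x ↦ (if x ∈ O₁ then (φ x : ℂ) else c) * (2 * Real.pi * Complex.I)
  have hψ : ∀ c : ℂ, ∀ s : Set X, (∀ x ∈ s, x ∉ O₁ → x ∉ O₂ → (φ x : ℂ) = c) →
      ContinuousOn (ψ c) s := fun c s hs ↦ by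
    refine ContinuousOn.of_isClosed_cover hc₂ hc₁ (fun x _ ↦ hcov x) ?_ ?_
    · refine ContinuousOn.congr (f := fun x ↦ (φ x : ℂ) * (2 * Real.pi * Complex.I))
        (Continuous.continuousOn (by fun_prop)) fun x hx ↦ ?_
      by_cases h : x ∈ O₁
      · simp [ψ, h]
      · simp [ψ, h, hs x hx.1 h hx.2]
    · refine ContinuousOn.congr (f := fun x ↦ c * (2 * Real.pi * Complex.I))
        continuousOn_const fun x hx ↦ ?_
      simp [ψ, show x ∉ O₁ from hx.2]
  have hφ0 : ∀ x ∉ U, φ x = 0 := fun x hx ↦ hφU hx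
  have hφ1 : ∀ x ∉ V, φ x = 1 := fun x hx ↦ hφV hx
  have hψU : ContinuousOn (ψ 1) U := hψ 1 U fun x hxU h₁ h₂ ↦ by
    have : x ∉ V := by
      have := hsplit x
      tauto
    simp [hφ1 x this]
  have hψV : ContinuousOn (ψ 0) V := hψ 0 V fun x hxV h₁ h₂ ↦ by
    have : x ∉ U := by
      have := hsplit x
      tauto
    simp [hφ0 x this]
  have hexp : ∀ x, Complex.exp (ψ 1 x) = Complex.exp (ψ 0 x) := fun x ↦ by
    by_cases h : x ∈ O₁ <;> simp [ψ, h, Complex.exp_two_pi_mul_I]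
  have hFc : Continuous fun x ↦ Complex.exp (ψ 0 x) := by
    rw [← continuousOn_univ, ← hUV]
    refine ContinuousOn.union_of_isOpen ?_ hψV.cexp hU hV
    exact hψU.cexp.congr fun x _ ↦ (hexp x).symm
  have hpq : p ≠ q := by
    rintro rfl
    exact hdisj p ⟨hp, hpA⟩ ⟨hq, hqB⟩
  obtain ⟨g, hg, hfg⟩ := HasLogOn.of_sphere hX hpq hFc fun _ ↦ Complex.exp_ne_zero _
  obtain ⟨m, hm⟩ := hUc.exists_int_of_exp_eq (hg.mono (subset_univ _)) hψU
    fun x _ ↦ by rw [← hfg x trivial, hexp]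
  obtain ⟨n, hn⟩ := hVc.exists_int_of_exp_eq (hg.mono (subset_univ _)) hψV
    fun x _ ↦ by rw [← hfg x trivial]
  have hpi : (2 * Real.pi * Complex.I : ℂ) ≠ 0 := Complex.two_pi_I_ne_zero
  have hp₁ : p ∈ O₁ := ⟨hp, hpA⟩
  have hq₁ : q ∉ O₁ := fun h ↦ hdisj q h ⟨hq, hqB⟩
  have e₁ := (hm p hp.1).symm.trans (hn p hp.2)
  have e₂ := (hm q hq.1).symm.trans (hn q hq.2)
  simp only [ψ, hp₁, if_true, add_right_inj] at e₁
  simp only [ψ, hq₁, if_false, ← add_mul] at e₂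
  have heq₁ := mul_right_cancel₀ hpi e₁
  have heq₂ := mul_right_cancel₀ hpi e₂
  rw [heq₁] at heq₂
  norm_num at heq₂

/-- The **Jordan curve theorem**: the complement of a simple closed curve in the sphere is the
disjoint union of two connected open sets. -/
theorem jordan_curve_sphere_s11 [CompactSpace X]
    (hX : ∀ q : X, ∃ e : OpenPartialHomeomorph X ℂ, e.source = {q}ᶜ ∧ e.target = univ)
    {f : Circle → X} (hf : Continuous f) (hinj : Function.Injective f) :
    ∃ D E : Set X, IsOpen D ∧ IsOpen E ∧ IsConnected D ∧ IsConnected E ∧ Disjoint D E ∧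
      D ∪ E = (range f)ᶜ := by
  have hopen : IsOpen (range f)ᶜ := (isCompact_range hf).isClosed.isOpen_compl
  have hn := not_isPreconnected_compl_of_simple_closed_curve hX hf hinj
  have split : ∀ s : Set X, IsOpen s → ¬ IsPreconnected s → ∃ D E : Set X,
      IsOpen D ∧ IsOpen E ∧ D.Nonempty ∧ E.Nonempty ∧ Disjoint D E ∧ D ∪ E = s := by
    intro s hs hns
    simp only [IsPreconnected, not_forall] at hns
    obtain ⟨A, B, hA, hB, hcover, hnA, hnB, hemp⟩ := hns
    refine ⟨s ∩ A, s ∩ B, hs.inter hA, hs.inter hB, hnA, hnB, ?_, ?_⟩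
    · rw [Set.disjoint_left]
      rintro x ⟨hx, hxA⟩ ⟨-, hxB⟩
      exact hemp ⟨x, hx, hxA, hxB⟩
    · rw [← inter_union_distrib_left, inter_eq_left.mpr hcover]
  have conn : ∀ D E : Set X, IsOpen D → IsOpen E → E.Nonempty → Disjoint D E →
      D ∪ E = (range f)ᶜ → IsPreconnected D := by
    intro D E hD hE hnE hDE hU
    by_contra hns
    obtain ⟨D₁, D₂, h₁, h₂, n₁, n₂, h₁₂, rfl⟩ := split D hD hns
    rw [Set.disjoint_union_left] at hDE
    exact not_three_open_of_simple_closed_curve hX hf hinj h₁ h₂ hE n₁ n₂ hnE h₁₂ hDE.1 hDE.2 hU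
  obtain ⟨D, E, hD, hE, hnD, hnE, hDE, hU⟩ := split _ hopen hn
  exact ⟨D, E, hD, hE, ⟨hnD, conn D E hD hE hnE hDE hU⟩,
    ⟨hnE, conn E D hE hD hnD hDE.symm (by rwa [union_comm])⟩, hDE, hU⟩

end Sphere

/-- The complement of a point in the unit sphere is homeomorphic to the plane. -/
theorem exists_chart_compl_singleton (q : Metric.sphere (0 : EuclideanSpace ℝ (Fin 3)) 1) :
    ∃ e : OpenPartialHomeomorph (Metric.sphere (0 : EuclideanSpace ℝ (Fin 3)) 1) ℂ,
      e.source = {q}ᶜ ∧ e.target = univ := by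
  have : Fact (Module.finrank ℝ (EuclideanSpace ℝ (Fin 3)) = 2 + 1) := ⟨by simp⟩
  refine ⟨(stereographic' 2 q).transHomeomorph
    Complex.orthonormalBasisOneI.repr.symm.toHomeomorph, ?_, ?_⟩ <;> simp

/-- If a simple closed curve `P ⊆ S²` is disjoint from its antipodal image `-P`, then
`S² \ (P ∪ -P)` has exactly three connected components: one antipodally invariant, and two
that are antipodal images of each other. -/
theorem jordan_curve_antipodal_components
    (P : Set (Metric.sphere (0 : EuclideanSpace ℝ (Fin 3)) 1))
    (hP : ∃ f : Circle → Metric.sphere (0 : EuclideanSpace ℝ (Fin 3)) 1,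
      Continuous f ∧ Function.Injective f ∧ Set.range f = P)
    (hdisj : Disjoint P (-P)) :
    ∃ C₀ C₁ C₂ : Set (Metric.sphere (0 : EuclideanSpace ℝ (Fin 3)) 1),
      IsOpen C₀ ∧ IsOpen C₁ ∧ IsOpen C₂ ∧
      IsConnected C₀ ∧ IsConnected C₁ ∧ IsConnected C₂ ∧
      Disjoint C₀ C₁ ∧ Disjoint C₀ C₂ ∧ Disjoint C₁ C₂ ∧
      C₀ ∪ C₁ ∪ C₂ = (P ∪ -P)ᶜ ∧
      (-C₀ = C₀) ∧ (-C₁ = C₂) := by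
  obtain ⟨f, hf, hinj, rfl⟩ := hP
  set P := range f
  obtain ⟨D, E, hD, hE, hDc, hEc, hDE, hDEP⟩ :=
    jordan_curve_sphere_s11 exists_chart_compl_singleton hf hinj
  have hPc : IsConnected P := isConnected_range hf
  have hconn : IsPreconnected (univ : Set (Metric.sphere (0 : EuclideanSpace ℝ (Fin 3)) 1)) := by
    have := isPreconnected_sphere (E := EuclideanSpace ℝ (Fin 3))
      (by rw [← Module.finrank_eq_rank]; simp) 0 1
    exact (isPreconnected_iff_preconnectedSpace.mp this).isPreconnected_univ
  have hneg : ∀ s : Set (Metric.sphere (0 : EuclideanSpace ℝ (Fin 3)) 1),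
      IsPreconnected s → IsPreconnected (-s) := fun s hs ↦ by
    rw [← image_neg_eq_neg]
    exact hs.image _ continuous_neg.continuousOn
  have hPneg : IsPreconnected (-P) := hneg P hPc.isPreconnected
  -- Name the component containing `-P` by `E`.
  wlog hPE : -P ⊆ E generalizing D E
  · refine this E D hE hD hEc hDc hDE.symm (by rwa [union_comm]) ?_
    have hsub : -P ⊆ D ∪ E := by
      rw [hDEP]
      exact hdisj.subset_compl_left
    exact (hPneg.subset_or_subset hD hE hDE hsub).resolve_right hPE
  have mem : ∀ x, x ∈ P ∨ x ∈ D ∨ x ∈ E := fun x ↦ by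
    have := Set.ext_iff.mp hDEP x
    simp only [mem_union, mem_compl_iff] at this
    tauto
  have nmem : ∀ x ∈ P, x ∉ D ∧ x ∉ E := fun x ↦ by
    have := Set.ext_iff.mp hDEP x
    simp only [mem_union, mem_compl_iff] at this
    tauto
  rw [Set.disjoint_left] at hDE hdisj
  have hDP : IsClosed (D ∪ P) := by
    have : D ∪ P = Eᶜ := by
      ext x
      have := mem x; have := nmem x; have := @hDE x
      simp only [mem_union, mem_compl_iff]
      tauto
    rw [this]
    exact hE.isClosed_compl
  obtain ⟨x₀, hx₀⟩ := hPc.nonempty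
  have hclopen : ∀ s : Set (Metric.sphere (0 : EuclideanSpace ℝ (Fin 3)) 1), IsClosed s →
      IsOpen s → s.Nonempty → ∀ x, x ∈ s := fun s hc ho hn x ↦
    hconn.subset_isClopen ⟨hc, ho⟩ (by simpa using hn) trivial
  obtain ⟨y, hyD, hyP⟩ : ∃ y ∈ closure D, y ∈ P := by
    by_contra! h
    have hDcl : IsClosed D := isClosed_of_closure_subset fun x hx ↦
      (closure_minimal subset_union_left hDP hx).resolve_right (h x hx)
    exact (nmem x₀ hx₀).1 (hclopen D hDcl hD hDc.nonempty x₀)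
  have hDPc : IsPreconnected (D ∪ P) := by
    have h₁ : IsPreconnected (insert y D) :=
      hDc.isPreconnected.subset_closure (subset_insert _ _)
        (insert_subset hyD subset_closure)
    have h₂ := h₁.union y (mem_insert _ _) hyP hPc.isPreconnected
    rwa [insert_union, insert_eq_of_mem (mem_union_right D hyP)] at h₂
  have hDPE : ∀ x, x ∈ D ∪ P → -x ∈ E := by
    have hsub : D ∪ P ⊆ -D ∪ -E := fun x hx ↦ by
      rcases mem (-x) with h | h
      · rcases hx with hx | hx
        · exact absurd (hPE (by simpa using h)) (hDE hx)
        · exact absurd (by simpa using h) (hdisj hx)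
      · exact h
    have hdisj' : Disjoint (-D) (-E) := by
      rw [Set.disjoint_left]
      exact fun x h₁ h₂ ↦ hDE h₁ h₂
    refine (hDPc.subset_or_subset hD.neg hE.neg hdisj' hsub).resolve_left fun h ↦ ?_
    exact hDE (a := -x₀) (h (Or.inr hx₀)) (hPE (by simpa using hx₀))
  have hcover : E ∪ -E = univ := by
    refine eq_univ_of_forall fun x ↦ ?_
    have := mem x
    have := hDPE x
    simp only [mem_union, Set.mem_neg] at *
    tauto
  have hnE : (E ∩ -E).Nonempty := by
    by_contra hemp
    have hEeq : E = (-E)ᶜ := by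
      ext x
      constructor
      · exact fun hx hx' ↦ hemp ⟨x, hx, hx'⟩
      · exact fun hx ↦ (hcover ▸ mem_univ x : x ∈ E ∪ -E).resolve_right hx
    have hEcl : IsClosed E := hEeq ▸ hE.neg.isClosed_compl
    exact (nmem x₀ hx₀).2 (hclopen E hEcl hE hEc.nonempty x₀)
  have hC₀ : IsPreconnected (E ∩ -E) :=
    IsPreconnected.inter_of_union_eq_univ exists_chart_compl_singleton hE hE.neg
      hEc.isPreconnected (hneg E hEc.isPreconnected) hcover
  have hnegmem : ∀ x, -x ∈ D → x ∈ E := fun x hx ↦ by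
    simpa using hDPE (-x) (Or.inl hx)
  refine ⟨E ∩ -E, D, -D, hE.inter hE.neg, hD, hD.neg, ⟨hnE, hC₀⟩, hDc,
    ⟨hDc.nonempty.neg, hneg D hDc.isPreconnected⟩, ?_, ?_, ?_, ?_, ?_, rfl⟩
  · rw [Set.disjoint_left]
    exact fun x hx hx' ↦ hDE hx' hx.1
  · rw [Set.disjoint_left]
    exact fun x hx hx' ↦ hDE hx' hx.2
  · rw [Set.disjoint_left]
    exact fun x hx hx' ↦ hDE hx (hnegmem x hx')
  · ext x
    constructor
    · rintro ((⟨hx, hx'⟩ | hx) | hx) (h | h)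
      exacts [(nmem x h).2 hx, (nmem (-x) h).2 hx', (nmem x h).1 hx, hDE hx (hPE h),
        hDE hx (hDPE x (Or.inr h)), (nmem (-x) h).1 hx]
    · intro hx
      rcases mem x with h | h | h
      · exact absurd (Or.inl h) hx
      · exact Or.inl (Or.inr h)
      · rcases mem (-x) with h' | h' | h'
        exacts [absurd (Or.inr h') hx, Or.inr h', Or.inl (Or.inl ⟨h, h'⟩)]
  · rw [Set.inter_neg, neg_neg, inter_comm]
end

section
/- Let g : S² → ℝ be continuous and odd (g(-x) = -g(x)), and suppose g⁻¹({0}) is a disjoint union of finitely many simple closed curves P₁, …, Pₘ which are permuted by the antipodal map. Then m is odd; in particular at least one Pᵢ satisfies -Pᵢ = Pᵢ. -/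
open scoped ComplexConjugate Real

/-- A nowhere vanishing continuous function on the plane has a continuous argument. -/
theorem exists_continuous_arg (F : ℝ × ℝ → ℂ) (hF : Continuous F) (h0 : ∀ x, F x ≠ 0) :
    ∃ f : ℝ × ℝ → ℝ, Continuous f ∧
      ∀ x, ∃ r : ℝ, 0 < r ∧ F x = r * Complex.exp (f x * Complex.I) := by
  let G : C(ℝ × ℝ, {z : ℂ // z ≠ 0}) := ⟨fun x => ⟨F x, h0 x⟩, by fun_prop⟩
  obtain ⟨H, ⟨-, hH⟩, -⟩ := Complex.isCoveringMap_exp.existsUnique_continuousMap_lifts G (0, 0)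
    (Complex.log (F (0, 0))) (Subtype.ext (Complex.exp_log (h0 _)))
  refine ⟨fun x => (H x).im, by fun_prop, fun x => ⟨Real.exp (H x).re, Real.exp_pos _, ?_⟩⟩
  have h : Complex.exp (H x) = F x := congrArg Subtype.val (congrFun hH x)
  rw [← h, Complex.ofReal_exp, ← Complex.exp_add, Complex.re_add_im]

/-- A nowhere vanishing continuous function on the line has a continuous argument. -/
theorem exists_continuous_arg_real (F : ℝ → ℂ) (hF : Continuous F) (h0 : ∀ x, F x ≠ 0) :
    ∃ f : ℝ → ℝ, Continuous f ∧
      ∀ x, ∃ r : ℝ, 0 < r ∧ F x = r * Complex.exp (f x * Complex.I) := by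
  obtain ⟨f, hf, hfe⟩ := exists_continuous_arg (fun x => F x.1) (by fun_prop) (fun x => h0 _)
  exact ⟨fun x => f (x, 0), by fun_prop, fun x => hfe (x, 0)⟩

/-- Two continuous arguments of the same function differ by a constant multiple of `2π`. -/
theorem exists_int_forall_eq_add {X : Type*} [TopologicalSpace X] [PreconnectedSpace X]
    [Nonempty X] (f f' : X → ℝ) (hf : Continuous f) (hf' : Continuous f')
    (h : ∀ x, ∃ r : ℝ, 0 < r ∧
      Complex.exp (f x * Complex.I) = r * Complex.exp (f' x * Complex.I)) :
    ∃ n : ℤ, ∀ x, f x = f' x + 2 * π * n := by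
  have hexp : ∀ x, Circle.exp (f x) = Circle.exp (f' x) := fun x => by
    obtain ⟨r, hr, e⟩ := h x
    have hn := congrArg norm e
    rw [norm_mul, Complex.norm_exp_ofReal_mul_I, Complex.norm_exp_ofReal_mul_I, mul_one,
      Complex.norm_real, Real.norm_of_nonneg hr.le] at hn
    rw [← hn, Complex.ofReal_one, one_mul] at e
    exact Circle.ext (by simpa using e)
  obtain ⟨a⟩ := ‹Nonempty X›
  obtain ⟨n, hn⟩ := Circle.exp_eq_exp.1 (hexp a)
  refine ⟨n, fun x => congrFun (Circle.isCoveringMap_exp.eq_of_comp_eq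
    (g₂ := fun x => f' x + 2 * π * n) hf (by fun_prop) ?_ a (by linarith)) x⟩
  funext y
  exact (hexp y).trans (Circle.exp_eq_exp.2 ⟨-n, by push_cast; ring⟩)

theorem exp_ofReal_add_mul_I (a b : ℝ) : Complex.exp ((a + b : ℝ) * Complex.I) =
    Complex.exp (a * Complex.I) * Complex.exp (b * Complex.I) := by
  rw [← Complex.exp_add]
  push_cast
  ring_nf

theorem exp_ofReal_neg_mul_I (a : ℝ) : Complex.exp ((-a : ℝ) * Complex.I) =
    (Complex.exp (a * Complex.I))⁻¹ := by
  rw [← Complex.exp_neg]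
  push_cast
  ring_nf

theorem conj_exp_ofReal_mul_I (a : ℝ) :
    conj (Complex.exp (a * Complex.I)) = (Complex.exp (a * Complex.I))⁻¹ := by
  rw [← Complex.exp_conj, ← Complex.exp_neg]
  simp

/-- Two loops in the punctured plane which are both invariant under `z ↦ -1 / conj z`, with this
map acting as a half turn of the parameter, intersect. -/
theorem exists_eq_of_inversion_invariant (z w : ℝ → ℂ) (hzc : Continuous z) (hwc : Continuous w)
    (hz : ∀ s, z (s + 1) * conj (z s) = -1) (hw : ∀ t, w (t + 1) * conj (w t) = -1) :
    ∃ s t, z s = w t := by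
  by_contra! hne
  have hz0 : ∀ s, z s ≠ 0 := fun s h => by simpa [h] using hz s
  have hw0 : ∀ s, w s ≠ 0 := fun s h => by simpa [h] using hw s
  have hzc0 : ∀ s, conj (z s) ≠ 0 := fun s => by simpa using hz0 s
  have hwc0 : ∀ s, conj (w s) ≠ 0 := fun s => by simpa using hw0 s
  have hz1 : ∀ s, z (s + 1) = -1 / conj (z s) := fun s => eq_div_of_mul_eq (hzc0 s) (hz s)
  have hw1 : ∀ s, w (s + 1) = -1 / conj (w s) := fun s => eq_div_of_mul_eq (hwc0 s) (hw s)
  have hz2 : ∀ s, z (s + 1 + 1) = z s := fun s => by rw [hz1, hz1]; simp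
  have hw2 : ∀ s, w (s + 1 + 1) = w s := fun s => by rw [hw1, hw1]; simp
  obtain ⟨f, hf, hfe⟩ := exists_continuous_arg (fun x => z x.1 - w x.2) (by fun_prop)
    (fun x => sub_ne_zero.2 (hne _ _))
  obtain ⟨ζ, hζ, hζe⟩ := exists_continuous_arg_real z hzc hz0
  obtain ⟨ω, hω, hωe⟩ := exists_continuous_arg_real w hwc hw0
  choose rf hrf hfe using hfe
  choose rz hrz hζe using hζe
  choose aw haw hωe using hωe
  have hrzc : ∀ x, (rz x : ℂ) ≠ 0 := fun x => Complex.ofReal_ne_zero.2 (hrz x).ne'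
  have hawc : ∀ x, (aw x : ℂ) ≠ 0 := fun x => Complex.ofReal_ne_zero.2 (haw x).ne'
  have hrfc : ∀ x, (rf x : ℂ) ≠ 0 := fun x => Complex.ofReal_ne_zero.2 (hrf x).ne'
  have shift1 : ∃ k : ℤ, ∀ x : ℝ × ℝ, ζ (x.1 + 1) = ζ x.1 + π + 2 * π * k := by
    refine exists_int_forall_eq_add _ _ (by fun_prop) (by fun_prop) fun x =>
      ⟨(rz (x.1 + 1) * rz x.1)⁻¹, ?_, ?_⟩
    · exact inv_pos.2 (mul_pos (hrz _) (hrz _))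
    · have h := hz x.1
      rw [hζe (x.1 + 1), hζe x.1, map_mul, Complex.conj_ofReal, conj_exp_ofReal_mul_I] at h
      rw [exp_ofReal_add_mul_I, Complex.exp_pi_mul_I]
      have h1 := hrzc (x.1 + 1)
      have h2 := hrzc x.1
      have h3 := Complex.exp_ne_zero (ζ x.1 * Complex.I)
      push_cast
      field_simp at h ⊢
      linear_combination h
  have shift2 : ∃ l : ℤ, ∀ x : ℝ × ℝ, ω (x.2 + 1) = ω x.2 + π + 2 * π * l := by
    refine exists_int_forall_eq_add _ _ (by fun_prop) (by fun_prop) fun x =>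
      ⟨(aw (x.2 + 1) * aw x.2)⁻¹, ?_, ?_⟩
    · exact inv_pos.2 (mul_pos (haw _) (haw _))
    · have h := hw x.2
      rw [hωe (x.2 + 1), hωe x.2, map_mul, Complex.conj_ofReal, conj_exp_ofReal_mul_I] at h
      rw [exp_ofReal_add_mul_I, Complex.exp_pi_mul_I]
      have h1 := hawc (x.2 + 1)
      have h2 := hawc x.2
      have h3 := Complex.exp_ne_zero (ω x.2 * Complex.I)
      push_cast
      field_simp at h ⊢
      linear_combination h
  have per1 : ∃ b : ℤ, ∀ x : ℝ × ℝ, f (x.1 + 1 + 1, x.2) = f x + 2 * π * b := by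
    refine exists_int_forall_eq_add _ _ (by fun_prop) (by fun_prop) fun x =>
      ⟨rf x / rf (x.1 + 1 + 1, x.2), ?_, ?_⟩
    · exact div_pos (hrf _) (hrf _)
    · have h := hfe (x.1 + 1 + 1, x.2)
      simp only [hz2] at h
      rw [hfe x] at h
      have h1 := hrfc (x.1 + 1 + 1, x.2)
      push_cast
      rw [div_mul_eq_mul_div, eq_div_iff h1]
      linear_combination -h
  have per2 : ∃ a : ℤ, ∀ x : ℝ × ℝ, f (x.1, x.2 + 1 + 1) = f x + 2 * π * a := by
    refine exists_int_forall_eq_add _ _ (by fun_prop) (by fun_prop) fun x =>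
      ⟨rf x / rf (x.1, x.2 + 1 + 1), ?_, ?_⟩
    · exact div_pos (hrf _) (hrf _)
    · have h := hfe (x.1, x.2 + 1 + 1)
      simp only [hw2] at h
      rw [hfe x] at h
      have h1 := hrfc (x.1, x.2 + 1 + 1)
      push_cast
      rw [div_mul_eq_mul_div, eq_div_iff h1]
      linear_combination -h
  have diag : ∃ N : ℤ, ∀ x : ℝ × ℝ, f (x.1 + 1, x.2 + 1) = -f x + ζ x.1 + ω x.2 + 2 * π * N := by
    refine exists_int_forall_eq_add _ _ (by fun_prop) (by fun_prop) fun x =>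
      ⟨rf x / (rf (x.1 + 1, x.2 + 1) * rz x.1 * aw x.2), ?_, ?_⟩
    · exact div_pos (hrf _) (mul_pos (mul_pos (hrf _) (hrz _)) (haw _))
    · have h : (z (x.1 + 1) - w (x.2 + 1)) * conj (z x.1) * conj (w x.2) =
          conj (z x.1 - w x.2) := by
        rw [map_sub]
        linear_combination conj (w x.2) * hz x.1 - conj (z x.1) * hw x.2
      rw [hfe (x.1 + 1, x.2 + 1), hfe x, hζe x.1, hωe x.2] at h
      simp only [map_mul, Complex.conj_ofReal, conj_exp_ofReal_mul_I] at h
      simp only [exp_ofReal_add_mul_I, exp_ofReal_neg_mul_I]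
      have h1 := hrfc (x.1 + 1, x.2 + 1)
      have h2 := hrfc x
      have h3 := hrzc x.1
      have h4 := hawc x.2
      have h5 := Complex.exp_ne_zero (ζ x.1 * Complex.I)
      have h6 := Complex.exp_ne_zero (ω x.2 * Complex.I)
      have h7 := Complex.exp_ne_zero (f x * Complex.I)
      push_cast
      field_simp at h ⊢
      linear_combination h
  have antidiag : ∃ n : ℤ, ∀ x : ℝ × ℝ,
      f (x.1 + 1, x.2) = π + -f (x.1, x.2 + 1) + ζ x.1 + ω x.2 + 2 * π * n := by
    refine exists_int_forall_eq_add _ _ (by fun_prop) (by fun_prop) fun x =>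
      ⟨rf (x.1, x.2 + 1) * aw x.2 / (rf (x.1 + 1, x.2) * rz x.1), ?_, ?_⟩
    · exact div_pos (mul_pos (hrf _) (haw _)) (mul_pos (hrf _) (hrz _))
    · have h : (z (x.1 + 1) - w x.2) * conj (z x.1) =
          -conj (z x.1 - w (x.2 + 1)) * w x.2 := by
        have h' := congrArg conj (hw x.2)
        simp only [map_mul, Complex.conj_conj, map_neg, map_one] at h'
        rw [map_sub]
        linear_combination hz x.1 - h'
      rw [hfe (x.1 + 1, x.2), hfe (x.1, x.2 + 1), hζe x.1, hωe x.2] at h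
      simp only [map_mul, Complex.conj_ofReal, conj_exp_ofReal_mul_I] at h
      simp only [exp_ofReal_add_mul_I, exp_ofReal_neg_mul_I, Complex.exp_pi_mul_I]
      have h1 := hrfc (x.1 + 1, x.2)
      have h3 := hrzc x.1
      have h5 := Complex.exp_ne_zero (ζ x.1 * Complex.I)
      have h7 := Complex.exp_ne_zero (f (x.1, x.2 + 1) * Complex.I)
      push_cast
      field_simp at h ⊢
      linear_combination h
  obtain ⟨k, hk⟩ := shift1
  obtain ⟨l, hl⟩ := shift2
  obtain ⟨b, hb⟩ := per1
  obtain ⟨a, ha⟩ := per2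
  obtain ⟨N, hN⟩ := diag
  obtain ⟨n, hn⟩ := antidiag
  have e1 := hk (0, 0)
  have e2 := hl (0, 0)
  have e3 := hb (0, 0)
  have e4 := ha (0, 0)
  have e5 := hb (0, 0 + 1 + 1)
  have e6 := hN (0, 0)
  have e7 := hN (0 + 1, 0 + 1)
  have e8 := hn (0 + 1, 0)
  have e9 := hn (0, 0 + 1)
  dsimp only at e1 e2 e3 e4 e5 e6 e7 e8 e9
  have key : π * (1 + 2 * N) = π * (2 + 2 * n) := by linarith
  have key' := mul_left_cancel₀ Real.pi_ne_zero key
  norm_cast at key'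
  omega

/-- **Borsuk–Ulam theorem** for the two-sphere: an odd map to the plane has a zero. -/
theorem exists_eq_zero_of_odd
    (F : Metric.sphere (0 : EuclideanSpace ℝ (Fin 3)) 1 → ℂ)
    (hF : Continuous F) (hodd : ∀ x, F (-x) = -F x) : ∃ x, F x = 0 := by
  by_contra! h0
  let p : ℝ × ℝ → Metric.sphere (0 : EuclideanSpace ℝ (Fin 3)) 1 := fun x =>
    ⟨!₂[Real.cos x.2 * Real.cos x.1, Real.cos x.2 * Real.sin x.1, Real.sin x.2], by
      rw [mem_sphere_zero_iff_norm, EuclideanSpace.norm_eq, Real.sqrt_eq_one]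
      simp only [Fin.sum_univ_three, Real.norm_eq_abs, sq_abs]
      simp
      nlinarith [Real.sin_sq_add_cos_sq x.1, Real.sin_sq_add_cos_sq x.2]⟩
  have hp : Continuous p := by
    refine Continuous.subtype_mk ?_ _
    fun_prop
  have hper : ∀ θ φ, p (θ + 2 * π, φ) = p (θ, φ) := fun θ φ => by simp [p]
  have hhalf : ∀ θ, p (θ + π, 0) = -p (θ, 0) := fun θ => by
    ext i
    fin_cases i <;> simp [p]
  have hpole : ∀ θ, p (θ, π / 2) = p (0, π / 2) := fun θ => by simp [p]
  obtain ⟨f, hf, hfe⟩ := exists_continuous_arg (fun x => F (p x)) (by fun_prop) (fun x => h0 _)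
  choose r hr hfe using hfe
  have hrc : ∀ x, (r x : ℂ) ≠ 0 := fun x => Complex.ofReal_ne_zero.2 (hr x).ne'
  have hequator : ∃ k : ℤ, ∀ x : ℝ, f (x + π, 0) = f (x, 0) + π + 2 * π * k := by
    refine exists_int_forall_eq_add _ _ (by fun_prop) (by fun_prop) fun x =>
      ⟨r (x, 0) / r (x + π, 0), div_pos (hr _) (hr _), ?_⟩
    have h := hfe (x + π, 0)
    rw [hhalf, hodd, hfe (x, 0)] at h
    have h1 := hrc (x + π, 0)
    rw [exp_ofReal_add_mul_I, Complex.exp_pi_mul_I]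
    push_cast
    rw [div_mul_eq_mul_div, eq_div_iff h1]
    linear_combination -h
  have hconst : ∃ k : ℤ, ∀ x : ℝ, f (x, π / 2) = f (0, π / 2) + 2 * π * k := by
    refine exists_int_forall_eq_add _ _ (by fun_prop) (by fun_prop) fun x =>
      ⟨r (0, π / 2) / r (x, π / 2), div_pos (hr _) (hr _), ?_⟩
    have h := hfe (x, π / 2)
    rw [hpole, hfe (0, π / 2)] at h
    have h1 := hrc (x, π / 2)
    push_cast
    rw [div_mul_eq_mul_div, eq_div_iff h1]
    linear_combination -h
  have hperiod : ∃ k : ℤ, ∀ x : ℝ × ℝ, f (x.1 + 2 * π, x.2) = f x + 2 * π * k := by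
    refine exists_int_forall_eq_add _ _ (by fun_prop) (by fun_prop) fun x =>
      ⟨r x / r (x.1 + 2 * π, x.2), div_pos (hr _) (hr _), ?_⟩
    have h := hfe (x.1 + 2 * π, x.2)
    rw [hper, hfe x] at h
    have h1 := hrc (x.1 + 2 * π, x.2)
    push_cast
    rw [div_mul_eq_mul_div, eq_div_iff h1]
    linear_combination -h
  obtain ⟨k, hk⟩ := hequator
  obtain ⟨l, hl⟩ := hconst
  obtain ⟨n, hn⟩ := hperiod
  have e1 := hk 0
  have e2 := hk (0 + π)
  have e3 := hl 0
  have e4 := hl (0 + 2 * π)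
  have e5 := hn (0, π / 2)
  have e6 := hn (0, 0)
  have e7 : (0 : ℝ) + 2 * π = 0 + π + π := by ring
  dsimp only at e5 e6
  rw [e7] at e4 e5 e6
  have key : π * (1 + 2 * k) = π * 0 := by linarith
  have key' := mul_left_cancel₀ Real.pi_ne_zero key
  norm_cast at key'
  omega

/-- A path connected symmetric set contains an antipodally equivariant loop. -/
theorem exists_odd_loop {X : Type*} [TopologicalSpace X] [InvolutiveNeg X] [ContinuousNeg X]
    {P : Set X} (hP : IsPathConnected P) (hsymm : ∀ x ∈ P, -x ∈ P) :
    ∃ L : ℝ → X, Continuous L ∧ (∀ s, L (s + 1) = -L s) ∧ ∀ s, L s ∈ P := by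
  obtain ⟨p, hp⟩ := hP.nonempty
  obtain ⟨γ, hγ⟩ := hP.joinedIn p hp (-p) (hsymm p hp)
  let T : Path p p := γ.trans ((γ.map continuous_neg).cast rfl (neg_neg p).symm)
  have hT1 : ∀ u ∈ Set.Icc (0 : ℝ) (1 / 2), T.extend u = γ.extend (2 * u) := fun u hu => by
    rw [Path.extend_apply _ ⟨hu.1, by linarith [hu.2]⟩,
      Path.extend_apply _ ⟨by linarith [hu.1], by linarith [hu.2]⟩, Path.trans_apply, dif_pos hu.2]
  have hT2 : ∀ u ∈ Set.Icc (0 : ℝ) (1 / 2), T.extend (u + 1 / 2) = -T.extend u := fun u hu => by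
    rw [hT1 u hu]
    rcases hu.1.eq_or_lt with rfl | h0
    · rw [zero_add, hT1 _ ⟨by norm_num, le_rfl⟩]
      norm_num
    · rw [Path.extend_apply _ ⟨by linarith, by linarith [hu.2]⟩,
        Path.extend_apply _ ⟨by linarith [hu.1], by linarith [hu.2]⟩, Path.trans_apply,
        dif_neg (by push Not; simpa using h0)]
      simp only [Path.cast_coe, Path.map_coe, Function.comp_apply]
      congr 3
      ring
  have hcont : Continuous fun s : ℝ => T.extend (Int.fract (s / 2)) :=
    ContinuousOn.comp_fract (f := fun _ u => T.extend u) (by fun_prop) (by fun_prop) (by simp)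
  have hhalf : ∀ s : ℝ, T.extend (Int.fract ((s + 1) / 2)) = -T.extend (Int.fract (s / 2)) := by
    intro s
    have h0 := Int.fract_nonneg (s / 2)
    have h1 := Int.fract_lt_one (s / 2)
    have h2 := Int.floor_add_fract (s / 2)
    rcases lt_or_ge (Int.fract (s / 2)) (1 / 2) with h | h
    · have : Int.fract ((s + 1) / 2) = Int.fract (s / 2) + 1 / 2 :=
        Int.fract_eq_iff.2 ⟨by linarith, by linarith, ⌊s / 2⌋, by linarith⟩
      rw [this, hT2 _ ⟨h0, h.le⟩]
    · have : Int.fract ((s + 1) / 2) = Int.fract (s / 2) - 1 / 2 :=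
        Int.fract_eq_iff.2 ⟨by linarith, by linarith, ⌊s / 2⌋ + 1, by push_cast; linarith⟩
      rw [this, ← neg_neg (T.extend (_ - _)), ← hT2 _ ⟨by linarith, by linarith⟩, sub_add_cancel]
  have hmem : ∀ s : ℝ, Int.fract (s / 2) < 1 / 2 → T.extend (Int.fract (s / 2)) ∈ P := by
    intro s h
    have h0 := Int.fract_nonneg (s / 2)
    rw [hT1 _ ⟨h0, h.le⟩, Path.extend_apply _ ⟨by linarith, by linarith⟩]
    exact hγ _
  refine ⟨_, hcont, hhalf, fun s => ?_⟩
  rcases lt_or_ge (Int.fract (s / 2)) (1 / 2) with h | h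
  · exact hmem s h
  · have h1 := Int.fract_lt_one (s / 2)
    have h2 := Int.floor_add_fract (s / 2)
    have : Int.fract ((s + 1) / 2) = Int.fract (s / 2) - 1 / 2 :=
      Int.fract_eq_iff.2 ⟨by linarith, by linarith, ⌊s / 2⌋ + 1, by push_cast; linarith⟩
    have h3 := hsymm _ (hmem (s + 1) (by rw [this]; linarith))
    rwa [hhalf, neg_neg] at h3

/-- Around any point `v` of the two-sphere there are coordinates in which `v` is the north pole. -/
theorem exists_sphere_coordinates (v : Metric.sphere (0 : EuclideanSpace ℝ (Fin 3)) 1) :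
    ∃ b : OrthonormalBasis (Fin 3) ℝ (EuclideanSpace ℝ (Fin 3)), b 2 = v := by
  have hv : ‖(v : EuclideanSpace ℝ (Fin 3))‖ = 1 := by simp
  obtain ⟨b, hb⟩ := Orthonormal.exists_orthonormalBasis_extension_of_card_eq (𝕜 := ℝ)
    (E := EuclideanSpace ℝ (Fin 3)) (ι := Fin 3) (by simp) (v := fun _ => v) (s := {2}) (by
      refine ⟨fun i => hv, fun i j hij => (hij (Subsingleton.elim _ _)).elim⟩)
  exact ⟨b, hb 2 rfl⟩

/-- Two antipodally equivariant loops on the two-sphere which miss a common point intersect. -/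
theorem exists_eq_of_odd_loops (L M : ℝ → Metric.sphere (0 : EuclideanSpace ℝ (Fin 3)) 1)
    (hL : Continuous L) (hM : Continuous M) (hL1 : ∀ s, L (s + 1) = -L s)
    (hM1 : ∀ s, M (s + 1) = -M s) (v : Metric.sphere (0 : EuclideanSpace ℝ (Fin 3)) 1)
    (hLv : ∀ s, L s ≠ v) (hMv : ∀ s, M s ≠ v) : ∃ s t, L s = M t := by
  obtain ⟨b, hb⟩ := exists_sphere_coordinates v
  let c : Fin 3 → Metric.sphere (0 : EuclideanSpace ℝ (Fin 3)) 1 → ℝ := fun i x => inner ℝ (b i) x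
  have hc : ∀ i, Continuous (c i) := fun i => by fun_prop
  have hneg : ∀ i x, c i (-x) = -c i x := fun i x => by simp [c, inner_neg_right]
  have hsq : ∀ x, c 0 x ^ 2 + c 1 x ^ 2 + c 2 x ^ 2 = 1 := fun x => by
    have h := b.sum_sq_norm_inner_right (x : EuclideanSpace ℝ (Fin 3))
    simpa [Fin.sum_univ_three, c] using h
  have hext : ∀ x y, c 0 x = c 0 y → c 1 x = c 1 y → c 2 x = c 2 y → x = y := by
    intro x y h0 h1 h2
    refine Subtype.ext (b.repr.injective ?_)
    ext i
    rw [b.repr_apply_apply, b.repr_apply_apply]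
    fin_cases i
    exacts [h0, h1, h2]
  have hne : ∀ x, x ≠ v → c 2 x ≠ 1 := by
    intro x hx h
    refine hx (Subtype.ext ?_)
    rw [← hb]
    exact ((inner_eq_one_iff_of_norm_eq_one (by simp) (by simp)).1 h).symm
  let S : Metric.sphere (0 : EuclideanSpace ℝ (Fin 3)) 1 → ℂ := fun x =>
    (c 0 x + c 1 x * Complex.I) / ((1 - c 2 x : ℝ) : ℂ)
  have hS : ∀ N : ℝ → Metric.sphere (0 : EuclideanSpace ℝ (Fin 3)) 1, Continuous N →
      (∀ s, N s ≠ v) → Continuous fun s => S (N s) := by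
    intro N hN hNv
    refine Continuous.div (by fun_prop) (by fun_prop) fun s => ?_
    exact Complex.ofReal_ne_zero.2 (sub_ne_zero.2 (hne _ (hNv s)).symm)
  have hSneg : ∀ x, x ≠ v → -x ≠ v → S (-x) * conj (S x) = -1 := by
    intro x hx hx'
    have h1 : ((1 - c 2 x : ℝ) : ℂ) ≠ 0 :=
      Complex.ofReal_ne_zero.2 (sub_ne_zero.2 (hne _ hx).symm)
    have h2 : ((1 - c 2 (-x) : ℝ) : ℂ) ≠ 0 :=
      Complex.ofReal_ne_zero.2 (sub_ne_zero.2 (hne _ hx').symm)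
    have h3 : ((c 0 x : ℂ) ^ 2 + (c 1 x : ℂ) ^ 2 + (c 2 x : ℂ) ^ 2) = 1 := by exact_mod_cast hsq x
    simp only [S, map_div₀, map_add, map_mul, Complex.conj_ofReal, Complex.conj_I]
    rw [div_mul_div_comm, div_eq_iff (mul_ne_zero h2 h1), hneg, hneg, hneg]
    push_cast
    linear_combination -h3 + (c 1 x : ℂ) ^ 2 * Complex.I_sq
  have hSinj : ∀ x y, x ≠ v → y ≠ v → S x = S y → x = y := by
    intro x y hx hy h
    have hx1 : 1 - c 2 x ≠ 0 := sub_ne_zero.2 (hne _ hx).symm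
    have hy1 : 1 - c 2 y ≠ 0 := sub_ne_zero.2 (hne _ hy).symm
    have hform : ∀ z, S z = ⟨c 0 z / (1 - c 2 z), c 1 z / (1 - c 2 z)⟩ := fun z => by
      rw [Complex.mk_eq_add_mul_I]
      simp only [S]
      push_cast
      ring
    rw [hform, hform, Complex.mk.injEq, div_eq_div_iff hx1 hy1, div_eq_div_iff hx1 hy1] at h
    obtain ⟨h0, h1⟩ := h
    have h2 : c 2 x = c 2 y := by
      have key : (1 - c 2 x) * (1 - c 2 y) * (c 2 x - c 2 y) * 2 = 0 := by
        have e0 := congrArg (· ^ 2) h0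
        have e1 := congrArg (· ^ 2) h1
        simp only [mul_pow] at e0 e1
        linear_combination e0 + e1 - (1 - c 2 y) ^ 2 * hsq x + (1 - c 2 x) ^ 2 * hsq y
      simpa [hx1, hy1, sub_eq_zero] using key
    rw [h2] at h0 h1
    exact hext x y (mul_right_cancel₀ hy1 h0) (mul_right_cancel₀ hy1 h1) h2
  obtain ⟨s, t, hst⟩ := exists_eq_of_inversion_invariant (fun s => S (L s)) (fun t => S (M t))
    (hS L hL hLv) (hS M hM hMv)
    (fun s => by
      have h := hSneg (L s) (hLv s) (hL1 s ▸ hLv (s + 1))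
      rwa [← hL1] at h)
    (fun s => by
      have h := hSneg (M s) (hMv s) (hM1 s ▸ hMv (s + 1))
      rwa [← hM1] at h)
  exact ⟨s, t, hSinj _ _ (hLv s) (hMv t) hst⟩

/-- Two symmetric compact path connected subsets of the two-sphere intersect. -/
theorem not_disjoint_of_symmetric {P Q : Set (Metric.sphere (0 : EuclideanSpace ℝ (Fin 3)) 1)}
    (hP : IsPathConnected P) (hQ : IsPathConnected Q) (hPc : IsClosed P) (hQc : IsClosed Q)
    (hPs : ∀ x ∈ P, -x ∈ P) (hQs : ∀ x ∈ Q, -x ∈ Q) : ¬ Disjoint P Q := by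
  intro hdisj
  have hpre : IsPreconnected (Set.univ : Set (Metric.sphere (0 : EuclideanSpace ℝ (Fin 3)) 1)) :=
    (isPreconnected_iff_preconnectedSpace.1 (isPreconnected_sphere (by
      rw [← Module.finrank_eq_rank]; simp) _ _)).isPreconnected_univ
  have hv : ∃ v, v ∉ P ∪ Q := by
    by_contra! hv
    obtain ⟨x, -, hx⟩ := isPreconnected_closed_iff.1 hpre P Q hPc hQc (fun x _ => hv x)
      (by simpa using hP.nonempty) (by simpa using hQ.nonempty)
    exact Set.disjoint_left.1 hdisj hx.1 hx.2
  obtain ⟨v, hv⟩ := hv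
  rw [Set.mem_union, not_or] at hv
  obtain ⟨L, hL, hL1, hLP⟩ := exists_odd_loop hP hPs
  obtain ⟨M, hM, hM1, hMQ⟩ := exists_odd_loop hQ hQs
  obtain ⟨s, t, hst⟩ := exists_eq_of_odd_loops L M hL hM hL1 hM1 v
    (fun s h => hv.1 (h ▸ hLP s)) (fun s h => hv.2 (h ▸ hMQ s))
  exact Set.disjoint_left.1 hdisj (hLP s) (hst ▸ hMQ t)

/-- The zero set of a continuous odd function on the two-sphere is not the disjoint union of a
closed set and its antipode. -/
theorem not_preimage_eq_union_neg (g : Metric.sphere (0 : EuclideanSpace ℝ (Fin 3)) 1 → ℝ)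
    (hg : Continuous g) (hodd : ∀ x, g (-x) = -g x)
    {A : Set (Metric.sphere (0 : EuclideanSpace ℝ (Fin 3)) 1)} (hA : IsClosed A)
    (hdisj : ∀ x ∈ A, -x ∉ A) (hzero : ∀ x, g x = 0 → x ∈ A ∨ -x ∈ A) : False := by
  obtain ⟨u, hu0, hu1, -⟩ := exists_continuous_zero_one_of_isClosed hA
    (hA.preimage continuous_neg) (Set.disjoint_left.2 hdisj)
  obtain ⟨x, hx⟩ := exists_eq_zero_of_odd (fun x => ⟨g x, u (-x) - u x⟩)
    (by
      have : Continuous fun x => (g x : ℂ) + ((u (-x) - u x : ℝ) : ℂ) * Complex.I := by fun_prop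
      simpa only [← Complex.mk_eq_add_mul_I] using this)
    (fun x => by
      apply Complex.ext <;> simp [hodd])
  obtain ⟨h1, h2⟩ := Complex.ext_iff.1 hx
  simp only [Complex.zero_re, Complex.zero_im] at h1 h2
  rcases hzero x h1 with h | h
  · have e0 : u x = 0 := hu0 h
    have e1 : u (-x) = 1 := hu1 (by simpa using h)
    rw [e0, e1] at h2
    norm_num at h2
  · have e0 : u (-x) = 0 := hu0 h
    have e1 : u x = 1 := hu1 h
    rw [e0, e1] at h2
    norm_num at h2

/-- If the zero set of a continuous odd `g : S² → ℝ` is a finite disjoint union of simple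
closed curves permuted by the antipodal map, then the number of curves is odd; in
particular some curve is antipodally invariant. -/
theorem odd_number_of_curves
    (g : Metric.sphere (0 : EuclideanSpace ℝ (Fin 3)) 1 → ℝ)
    (hg : Continuous g) (hodd : ∀ x, g (-x) = -g x)
    (m : ℕ) (P : Fin m → Set (Metric.sphere (0 : EuclideanSpace ℝ (Fin 3)) 1))
    (hcurve : ∀ i, ∃ f : Circle → Metric.sphere (0 : EuclideanSpace ℝ (Fin 3)) 1,
      Continuous f ∧ Function.Injective f ∧ Set.range f = P i)
    (hdisj : Pairwise (Function.onFun Disjoint P))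
    (hunion : (⋃ i, P i) = g ⁻¹' {0})
    (hperm : ∀ i, ∃ j, -P i = P j) :
    Odd m ∧ ∃ i, -P i = P i := by
  choose f hf _ hfP using hcurve
  have hpath : ∀ i, IsPathConnected (P i) := fun i => by
    rw [← hfP i]
    exact isPathConnected_range (hf i)
  have hclosed : ∀ i, IsClosed (P i) := fun i => by
    rw [← hfP i]
    exact (isCompact_range (hf i)).isClosed
  have hinj : Function.Injective P := fun i j hij => by
    by_contra h
    have := hdisj h
    rw [Function.onFun, hij, disjoint_self] at this
    exact (hpath j).nonempty.ne_empty this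
  choose τ hτ using hperm
  have hττ : ∀ i, τ (τ i) = i := fun i => hinj (by rw [← hτ, ← hτ, neg_neg])
  have hmem : ∀ i x, -x ∈ P i ↔ x ∈ P (τ i) := fun i x => by rw [← hτ, Set.mem_neg]
  have hex : ∃ i, τ i = i := by
    by_contra! hne
    refine not_preimage_eq_union_neg g hg hodd (A := ⋃ i ∈ {i | i < τ i}, P i)
      ((Set.toFinite _).isClosed_biUnion fun i _ => hclosed i) ?_ ?_
    · intro x hx hx'
      simp only [Set.mem_iUnion, Set.mem_ofPred_eq, exists_prop] at hx hx'
      obtain ⟨i, hi, hxi⟩ := hx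
      obtain ⟨j, hj, hxj⟩ := hx'
      rw [hmem] at hxj
      have hij : i = τ j := by
        by_contra h
        exact Set.disjoint_left.1 (hdisj h) hxi hxj
      rw [hij, hττ] at hi
      exact lt_asymm hi hj
    · intro x hx
      have hx' : x ∈ ⋃ i, P i := hunion ▸ hx
      obtain ⟨i, hi⟩ := Set.mem_iUnion.1 hx'
      simp only [Set.mem_iUnion, Set.mem_ofPred_eq, exists_prop]
      rcases lt_or_gt_of_ne (hne i) with h | h
      · exact Or.inr ⟨τ i, by rwa [hττ], by rwa [hmem, hττ]⟩
      · exact Or.inl ⟨i, h, hi⟩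
  have huniq : ∀ i j, τ i = i → τ j = j → i = j := by
    intro i j hi hj
    by_contra h
    refine not_disjoint_of_symmetric (hpath i) (hpath j) (hclosed i) (hclosed j) ?_ ?_ (hdisj h)
    · intro x hx
      rwa [hmem, hi]
    · intro x hx
      rwa [hmem, hj]
  obtain ⟨i, hi⟩ := hex
  refine ⟨?_, i, by rw [hτ, hi]⟩
  have hcard := Equiv.Perm.card_fixedPoints_modEq
    (f := (τ : Function.End (Fin m))) (p := 2) (n := 1)
    ((pow_two (M := Function.End (Fin m)) τ).trans (funext hττ))
  have hone : Fintype.card (Function.fixedPoints (τ : Function.End (Fin m))) = 1 :=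
    Fintype.card_eq_one_iff.2 ⟨⟨i, hi⟩, fun j => Subtype.ext (huniq _ _ j.2 hi)⟩
  rw [hone, Fintype.card_fin] at hcard
  exact Nat.odd_iff.2 hcard
end

section
/- Let T be a finite symmetric triangulation of S² and ℓ a generalized Tucker labelling by {±1}, with L : S² → ℝ the simplicial (piecewise-linear) extension of ℓ. Then there exists a polygonal simple closed path P ⊆ L⁻¹({0}) in S² that is invariant under the antipodal map (-P = P). -/
/-- A finite symmetric triangulation of the unit sphere `S² ⊆ ℝ³`: a finite simplicial
complex, closed under the antipodal map, whose vertices lie on the sphere and whose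
underlying space projects radially, bijectively, onto the sphere. -/
structure SymmetricSphereTriangulation where
  K : Geometry.SimplicialComplex ℝ (EuclideanSpace ℝ (Fin 3))
  finite : K.faces.Finite
  symm : ∀ s ∈ K.faces, ∃ t ∈ K.faces,
    (t : Set (EuclideanSpace ℝ (Fin 3))) = (fun v => -v) '' (s : Set (EuclideanSpace ℝ (Fin 3)))
  vertices_on_sphere : ∀ v ∈ K.vertices, ‖v‖ = 1
  zero_not_mem : (0 : EuclideanSpace ℝ (Fin 3)) ∉ K.space
  radial_bij : Set.BijOn (fun x => ‖x‖⁻¹ • x) K.space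
    (Metric.sphere (0 : EuclideanSpace ℝ (Fin 3)) 1)

/-- A generalized Tucker labelling: each vertex is labelled `+1` or `-1`, antipodal
vertices receiving opposite labels. -/
def IsGenTuckerLabelling (T : SymmetricSphereTriangulation)
    (ℓ : EuclideanSpace ℝ (Fin 3) → ℝ) : Prop :=
  (∀ v ∈ T.K.vertices, ℓ v = 1 ∨ ℓ v = -1) ∧
  (∀ v ∈ T.K.vertices, ℓ (-v) = -ℓ v)

/-- `L` is the simplicial (piecewise affine) extension of the vertex labelling `ℓ`. -/
def IsSimplicialExtension (T : SymmetricSphereTriangulation)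
    (ℓ L : EuclideanSpace ℝ (Fin 3) → ℝ) : Prop :=
  (∀ v ∈ T.K.vertices, L v = ℓ v) ∧
  (∀ s ∈ T.K.faces, ∃ A : EuclideanSpace ℝ (Fin 3) →ᵃ[ℝ] ℝ,
    ∀ x ∈ convexHull ℝ (s : Set (EuclideanSpace ℝ (Fin 3))), L x = A x)

/-- A polygonal simple closed path: a simple closed curve which is a finite union of
line segments. -/
def IsPolygonalSimpleClosedPath (P : Set (EuclideanSpace ℝ (Fin 3))) : Prop :=
  (∃ f : Circle → EuclideanSpace ℝ (Fin 3),
    Continuous f ∧ Function.Injective f ∧ Set.range f = P) ∧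
  (∃ (n : ℕ) (_ : 0 < n) (p : ZMod n → EuclideanSpace ℝ (Fin 3)),
    P = ⋃ i, segment ℝ (p i) (p (i + 1)))

/-- The Borsuk–Ulam theorem for the two-dimensional sphere. -/
theorem exists_eq_zero_of_odd_on_sphere (F : EuclideanSpace ℝ (Fin 3) → ℂ)
    (hF : ContinuousOn F (Metric.sphere 0 1))
    (hodd : ∀ x ∈ Metric.sphere (0 : EuclideanSpace ℝ (Fin 3)) 1, F (-x) = -F x) :
    ∃ x ∈ Metric.sphere (0 : EuclideanSpace ℝ (Fin 3)) 1, F x = 0 := by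
  by_contra! h0
  let b : ℂ → EuclideanSpace ℝ (Fin 3) := fun z => !₂[z.re, z.im, max 0 (1 - ‖z‖)]
  have hb0 : ∀ z, b z ≠ 0 := by
    intro z hz
    have h1 : z.re = 0 := congr($hz 0)
    have h2 : z.im = 0 := congr($hz 1)
    have h3 : max 0 (1 - ‖z‖) = 0 := congr($hz 2)
    have : z = 0 := Complex.ext h1 h2
    simp [this] at h3
  have hbc : Continuous b := by
    refine (PiLp.continuous_toLp 2 _).comp (continuous_pi fun i => ?_)
    fin_cases i <;> simp <;> fun_prop
  let c : ℂ → EuclideanSpace ℝ (Fin 3) := fun z => ‖b z‖⁻¹ • b z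
  have hcc : Continuous c :=
    (hbc.norm.inv₀ fun z => norm_ne_zero_iff.2 (hb0 z)).smul hbc
  have hcs : ∀ z, c z ∈ Metric.sphere (0 : EuclideanSpace ℝ (Fin 3)) 1 := by
    intro z
    simp [c, norm_smul, hb0 z]
  have hcneg : ∀ z, ‖z‖ = 1 → c (-z) = -c z := by
    intro z hz
    have : b (-z) = -b z := by
      ext i
      fin_cases i <;> simp [b, hz]
    simp [c, this]
  have huniv : IsSimplyConnected (Set.univ : Set ℂ) :=
    have := (convex_univ (𝕜 := ℝ) (E := ℂ)).contractibleSpace Set.univ_nonempty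
    inferInstanceAs (SimplyConnectedSpace (Set.univ : Set ℂ))
  obtain ⟨w, hwc, hw⟩ := Complex.exists_continuousOn_eqOn_exp_comp (U := (Set.univ : Set ℂ))
    (g := F ∘ c) huniv isOpen_univ
    (hF.comp hcc.continuousOn fun z _ => hcs z)
    (by rintro ⟨z, -, hz⟩; exact h0 _ (hcs z) hz)
  rw [continuousOn_univ] at hwc
  let g : ℝ → ℂ := fun t => w (-Circle.exp t) - w (Circle.exp t)
  have hgc : Continuous g := by fun_prop
  have hexp : ∀ t, Complex.exp (g t) = -1 := by
    intro t
    have h1 := hw (Set.mem_univ (Circle.exp t : ℂ))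
    have h2 := hw (Set.mem_univ (-(Circle.exp t : ℂ)))
    simp only [Function.comp_apply] at h1 h2
    rw [hcneg _ (Circle.norm_coe _), hodd _ (hcs _), ← h1] at h2
    simp only [g, Complex.exp_sub, h2]
    field_simp [Complex.exp_ne_zero]
  have hgpi : g Real.pi = -g 0 := by simp [g]
  have hmem : (0 : ℝ) ∈ Set.uIcc (g 0).im (g Real.pi).im := by
    rw [hgpi, Set.mem_uIcc]
    rcases le_total (g 0).im 0 with h | h
    · left; simpa using h
    · right; simpa using h
  obtain ⟨t, -, ht⟩ := intermediate_value_uIcc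
    (Complex.continuous_im.comp hgc).continuousOn hmem
  have := congrArg Complex.re (hexp t)
  simp only [Function.comp_apply] at ht
  rw [Complex.exp_re, ht] at this
  simp at this
  linarith [Real.exp_pos (g t).re]

section ClosedPolygon

variable {V : Type*} [NormedAddCommGroup V] [NormedSpace ℝ V]

/-- The piecewise affine curve which is at `q k` at each integer time `k`. -/
noncomputable def polygonalCurve (q : ℤ → V) (t : ℝ) : V :=
  AffineMap.lineMap (q ⌊t⌋) (q (⌊t⌋ + 1)) (Int.fract t)

theorem polygonalCurve_of_mem_Icc (q : ℤ → V) (k : ℤ) {t : ℝ} (ht : t ∈ Set.Icc (k : ℝ) (k + 1)) :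
    polygonalCurve q t = AffineMap.lineMap (q k) (q (k + 1)) (t - k) := by
  rcases ht.2.lt_or_eq with h | h
  · have : ⌊t⌋ = k := Int.floor_eq_iff.2 ⟨ht.1, h⟩
    simp [polygonalCurve, Int.fract, this]
  · simp [polygonalCurve, h]

theorem continuous_polygonalCurve (q : ℤ → V) : Continuous (polygonalCurve q) := by
  have hlf : LocallyFinite fun k : ℤ => Set.Icc (k : ℝ) (k + 1) :=
    locallyFinite_Icc_of_tendsto tendsto_intCast_atTop_atTop
      (Filter.tendsto_atBot_add_const_right _ _ (tendsto_intCast_atBot_iff.2 Filter.tendsto_id))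
  refine hlf.continuous (iUnion_Icc_intCast ℝ) (fun k => isClosed_Icc) fun k => ?_
  refine ContinuousOn.congr ?_ fun t ht => polygonalCurve_of_mem_Icc q k ht
  exact (AffineMap.lineMap_continuous.comp (continuous_id.sub continuous_const)).continuousOn

theorem range_polygonalCurve (q : ℤ → V) :
    Set.range (polygonalCurve q) = ⋃ k, segment ℝ (q k) (q (k + 1)) := by
  ext x
  simp only [Set.mem_range, Set.mem_iUnion, segment_eq_image_lineMap, Set.mem_image]
  constructor
  · rintro ⟨t, rfl⟩
    exact ⟨⌊t⌋, Int.fract t, ⟨Int.fract_nonneg t, (Int.fract_lt_one t).le⟩, rfl⟩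
  · rintro ⟨k, s, hs, rfl⟩
    refine ⟨k + s, ?_⟩
    rw [polygonalCurve_of_mem_Icc q k ⟨by linarith [hs.1], by linarith [hs.2]⟩, add_sub_cancel_left]

theorem polygonalCurve_periodic {q : ℤ → V} {N : ℕ} (hq : Function.Periodic q (N : ℤ)) :
    Function.Periodic (polygonalCurve q) (N : ℝ) := by
  intro t
  simp only [polygonalCurve, Int.floor_add_natCast, Int.fract_add_natCast]
  rw [hq, add_right_comm, hq]

/-- Two edges of the closed polygon `q` of period `N` which are not equal can only meet
at common endpoints. -/
def EdgesMeetAtVertices (q : ℤ → V) (N : ℕ) : Prop :=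
  ∀ i j z, z ∈ segment ℝ (q i) (q (i + 1)) → z ∈ segment ℝ (q j) (q (j + 1)) →
    i ≡ j [ZMOD N] ∨
      ((z = q i ∨ z = q (i + 1)) ∧ (z = q j ∨ z = q (j + 1)))

theorem polygonalCurve_eq_iff {q : ℤ → V} {N : ℕ} (hN : 2 ≤ N)
    (hq : Function.Periodic q (N : ℤ)) (hinj : ∀ i j, q i = q j → i ≡ j [ZMOD N])
    (hmeet : EdgesMeetAtVertices q N) {s t : ℝ} (h : polygonalCurve q s = polygonalCurve q t) :
    ∃ k : ℤ, k • (N : ℝ) = s - t := by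
  have hne : ∀ i, q i ≠ q (i + 1) := by
    intro i hi
    have := (hinj _ _ hi).dvd
    rw [add_sub_cancel_left] at this
    have := Int.le_of_dvd one_pos this
    omega
  have hend : ∀ r, polygonalCurve q r ≠ q (⌊r⌋ + 1) := by
    intro r hr
    have : AffineMap.lineMap (q ⌊r⌋) (q (⌊r⌋ + 1)) (Int.fract r) =
        AffineMap.lineMap (q ⌊r⌋) (q (⌊r⌋ + 1)) (1 : ℝ) := by
      rw [AffineMap.lineMap_apply_one]; exact hr
    exact (Int.fract_lt_one r).ne (AffineMap.lineMap_injective ℝ (hne _) this)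
  have hmem : ∀ r, polygonalCurve q r ∈ segment ℝ (q ⌊r⌋) (q (⌊r⌋ + 1)) := by
    intro r
    rw [segment_eq_image_lineMap]
    exact ⟨_, ⟨Int.fract_nonneg r, (Int.fract_lt_one r).le⟩, rfl⟩
  have key : ⌊t⌋ ≡ ⌊s⌋ [ZMOD N] := by
    rcases hmeet ⌊t⌋ ⌊s⌋ _ (hmem t) (h ▸ hmem s) with h1 | ⟨h1, h2⟩
    · exact h1
    · have h1 := h1.resolve_right (hend t)
      rw [← h] at h1 h2
      have h2 := h2.resolve_right (hend s)
      exact hinj _ _ (h1.symm.trans h2)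
  obtain ⟨k, hk⟩ := key.dvd
  have hfl : ⌊s⌋ = ⌊t⌋ + k * N := by linarith
  have e1 : q ⌊s⌋ = q ⌊t⌋ := by rw [hfl]; simpa using hq.int_mul k ⌊t⌋
  have e2 : q (⌊s⌋ + 1) = q (⌊t⌋ + 1) := by
    rw [hfl, add_right_comm]; simpa using hq.int_mul k (⌊t⌋ + 1)
  have hfr : Int.fract s = Int.fract t := by
    rw [polygonalCurve, polygonalCurve, e1, e2] at h
    exact AffineMap.lineMap_injective ℝ (hne _) h
  refine ⟨k, ?_⟩
  have h1 := Int.floor_add_fract s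
  have h2 := Int.floor_add_fract t
  rw [hfl, hfr] at h1
  push_cast at h1
  rw [zsmul_eq_mul]
  linarith

end ClosedPolygon

theorem isPolygonalSimpleClosedPath_iUnion_segment {q : ℤ → EuclideanSpace ℝ (Fin 3)} {N : ℕ}
    (hN : 2 ≤ N) (hq : Function.Periodic q (N : ℤ)) (hinj : ∀ i j, q i = q j → i ≡ j [ZMOD N])
    (hmeet : EdgesMeetAtVertices q N) :
    IsPolygonalSimpleClosedPath (⋃ k, segment ℝ (q k) (q (k + 1))) := by
  constructor
  · have hN0 : (N : ℝ) ≠ 0 := by positivity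
    have hper := polygonalCurve_periodic hq
    have hcont : Continuous hper.lift :=
      continuous_quot_lift _ (continuous_polygonalCurve q)
    have hinj' : Function.Injective hper.lift := by
      intro x y
      induction x using QuotientAddGroup.induction_on with | H s => ?_
      induction y using QuotientAddGroup.induction_on with | H t => ?_
      intro h
      rw [hper.lift_coe, hper.lift_coe] at h
      obtain ⟨k, hk⟩ := polygonalCurve_eq_iff hN hq hinj hmeet h
      rw [← sub_eq_zero, ← QuotientAddGroup.mk_sub]
      exact (AddCircle.coe_eq_zero_iff (N : ℝ)).2 ⟨k, hk⟩
    let e := AddCircle.homeomorphCircle hN0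
    refine ⟨hper.lift ∘ e.symm, hcont.comp e.symm.continuous, hinj'.comp e.symm.injective, ?_⟩
    rw [e.symm.surjective.range_comp, ← range_polygonalCurve,
      ← (QuotientAddGroup.mk_surjective).range_comp hper.lift]
    rfl
  · refine ⟨N, by omega, fun i => q i.cast, ?_⟩
    have hcast : ∀ k : ℤ, q ((k : ZMod N).cast) = q k := by
      intro k
      have : ((k : ZMod N).cast : ℤ) ≡ k [ZMOD N] := by
        rw [← ZMod.intCast_eq_intCast_iff]; simp
      obtain ⟨m, hm⟩ := this.dvd
      rw [eq_add_of_sub_eq' hm, mul_comm]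
      simpa using (hq.int_mul m _).symm
    have := (ZMod.intCast_surjective (n := N)).iUnion_comp
      (fun i => segment ℝ (q i.cast) (q (i + 1).cast))
    rw [← this]
    refine Set.iUnion_congr fun k => ?_
    rw [hcast, show (k : ZMod N) + 1 = ((k + 1 : ℤ) : ZMod N) by push_cast; rfl, hcast]

namespace SymmetricSphereTriangulation

theorem exists_neg_face (T : SymmetricSphereTriangulation) {s : Finset (EuclideanSpace ℝ (Fin 3))}
    (hs : s ∈ T.K.faces) :
    ∃ t ∈ T.K.faces, (t : Set (EuclideanSpace ℝ (Fin 3))) = -(s : Set (EuclideanSpace ℝ (Fin 3))) ∧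
      ∀ v, v ∈ t ↔ -v ∈ s := by
  obtain ⟨t, ht, h⟩ := T.symm s hs
  rw [Set.image_neg_eq_neg] at h
  exact ⟨t, ht, h, fun v => by rw [← Finset.mem_coe, h]; simp⟩

theorem mem_vertices_of_mem (T : SymmetricSphereTriangulation)
    {s : Finset (EuclideanSpace ℝ (Fin 3))} (hs : s ∈ T.K.faces) {v : EuclideanSpace ℝ (Fin 3)}
    (hv : v ∈ s) : v ∈ T.K.vertices :=
  T.K.down_closed hs (Finset.singleton_subset_iff.2 hv) (Finset.singleton_nonempty v)

theorem neg_mem_space (T : SymmetricSphereTriangulation) {x : EuclideanSpace ℝ (Fin 3)}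
    (hx : x ∈ T.K.space) : -x ∈ T.K.space := by
  rw [Geometry.SimplicialComplex.mem_space_iff] at hx ⊢
  obtain ⟨s, hs, hx⟩ := hx
  obtain ⟨t, ht, hts, -⟩ := T.exists_neg_face hs
  refine ⟨t, ht, ?_⟩
  rw [hts, convexHull_neg]
  simpa using hx

theorem isCompact_space (T : SymmetricSphereTriangulation) : IsCompact T.K.space :=
  T.finite.isCompact_biUnion fun s _ => s.finite_toSet.isCompact_convexHull ℝ

theorem card_face_le (T : SymmetricSphereTriangulation) {s : Finset (EuclideanSpace ℝ (Fin 3))}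
    (hs : s ∈ T.K.faces) : s.card ≤ 3 := by
  by_contra! hcard
  have hind := T.K.indep hs
  have hle := hind.card_le_finrank_succ.trans (Nat.succ_le_succ (Submodule.finrank_le _))
  have hspan := hind.affineSpan_eq_top_iff_card_eq_finrank_add_one.2 (by
    rw [finrank_euclideanSpace_fin, Fintype.card_coe] at hle ⊢; omega)
  rw [Subtype.range_coe_subtype, Finset.setOfPred_mem,
    ← interior_convexHull_nonempty_iff_affineSpan_eq_top] at hspan
  obtain ⟨x, hx⟩ := hspan
  have hsub := T.K.convexHull_subset_space hs
  have hx0 : x ≠ 0 := by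
    rintro rfl
    exact T.zero_not_mem (hsub (interior_subset hx))
  have hnhds : ∀ᶠ r : ℝ in nhds 1, r • x ∈ interior (convexHull ℝ (s : Set _)) := by
    refine (continuous_id.smul continuous_const).continuousAt.eventually_mem ?_
    simpa using isOpen_interior.mem_nhds hx
  obtain ⟨r, hr, hr1⟩ := ((hnhds.filter_mono nhdsWithin_le_nhds).and
    (self_mem_nhdsWithin : Set.Ioi (1 : ℝ) ∈ nhdsWithin 1 (Set.Ioi 1))).exists
  have hr1 : 1 < r := hr1
  have hr0 : 0 < r := by linarith
  have := T.radial_bij.injOn (hsub (interior_subset hr)) (hsub (interior_subset hx)) (by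
    simp only [norm_smul, Real.norm_of_nonneg hr0.le, smul_smul]
    congr 1
    field_simp)
  have h1 : (r - 1) • x = 0 := by rw [sub_smul, this, one_smul, sub_self]
  rcases smul_eq_zero.1 h1 with h | h
  · linarith
  · exact hx0 h

/-- The Borsuk–Ulam theorem on the underlying space of a symmetric triangulation. -/
theorem exists_eq_zero_of_odd (T : SymmetricSphereTriangulation)
    {F : EuclideanSpace ℝ (Fin 3) → ℂ} (hF : ContinuousOn F T.K.space)
    (hodd : ∀ x ∈ T.K.space, F (-x) = -F x) : ∃ x ∈ T.K.space, F x = 0 := by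
  have hbij := T.radial_bij
  set ρ : EuclideanSpace ℝ (Fin 3) → EuclideanSpace ℝ (Fin 3) := fun x => ‖x‖⁻¹ • x with hρ
  have hcont : ContinuousOn ρ T.K.space := by
    refine (continuousOn_id.norm.inv₀ fun x hx h => ?_).smul continuousOn_id
    obtain rfl : x = 0 := by simpa using h
    exact T.zero_not_mem hx
  set ψ := Function.invFunOn ρ T.K.space
  have hinv : Set.InvOn ψ ρ T.K.space (Metric.sphere 0 1) := hbij.invOn_invFunOn
  have hψ : Set.MapsTo ψ (Metric.sphere 0 1) T.K.space := hbij.surjOn.mapsTo_invFunOn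
  have hψc : ContinuousOn ψ (Metric.sphere 0 1) := by
    have := isCompact_iff_compactSpace.1 T.isCompact_space
    let e := Continuous.homeoOfEquivCompactToT2 (f := hbij.equiv ρ)
      ((continuousOn_iff_continuous_domRestrict.1 hcont).subtype_mk _)
    rw [continuousOn_iff_continuous_domRestrict]
    convert! continuous_subtype_val.comp e.symm.continuous using 1
    ext1 y
    obtain ⟨x, rfl⟩ := e.surjective y
    rw [Function.comp_apply, e.symm_apply_apply]
    exact hinv.1 x.2
  obtain ⟨y, hy, h⟩ := exists_eq_zero_of_odd_on_sphere (F ∘ ψ) (hF.comp hψc hψ) fun y hy => by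
    have hy' : -y ∈ Metric.sphere (0 : EuclideanSpace ℝ (Fin 3)) 1 := by simpa using hy
    have : ψ (-y) = -ψ y := by
      refine hbij.injOn (hψ hy') (T.neg_mem_space (hψ hy)) ?_
      rw [hinv.2 hy']
      have := hinv.2 hy
      simp only [hρ] at this ⊢
      rw [norm_neg, smul_neg, this]
    simp only [Function.comp_apply, this, hodd _ (hψ hy)]
  exact ⟨ψ y, hψ hy, h⟩

end SymmetricSphereTriangulation

open scoped Classical in
/-- The midpoints of those edges of the simplex `s` whose endpoints carry opposite labels. -/
noncomputable def edgeMidpoints (ℓ : EuclideanSpace ℝ (Fin 3) → ℝ)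
    (s : Finset (EuclideanSpace ℝ (Fin 3))) : Finset (EuclideanSpace ℝ (Fin 3)) :=
  ({v ∈ s | ℓ v = 1} ×ˢ {v ∈ s | ℓ v = -1}).image fun e => midpoint ℝ e.1 e.2

theorem mem_edgeMidpoints {ℓ : EuclideanSpace ℝ (Fin 3) → ℝ}
    {s : Finset (EuclideanSpace ℝ (Fin 3))} {x : EuclideanSpace ℝ (Fin 3)} :
    x ∈ edgeMidpoints ℓ s ↔ ∃ u ∈ s, ∃ v ∈ s, ℓ u = 1 ∧ ℓ v = -1 ∧ midpoint ℝ u v = x := by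
  simp only [edgeMidpoints, Finset.mem_image, Finset.mem_product, Finset.mem_filter, Prod.exists]
  grind

theorem edgeMidpoints_mono (ℓ : EuclideanSpace ℝ (Fin 3) → ℝ)
    {s t : Finset (EuclideanSpace ℝ (Fin 3))} (h : s ⊆ t) :
    edgeMidpoints ℓ s ⊆ edgeMidpoints ℓ t := by
  intro x
  simp only [mem_edgeMidpoints]
  rintro ⟨u, hu, v, hv, h'⟩
  exact ⟨u, h hu, v, h hv, h'⟩

theorem exists_card_edgeMidpoints_le (ℓ : EuclideanSpace ℝ (Fin 3) → ℝ)
    (s : Finset (EuclideanSpace ℝ (Fin 3))) :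
    ∃ a b : ℕ, a + b ≤ s.card ∧ (edgeMidpoints ℓ s).card ≤ a * b := by
  classical
  refine ⟨({v ∈ s | ℓ v = 1} : Finset _).card, ({v ∈ s | ℓ v = -1} : Finset _).card, ?_, ?_⟩
  · rw [← Finset.card_union_of_disjoint]
    · exact Finset.card_le_card (Finset.union_subset (Finset.filter_subset _ _)
        (Finset.filter_subset _ _))
    · rw [Finset.disjoint_filter]
      intro v _ h1 h2
      linarith
  · rw [← Finset.card_product, edgeMidpoints]
    convert! Finset.card_image_le (s := {v ∈ s | ℓ v = 1} ×ˢ {v ∈ s | ℓ v = -1})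

theorem card_edgeMidpoints_le_two (ℓ : EuclideanSpace ℝ (Fin 3) → ℝ)
    {s : Finset (EuclideanSpace ℝ (Fin 3))} (hs : s.card ≤ 3) :
    (edgeMidpoints ℓ s).card ≤ 2 := by
  obtain ⟨a, b, hab, h⟩ := exists_card_edgeMidpoints_le ℓ s
  have ha : a ≤ 3 := by omega
  interval_cases a <;> omega

theorem card_edgeMidpoints_le_one (ℓ : EuclideanSpace ℝ (Fin 3) → ℝ)
    {s : Finset (EuclideanSpace ℝ (Fin 3))} (hs : s.card ≤ 2) :
    (edgeMidpoints ℓ s).card ≤ 1 := by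
  obtain ⟨a, b, hab, h⟩ := exists_card_edgeMidpoints_le ℓ s
  have ha : a ≤ 2 := by omega
  interval_cases a <;> omega

theorem edgeMidpoints_subset_convexHull (ℓ : EuclideanSpace ℝ (Fin 3) → ℝ)
    (s : Finset (EuclideanSpace ℝ (Fin 3))) :
    (edgeMidpoints ℓ s : Set (EuclideanSpace ℝ (Fin 3))) ⊆ convexHull ℝ s := by
  intro x hx
  obtain ⟨u, hu, v, hv, -, -, rfl⟩ := mem_edgeMidpoints.1 (Finset.mem_coe.1 hx)
  exact (convex_convexHull ℝ _).midpoint_mem (subset_convexHull ℝ _ hu)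
    (subset_convexHull ℝ _ hv)

theorem convexHull_edgeMidpoints_subset (ℓ : EuclideanSpace ℝ (Fin 3) → ℝ)
    (s : Finset (EuclideanSpace ℝ (Fin 3))) :
    convexHull ℝ (edgeMidpoints ℓ s : Set (EuclideanSpace ℝ (Fin 3))) ⊆ convexHull ℝ s :=
  convexHull_min (edgeMidpoints_subset_convexHull ℓ s) (convex_convexHull ℝ _)

/-- A convex combination which gives total weight `1 / 2` to each label is a convex combination
of midpoints of edges with opposite labels. -/
theorem mem_convexHull_edgeMidpoints {ℓ : EuclideanSpace ℝ (Fin 3) → ℝ}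
    {s : Finset (EuclideanSpace ℝ (Fin 3))} (hℓ : ∀ v ∈ s, ℓ v = 1 ∨ ℓ v = -1)
    {w : EuclideanSpace ℝ (Fin 3) → ℝ} (hw : ∀ v ∈ s, 0 ≤ w v) (hw1 : ∑ v ∈ s, w v = 1)
    (h0 : ∑ v ∈ s, w v * ℓ v = 0) :
    ∑ v ∈ s, w v • v ∈ convexHull ℝ (edgeMidpoints ℓ s : Set (EuclideanSpace ℝ (Fin 3))) := by
  classical
  set P : Finset (EuclideanSpace ℝ (Fin 3)) := {v ∈ s | ℓ v = 1} with hP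
  set N : Finset (EuclideanSpace ℝ (Fin 3)) := {v ∈ s | ¬ ℓ v = 1} with hN
  have hNℓ : ∀ v ∈ N, ℓ v = -1 := fun v hv =>
    (hℓ v (Finset.mem_filter.1 hv).1).resolve_left (Finset.mem_filter.1 hv).2
  have hPℓ : ∀ v ∈ P, ℓ v = 1 := fun v hv => (Finset.mem_filter.1 hv).2
  have hPs : P ⊆ s := Finset.filter_subset _ _
  have hNs : N ⊆ s := Finset.filter_subset _ _
  have hsum : ∑ v ∈ P, w v + ∑ v ∈ N, w v = 1 := by
    rw [← hw1]; exact Finset.sum_filter_add_sum_filter_not s _ _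
  have hdiff : ∑ v ∈ P, w v - ∑ v ∈ N, w v = 0 := by
    rw [← h0, ← Finset.sum_filter_add_sum_filter_not s (fun v => ℓ v = 1), sub_eq_add_neg,
      ← Finset.sum_neg_distrib]
    congr 1
    · exact Finset.sum_congr rfl fun v hv => by rw [hPℓ v hv, mul_one]
    · exact Finset.sum_congr rfl fun v hv => by rw [hNℓ v hv, mul_neg_one]
  have hwP : ∑ v ∈ P, w v = 1 / 2 := by linarith
  have hwN : ∑ v ∈ N, w v = 1 / 2 := by linarith
  have key : ∑ v ∈ s, w v • v =
      ∑ e ∈ P ×ˢ N, (4 * (w e.1 * w e.2)) • midpoint ℝ e.1 e.2 := by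
    have hterm : ∀ u v : EuclideanSpace ℝ (Fin 3), (4 * (w u * w v)) • midpoint ℝ u v =
        (2 * w v) • (w u • u) + (2 * w u) • (w v • v) := by
      intro u v
      rw [midpoint_eq_smul_add, invOf_eq_inv]
      module
    rw [← Finset.sum_filter_add_sum_filter_not s (fun v => ℓ v = 1), Finset.sum_product]
    simp only [hterm, Finset.sum_add_distrib, ← Finset.sum_smul, ← Finset.smul_sum,
      ← Finset.mul_sum, hwP, hwN]
    norm_num
    rfl
  rw [key]
  refine (convex_convexHull ℝ _).sum_mem (fun e he => ?_) ?_ fun e he => ?_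
  · rw [Finset.mem_product] at he
    have := hw _ (hPs he.1)
    have := hw _ (hNs he.2)
    positivity
  · rw [← Finset.mul_sum, Finset.sum_product]
    simp only [← Finset.mul_sum, ← Finset.sum_mul, hwP, hwN]
    norm_num
  · rw [Finset.mem_product] at he
    exact subset_convexHull ℝ _ (mem_edgeMidpoints.2
      ⟨_, hPs he.1, _, hNs he.2, hPℓ _ he.1, hNℓ _ he.2, rfl⟩)

section SimplicialExtension

variable {T : SymmetricSphereTriangulation} {ℓ L : EuclideanSpace ℝ (Fin 3) → ℝ}
  {s : Finset (EuclideanSpace ℝ (Fin 3))}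

theorem IsGenTuckerLabelling.neg_mem_edgeMidpoints (hℓ : IsGenTuckerLabelling T ℓ)
    (hs : s ∈ T.K.faces) {t : Finset (EuclideanSpace ℝ (Fin 3))} (hst : ∀ v, v ∈ t ↔ -v ∈ s)
    {x : EuclideanSpace ℝ (Fin 3)} (hx : x ∈ edgeMidpoints ℓ s) : -x ∈ edgeMidpoints ℓ t := by
  obtain ⟨u, hu, v, hv, hu1, hv1, rfl⟩ := mem_edgeMidpoints.1 hx
  refine mem_edgeMidpoints.2 ⟨-v, by simpa [hst], -u, by simpa [hst], ?_, ?_, ?_⟩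
  · rw [hℓ.2 v (T.mem_vertices_of_mem hs hv), hv1, neg_neg]
  · rw [hℓ.2 u (T.mem_vertices_of_mem hs hu), hu1]
  · rw [midpoint_comm, midpoint_eq_smul_add, midpoint_eq_smul_add, ← smul_neg, neg_add]

theorem IsSimplicialExtension.continuousOn (hL : IsSimplicialExtension T ℓ L) :
    ContinuousOn L T.K.space := by
  have := T.finite.to_subtype
  have h := (locallyFinite_of_finite fun s : T.K.faces =>
    convexHull ℝ (s.1 : Set (EuclideanSpace ℝ (Fin 3)))).continuousOn_iUnion (g := L)
    (fun s => (s.1.finite_toSet.isCompact_convexHull ℝ).isClosed) fun s => by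
      obtain ⟨A, hA⟩ := hL.2 s.1 s.2
      exact A.continuous_of_finiteDimensional.continuousOn.congr hA
  rwa [Set.iUnion_coe_set] at h

theorem IsSimplicialExtension.map_neg (hL : IsSimplicialExtension T ℓ L)
    (hℓ : IsGenTuckerLabelling T ℓ) {x : EuclideanSpace ℝ (Fin 3)} (hx : x ∈ T.K.space) :
    L (-x) = -L x := by
  obtain ⟨s, hs, hxs⟩ := T.K.mem_space_iff.1 hx
  obtain ⟨t, ht, hts, hmem⟩ := T.exists_neg_face hs
  obtain ⟨A, hA⟩ := hL.2 s hs
  obtain ⟨B, hB⟩ := hL.2 t ht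
  have hneg : ∀ y ∈ convexHull ℝ (s : Set (EuclideanSpace ℝ (Fin 3))),
      -y ∈ convexHull ℝ (t : Set (EuclideanSpace ℝ (Fin 3))) := by
    intro y hy
    rw [hts, convexHull_neg]
    simpa using hy
  have hEq : Set.EqOn (B.comp (-LinearMap.id : _ →ₗ[ℝ] _).toAffineMap)
      (-A : EuclideanSpace ℝ (Fin 3) →ᵃ[ℝ] ℝ)
      (s : Set (EuclideanSpace ℝ (Fin 3))) := by
    intro v hv
    have hv' := subset_convexHull ℝ _ hv
    have hvs := T.mem_vertices_of_mem hs hv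
    have hvt : -v ∈ T.K.vertices := T.mem_vertices_of_mem ht (by simpa [hmem] using hv)
    simp only [AffineMap.coe_comp, LinearMap.coe_toAffineMap, Function.comp_apply,
      LinearMap.neg_apply, LinearMap.id_apply, AffineMap.coe_neg, Pi.neg_apply]
    rw [← hA v hv', ← hB _ (hneg v hv'), hL.1 _ hvs, hL.1 _ hvt, hℓ.2 v hvs]
  have := AffineMap.eqOn_affineSpan hEq (convexHull_subset_affineSpan _ hxs)
  rw [hA x hxs, hB _ (hneg x hxs)]
  simpa using this

theorem IsSimplicialExtension.eq_zero_of_mem_convexHull (hL : IsSimplicialExtension T ℓ L)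
    (hs : s ∈ T.K.faces) {x : EuclideanSpace ℝ (Fin 3)}
    (hx : x ∈ convexHull ℝ (edgeMidpoints ℓ s : Set (EuclideanSpace ℝ (Fin 3)))) : L x = 0 := by
  obtain ⟨A, hA⟩ := hL.2 s hs
  have hEq : Set.EqOn A (AffineMap.const ℝ _ 0)
      (edgeMidpoints ℓ s : Set (EuclideanSpace ℝ (Fin 3))) := by
    intro m hm
    obtain ⟨u, hu, v, hv, hu1, hv1, rfl⟩ := mem_edgeMidpoints.1 (Finset.mem_coe.1 hm)
    rw [A.map_midpoint, ← hA u (subset_convexHull ℝ _ hu), ← hA v (subset_convexHull ℝ _ hv),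
      hL.1 u (T.mem_vertices_of_mem hs hu), hL.1 v (T.mem_vertices_of_mem hs hv), hu1, hv1]
    simp
  rw [hA x (convexHull_edgeMidpoints_subset ℓ s hx)]
  exact AffineMap.eqOn_affineSpan hEq (convexHull_subset_affineSpan _ hx)

theorem IsSimplicialExtension.mem_convexHull_edgeMidpoints (hL : IsSimplicialExtension T ℓ L)
    (hℓ : IsGenTuckerLabelling T ℓ) (hs : s ∈ T.K.faces) {x : EuclideanSpace ℝ (Fin 3)}
    (hx : x ∈ convexHull ℝ (s : Set (EuclideanSpace ℝ (Fin 3)))) (h0 : L x = 0) :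
    x ∈ convexHull ℝ (edgeMidpoints ℓ s : Set (EuclideanSpace ℝ (Fin 3))) := by
  obtain ⟨A, hA⟩ := hL.2 s hs
  rw [hA x hx] at h0
  obtain ⟨w, hw, hw1, rfl⟩ := Finset.mem_convexHull'.1 hx
  refine _root_.mem_convexHull_edgeMidpoints
    (fun v hv => hℓ.1 v (T.mem_vertices_of_mem hs hv)) hw hw1 ?_
  have hAv : ∀ v ∈ s, w v * ℓ v = w v * A.linear v + w v * A 0 := by
    intro v hv
    rw [← hL.1 v (T.mem_vertices_of_mem hs hv), hA v (subset_convexHull ℝ _ hv),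
      congrFun A.decomp v]
    simp [mul_add]
  rw [Finset.sum_congr rfl hAv, Finset.sum_add_distrib, ← Finset.sum_mul, hw1, ← h0,
    congrFun A.decomp (∑ v ∈ s, w v • v)]
  simp

/-- Zeros of the simplicial extension which are common to two simplices lie in the hull of the
midpoints of the common edges. -/
theorem IsSimplicialExtension.mem_convexHull_edgeMidpoints_inter
    [DecidableEq (EuclideanSpace ℝ (Fin 3))] (hL : IsSimplicialExtension T ℓ L)
    (hℓ : IsGenTuckerLabelling T ℓ) (hs : s ∈ T.K.faces) {t : Finset (EuclideanSpace ℝ (Fin 3))}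
    (ht : t ∈ T.K.faces) {x : EuclideanSpace ℝ (Fin 3)}
    (hxs : x ∈ convexHull ℝ (edgeMidpoints ℓ s : Set (EuclideanSpace ℝ (Fin 3))))
    (hxt : x ∈ convexHull ℝ (edgeMidpoints ℓ t : Set (EuclideanSpace ℝ (Fin 3)))) :
    x ∈ convexHull ℝ (edgeMidpoints ℓ (s ∩ t) : Set (EuclideanSpace ℝ (Fin 3))) := by
  have hx := T.K.inter_subset_convexHull hs ht
    ⟨convexHull_edgeMidpoints_subset ℓ s hxs, convexHull_edgeMidpoints_subset ℓ t hxt⟩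
  rw [← Finset.coe_inter] at hx
  have hne : (s ∩ t).Nonempty := by
    exact Finset.coe_nonempty.1 (convexHull_nonempty_iff.1 ⟨x, hx⟩)
  exact hL.mem_convexHull_edgeMidpoints hℓ (T.K.down_closed hs Finset.inter_subset_left hne) hx
    (hL.eq_zero_of_mem_convexHull hs hxs)

end SimplicialExtension

section MidpointGraph

/-- The graph on midpoints of edges with opposite labels, two such midpoints being adjacent when
their edges lie in a common simplex. -/
def midpointGraph (T : SymmetricSphereTriangulation) (ℓ : EuclideanSpace ℝ (Fin 3) → ℝ) :
    SimpleGraph (EuclideanSpace ℝ (Fin 3)) where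
  Adj x y := x ≠ y ∧ ∃ s ∈ T.K.faces, x ∈ edgeMidpoints ℓ s ∧ y ∈ edgeMidpoints ℓ s
  symm := ⟨fun _ _ h => ⟨h.1.symm, h.2.imp fun _ hs => ⟨hs.1, hs.2.2, hs.2.1⟩⟩⟩
  loopless := ⟨fun _ h => h.1 rfl⟩

variable {T : SymmetricSphereTriangulation} {ℓ L : EuclideanSpace ℝ (Fin 3) → ℝ}

theorem reachable_of_mem_edgeMidpoints {s : Finset (EuclideanSpace ℝ (Fin 3))}
    (hs : s ∈ T.K.faces) {x y : EuclideanSpace ℝ (Fin 3)} (hx : x ∈ edgeMidpoints ℓ s)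
    (hy : y ∈ edgeMidpoints ℓ s) : (midpointGraph T ℓ).Reachable x y := by
  by_cases h : x = y
  · rw [h]
  · exact SimpleGraph.Adj.reachable ⟨h, s, hs, hx, hy⟩

/-- The antipodal map, as an endomorphism of the midpoint graph. -/
def midpointGraphNeg (hℓ : IsGenTuckerLabelling T ℓ) : midpointGraph T ℓ →g midpointGraph T ℓ where
  toFun x := -x
  map_rel' := by
    rintro x y ⟨hne, s, hs, hx, hy⟩
    obtain ⟨t, ht, -, hst⟩ := T.exists_neg_face hs
    exact ⟨neg_injective.ne hne, t, ht, hℓ.neg_mem_edgeMidpoints hs hst hx,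
      hℓ.neg_mem_edgeMidpoints hs hst hy⟩

/-- The part of the zero set spanned by the midpoints satisfying `χ`. -/
def zeroRegion (T : SymmetricSphereTriangulation) (ℓ : EuclideanSpace ℝ (Fin 3) → ℝ)
    (χ : EuclideanSpace ℝ (Fin 3) → Prop) : Set (EuclideanSpace ℝ (Fin 3)) :=
  ⋃ s ∈ {s ∈ T.K.faces | ∃ m ∈ edgeMidpoints ℓ s, χ m},
    convexHull ℝ (edgeMidpoints ℓ s : Set (EuclideanSpace ℝ (Fin 3)))

theorem mem_zeroRegion {χ : EuclideanSpace ℝ (Fin 3) → Prop} {x : EuclideanSpace ℝ (Fin 3)} :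
    x ∈ zeroRegion T ℓ χ ↔ ∃ s ∈ T.K.faces, (∃ m ∈ edgeMidpoints ℓ s, χ m) ∧
      x ∈ convexHull ℝ (edgeMidpoints ℓ s : Set (EuclideanSpace ℝ (Fin 3))) := by
  simp only [zeroRegion, Set.mem_iUnion, Set.mem_sep_iff, exists_prop, and_assoc]

theorem isClosed_zeroRegion (T : SymmetricSphereTriangulation)
    (ℓ : EuclideanSpace ℝ (Fin 3) → ℝ) (χ : EuclideanSpace ℝ (Fin 3) → Prop) :
    IsClosed (zeroRegion T ℓ χ) :=
  (T.finite.subset (Set.sep_subset _ _)).isClosed_biUnion fun s _ =>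
    ((edgeMidpoints ℓ s).finite_toSet.isCompact_convexHull ℝ).isClosed

theorem neg_mem_zeroRegion (hℓ : IsGenTuckerLabelling T ℓ)
    {χ χ' : EuclideanSpace ℝ (Fin 3) → Prop}
    (hχ : ∀ s ∈ T.K.faces, ∀ m ∈ edgeMidpoints ℓ s, χ m → χ' (-m))
    {x : EuclideanSpace ℝ (Fin 3)} (hx : x ∈ zeroRegion T ℓ χ) : -x ∈ zeroRegion T ℓ χ' := by
  obtain ⟨s, hs, ⟨m, hm, hχm⟩, hxs⟩ := mem_zeroRegion.1 hx
  obtain ⟨t, ht, -, hst⟩ := T.exists_neg_face hs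
  refine mem_zeroRegion.2
    ⟨t, ht, ⟨-m, hℓ.neg_mem_edgeMidpoints hs hst hm, hχ s hs m hm hχm⟩, ?_⟩
  rw [← Set.mem_neg, ← convexHull_neg]
  refine convexHull_mono (fun y hy => ?_) hxs
  exact Finset.mem_coe.2 (hℓ.neg_mem_edgeMidpoints hs hst hy)

/-- Some midpoint is connected to its antipode in the midpoint graph. -/
theorem exists_reachable_neg (hℓ : IsGenTuckerLabelling T ℓ) (hL : IsSimplicialExtension T ℓ L) :
    ∃ s ∈ T.K.faces, ∃ m ∈ edgeMidpoints ℓ s, (midpointGraph T ℓ).Reachable m (-m) := by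
  classical
  by_contra! hno
  set comp := (midpointGraph T ℓ).connectedComponentMk with hcomp
  let χ : EuclideanSpace ℝ (Fin 3) → Prop := fun m => WellOrderingRel (comp m) (comp (-m))
  have hχcongr : ∀ m m', (midpointGraph T ℓ).Reachable m m' → (χ m → χ m') := by
    intro m m' h
    have h1 : comp m = comp m' := SimpleGraph.ConnectedComponent.eq.2 h
    have h2 : comp (-m) = comp (-m') :=
      SimpleGraph.ConnectedComponent.eq.2 (h.map (midpointGraphNeg hℓ))
    simp only [χ, h1, h2, imp_self]
  have hχneg : ∀ s ∈ T.K.faces, ∀ m ∈ edgeMidpoints ℓ s, χ m → ¬χ (-m) := by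
    intro s hs m hm h h'
    simp only [χ, neg_neg] at h h'
    exact asymm h h'
  have hχneg' : ∀ s ∈ T.K.faces, ∀ m ∈ edgeMidpoints ℓ s, ¬χ m → χ (-m) := by
    intro s hs m hm h
    simp only [χ, neg_neg] at h ⊢
    rcases trichotomous_of WellOrderingRel (comp m) (comp (-m)) with h1 | h1 | h1
    · exact absurd h1 h
    · exact absurd (SimpleGraph.ConnectedComponent.eq.1 h1) (hno s hs m hm)
    · exact h1
  set A := zeroRegion T ℓ χ
  set B := zeroRegion T ℓ fun m => ¬χ m
  have hA : IsClosed A := isClosed_zeroRegion T ℓ _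
  have hB : IsClosed B := isClosed_zeroRegion T ℓ _
  have hAB : ∀ x ∈ A, -x ∈ B := fun x => neg_mem_zeroRegion hℓ hχneg
  have hBA : ∀ x ∈ B, -x ∈ A := fun x => neg_mem_zeroRegion hℓ hχneg'
  have hdisj : ∀ x ∈ A, x ∉ B := by
    intro x hxA hxB
    obtain ⟨s, hs, ⟨m, hm, hχm⟩, hxs⟩ := mem_zeroRegion.1 hxA
    obtain ⟨t, ht, ⟨m', hm', hχm'⟩, hxt⟩ := mem_zeroRegion.1 hxB
    obtain ⟨k, hk⟩ := convexHull_nonempty_iff.1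
      ⟨x, hL.mem_convexHull_edgeMidpoints_inter hℓ hs ht hxs hxt⟩
    have hk1 := edgeMidpoints_mono ℓ Finset.inter_subset_left hk
    have hk2 := edgeMidpoints_mono ℓ Finset.inter_subset_right hk
    exact hχm' (hχcongr _ _ ((reachable_of_mem_edgeMidpoints hs hm hk1).trans
      (reachable_of_mem_edgeMidpoints ht hk2 hm')) hχm)
  have hcover : ∀ x ∈ T.K.space, L x = 0 → x ∈ A ∨ x ∈ B := by
    intro x hx h0
    obtain ⟨s, hs, hxs⟩ := T.K.mem_space_iff.1 hx
    have hxM := hL.mem_convexHull_edgeMidpoints hℓ hs hxs h0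
    obtain ⟨m, hm⟩ := convexHull_nonempty_iff.1 ⟨x, hxM⟩
    by_cases h : χ m
    · exact .inl (mem_zeroRegion.2 ⟨s, hs, ⟨m, hm, h⟩, hxM⟩)
    · exact .inr (mem_zeroRegion.2 ⟨s, hs, ⟨m, hm, h⟩, hxM⟩)
  have hBeq : B = (fun x => -x) '' A := by
    ext x
    exact ⟨fun hx => ⟨-x, hBA x hx, neg_neg x⟩, by rintro ⟨y, hy, rfl⟩; exact hAB y hy⟩
  have hdist : ∀ x, Metric.infDist (-x) B = Metric.infDist x A := by
    intro x
    rw [hBeq]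
    exact Metric.infDist_image (LinearIsometryEquiv.neg ℝ).isometry
  have hdist' : ∀ x, Metric.infDist (-x) A = Metric.infDist x B := by
    intro x
    rw [← hdist, neg_neg]
  let F : EuclideanSpace ℝ (Fin 3) → ℂ := fun x =>
    (L x : ℂ) + ((Metric.infDist x B - Metric.infDist x A : ℝ) : ℂ) * Complex.I
  have hFc : ContinuousOn F T.K.space := by
    refine (Complex.continuous_ofReal.comp_continuousOn hL.continuousOn).add
      (Continuous.continuousOn ?_)
    exact (Complex.continuous_ofReal.comp ((Metric.continuous_infDist_pt B).sub
      (Metric.continuous_infDist_pt A))).mul continuous_const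
  obtain ⟨x, hx, h0⟩ := T.exists_eq_zero_of_odd hFc fun x hx => by
    simp only [F, hL.map_neg hℓ hx, hdist, hdist']
    push_cast
    ring
  have hre := congrArg Complex.re h0
  have him := congrArg Complex.im h0
  simp [F] at hre him
  rcases hcover x hx hre with h | h
  · have := (hB.notMem_iff_infDist_pos ⟨_, hAB x h⟩).1 (hdisj x h)
    rw [Metric.infDist_zero_of_mem h] at him
    linarith
  · have := (hA.notMem_iff_infDist_pos ⟨_, hBA x h⟩).1 fun h' => hdisj x h' h
    rw [Metric.infDist_zero_of_mem h] at him
    linarith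

theorem neg_notMem_edgeMidpoints {x : EuclideanSpace ℝ (Fin 3)}
    {s : Finset (EuclideanSpace ℝ (Fin 3))}
    (hs : s ∈ T.K.faces) (hx : x ∈ edgeMidpoints ℓ s) : -x ∉ edgeMidpoints ℓ s := by
  intro hx'
  have h := (convex_convexHull ℝ _).midpoint_mem (edgeMidpoints_subset_convexHull ℓ s hx)
    (edgeMidpoints_subset_convexHull ℓ s hx')
  rw [midpoint_self_neg] at h
  exact T.zero_not_mem (T.K.convexHull_subset_space hs h)

end MidpointGraph

/-- A finite sequence from a point to its negative extends to an antiperiodic sequence. -/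
theorem exists_antiperiodic_extension {α : Type*} [InvolutiveNeg α] (y : ℕ → α) {n : ℕ}
    (hn : 0 < n) (hy : y n = -y 0) :
    ∃ q : ℤ → α, q 0 = y 0 ∧ Function.Antiperiodic q (n : ℤ) ∧
      ∀ k, ∃ i < n, (q k = y i ∧ q (k + 1) = y (i + 1)) ∨
        (q k = -y i ∧ q (k + 1) = -y (i + 1)) := by
  have hn' : (n : ℤ) ≠ 0 := by omega
  refine ⟨fun k => if Even (k / n) then y (k % n).toNat else -y (k % n).toNat, by simp, ?_, ?_⟩
  · intro k
    have hq : (k + n) / n = k / n + 1 := by simpa using Int.add_mul_ediv_right k 1 hn'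
    simp only [hq, Int.add_emod_right, Int.even_add_one]
    by_cases hev : Even (k / n) <;> simp [hev]
  · intro k
    have h1 := Int.emod_nonneg k hn'
    have h2 := Int.emod_lt_of_pos k (by omega : (0 : ℤ) < n)
    have h3 := Int.mul_ediv_add_emod k n
    refine ⟨(k % n).toNat, by omega, ?_⟩
    by_cases hlast : k % n + 1 = n
    · have e : k + 1 = 0 + (k / n + 1) * n := by linarith
      have hq : (k + 1) / n = k / n + 1 := by rw [e, Int.add_mul_ediv_right _ _ hn']; simp
      have hr : (k + 1) % n = 0 := by rw [e, Int.add_mul_emod_self_right]; simp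
      have hi : (k % n).toNat + 1 = n := by omega
      simp only [hq, hr, hi, hy, Int.even_add_one]
      by_cases hev : Even (k / n) <;> simp [hev]
    · have e : k + 1 = (k % n + 1) + (k / n) * n := by linarith
      have hz : (k % n + 1) / n = 0 := Int.ediv_eq_zero_of_lt (by omega) (by omega)
      have hq : (k + 1) / n = k / n := by rw [e, Int.add_mul_ediv_right _ _ hn', hz, zero_add]
      have hr : (k + 1) % n = k % n + 1 := by
        rw [e, Int.add_mul_emod_self_right, Int.emod_eq_of_lt (by omega) (by omega)]
      have hi : (k % n + 1).toNat = (k % n).toNat + 1 := by omega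
      simp only [hq, hr, hi]
      by_cases hev : Even (k / n) <;> simp [hev]

/-- A shortest walk of the midpoint graph from a midpoint to its antipode closes up, together with
its image under the antipodal map, to a simple closed polygon. -/
theorem exists_antiperiodic_midpoint_polygon {T : SymmetricSphereTriangulation}
    {ℓ L : EuclideanSpace ℝ (Fin 3) → ℝ} (hℓ : IsGenTuckerLabelling T ℓ)
    (hL : IsSimplicialExtension T ℓ L) :
    ∃ (n : ℕ) (q : ℤ → EuclideanSpace ℝ (Fin 3)), 2 ≤ n ∧ Function.Antiperiodic q (n : ℤ) ∧
      (∀ k, (midpointGraph T ℓ).Adj (q k) (q (k + 1))) ∧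
      ∀ i j, q i = q j → i ≡ j [ZMOD (2 * n : ℕ)] := by
  classical
  have hex : ∃ n : ℕ, ∃ s ∈ T.K.faces, ∃ m ∈ edgeMidpoints ℓ s,
      ∃ w : (midpointGraph T ℓ).Walk m (-m), w.length = n := by
    obtain ⟨s, hs, m, hm, ⟨w⟩⟩ := exists_reachable_neg hℓ hL
    exact ⟨w.length, s, hs, m, hm, w, rfl⟩
  obtain ⟨s, hs, m, hm, w, hw⟩ := Nat.find_spec hex
  have hmin : ∀ s ∈ T.K.faces, ∀ m ∈ edgeMidpoints ℓ s,
      ∀ w : (midpointGraph T ℓ).Walk m (-m), Nat.find hex ≤ w.length :=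
    fun s hs m hm w => Nat.find_min' hex ⟨s, hs, m, hm, w, rfl⟩
  generalize Nat.find hex = n at hw hmin
  have hn : 2 ≤ n := by
    by_contra! hlt
    interval_cases n
    · have := SimpleGraph.Walk.eq_of_length_eq_zero hw
      exact neg_notMem_edgeMidpoints hs hm (this ▸ hm)
    · obtain ⟨-, t, ht, h1, h2⟩ := SimpleGraph.Walk.adj_of_length_eq_one hw
      exact neg_notMem_edgeMidpoints ht h1 h2
  obtain ⟨q, -, hanti, hstep⟩ := exists_antiperiodic_extension w.getVert (n := n) (by omega)
    (by rw [← hw, w.getVert_length, w.getVert_zero])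
  have hadj : ∀ k, (midpointGraph T ℓ).Adj (q k) (q (k + 1)) := by
    intro k
    obtain ⟨i, hi, ⟨h1, h2⟩ | ⟨h1, h2⟩⟩ := hstep k
    · rw [h1, h2]
      exact w.adj_getVert_succ (by omega)
    · rw [h1, h2]
      exact (midpointGraphNeg hℓ).map_adj (w.adj_getVert_succ (by omega))
  have hwalk : ∀ (k : ℤ) (d : ℕ), ∃ w : (midpointGraph T ℓ).Walk (q k) (q (k + d)),
      w.length = d := by
    intro k d
    induction d with
    | zero => exact ⟨SimpleGraph.Walk.nil.copy rfl (by simp), by simp⟩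
    | succ d ih =>
      obtain ⟨w, hw⟩ := ih
      refine ⟨(w.concat (hadj _)).copy rfl (by push_cast; rw [add_assoc]), ?_⟩
      simp [hw]
  have hlong : ∀ (i j : ℤ), i ≤ j → q j = -q i → (n : ℤ) ≤ j - i := by
    intro i j hij h
    obtain ⟨d, rfl⟩ := Int.le.dest hij
    obtain ⟨-, t, ht, h1, -⟩ := hadj i
    obtain ⟨w, hw⟩ := hwalk i d
    have := hmin t ht _ h1 (w.copy rfl h)
    rw [SimpleGraph.Walk.length_copy] at this
    omega
  have hper : Function.Periodic q ((2 * n : ℕ) : ℤ) := by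
    simpa using hanti.periodic_two_mul
  have hne : ∀ (i j : ℤ), i < j → j < i + (2 * n : ℕ) → q i ≠ q j := by
    intro i j h1 h2 h
    rcases le_or_gt j (i + n) with h3 | h3
    · have := hlong j (i + n) h3 (by rw [hanti, h])
      omega
    · have := hlong (i + n) j h3.le (by rw [hanti, neg_neg, h])
      push_cast at h2
      omega
  refine ⟨n, q, hn, hanti, hadj, fun i j h => ?_⟩
  have hpos : (0 : ℤ) < (2 * n : ℕ) := by omega
  have hmod : ∀ k, q (k % (2 * n : ℕ)) = q k := by
    intro k
    rw [Int.emod_def, mul_comm]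
    simpa using hper.sub_int_mul_eq (x := k) (k / (2 * n : ℕ))
  have hi1 := Int.emod_nonneg i hpos.ne'
  have hi2 := Int.emod_lt_of_pos i hpos
  have hj1 := Int.emod_nonneg j hpos.ne'
  have hj2 := Int.emod_lt_of_pos j hpos
  rw [← hmod i, ← hmod j] at h
  rcases lt_trichotomy (i % (2 * n : ℕ)) (j % (2 * n : ℕ)) with h1 | h1 | h1
  · exact absurd h (hne _ _ h1 (by omega))
  · exact h1
  · exact absurd h.symm (hne _ _ h1 (by omega))

/-- Main theorem (combinatorial analog of Dyson's theorem): for any generalized Tucker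
labelling of a finite symmetric triangulation of `S²`, the zero set of the simplicial
extension contains an antipodally invariant polygonal simple closed path. -/
theorem invariant_polygonal_path (T : SymmetricSphereTriangulation)
    (ℓ L : EuclideanSpace ℝ (Fin 3) → ℝ)
    (hℓ : IsGenTuckerLabelling T ℓ) (hL : IsSimplicialExtension T ℓ L) :
    ∃ P : Set (EuclideanSpace ℝ (Fin 3)),
      P ⊆ T.K.space ∧ IsPolygonalSimpleClosedPath P ∧
      (∀ x ∈ P, L x = 0) ∧ ((fun x => -x) '' P = P) := by
  classical
  obtain ⟨n, q, hn, hanti, hadj, hinj⟩ := exists_antiperiodic_midpoint_polygon hℓ hL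
  have hper : Function.Periodic q ((2 * n : ℕ) : ℤ) := by
    simpa using hanti.periodic_two_mul
  have hface : ∀ k, ∃ s ∈ T.K.faces, edgeMidpoints ℓ s = {q k, q (k + 1)} := by
    intro k
    obtain ⟨hne, s, hs, h1, h2⟩ := hadj k
    refine ⟨s, hs, (Finset.eq_of_subset_of_card_le ?_ ?_).symm⟩
    · simp [Finset.insert_subset_iff, h1, h2]
    · rw [Finset.card_pair hne]
      exact card_edgeMidpoints_le_two ℓ (T.card_face_le hs)
  choose s hs hM using hface
  have hseg : ∀ k, segment ℝ (q k) (q (k + 1)) =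
      convexHull ℝ (edgeMidpoints ℓ (s k) : Set (EuclideanSpace ℝ (Fin 3))) := by
    intro k
    rw [hM, Finset.coe_pair, convexHull_pair]
  have hmeet : EdgesMeetAtVertices q (2 * n) := by
    intro i j z hzi hzj
    by_cases hij : s i = s j
    · left
      have hpair := hM i
      rw [hij, hM j] at hpair
      have h1 : q i ∈ ({q j, q (j + 1)} : Finset _) := by rw [hpair]; simp
      have h2 : q j ∈ ({q i, q (i + 1)} : Finset _) := by rw [← hpair]; simp
      rw [Finset.mem_insert, Finset.mem_singleton] at h1 h2
      rcases h1 with h1 | h1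
      · exact hinj _ _ h1
      rcases h2 with h2 | h2
      · exact (hinj _ _ h2).symm
      exfalso
      have h3 := (hinj _ _ h1).dvd
      have h4 := (hinj _ _ h2).dvd
      have h5 := Int.le_of_dvd (by omega) (dvd_add h3 h4)
      push_cast at h5
      omega
    · right
      rw [hseg] at hzi hzj
      have hz := hL.mem_convexHull_edgeMidpoints_inter hℓ (hs i) (hs j) hzi hzj
      have hcard : (s i ∩ s j).card ≤ 2 := by
        by_contra! h
        have h1 := Finset.eq_of_subset_of_card_le Finset.inter_subset_left
          ((T.card_face_le (hs i)).trans h)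
        have h2 := Finset.eq_of_subset_of_card_le Finset.inter_subset_right
          ((T.card_face_le (hs j)).trans h)
        exact hij (h1.symm.trans h2)
      obtain ⟨k, hk⟩ := convexHull_nonempty_iff.1 ⟨z, hz⟩
      have hsingle : edgeMidpoints ℓ (s i ∩ s j) = {k} :=
        Finset.eq_singleton_iff_unique_mem.2 ⟨hk, fun x hx =>
          Finset.card_le_one.1 (card_edgeMidpoints_le_one ℓ hcard) x hx k hk⟩
      rw [hsingle, Finset.coe_singleton, convexHull_singleton, Set.mem_singleton_iff] at hz
      subst hz
      have h1 := edgeMidpoints_mono ℓ Finset.inter_subset_left hk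
      have h2 := edgeMidpoints_mono ℓ Finset.inter_subset_right hk
      rw [hM, Finset.mem_insert, Finset.mem_singleton] at h1 h2
      exact ⟨h1, h2⟩
  refine ⟨⋃ k, segment ℝ (q k) (q (k + 1)), Set.iUnion_subset fun k => ?_,
    isPolygonalSimpleClosedPath_iUnion_segment (by omega) hper hinj hmeet, fun x hx => ?_, ?_⟩
  · rw [hseg]
    exact (convexHull_edgeMidpoints_subset ℓ _).trans (T.K.convexHull_subset_space (hs k))
  · obtain ⟨k, hk⟩ := Set.mem_iUnion.1 hx
    rw [hseg] at hk
    exact hL.eq_zero_of_mem_convexHull (hs k) hk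
  · rw [Set.image_iUnion]
    have himage : ∀ k, (fun x => -x) '' segment ℝ (q k) (q (k + 1)) =
        segment ℝ (q (k + n)) (q (k + n + 1)) := by
      intro k
      rw [hanti, add_right_comm, hanti]
      exact image_segment ℝ (-LinearMap.id : _ →ₗ[ℝ] _).toAffineMap _ _
    simp only [himage]
    exact (Equiv.addRight (n : ℤ)).surjective.iUnion_comp
      fun k => segment ℝ (q k) (q (k + 1))
end
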